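/- Let (Ω, μ) be a probability space, M ≥ 0, and n ∈ ℕ. The couple (V^1_{≤M}(Ω^n, L^1(ℝ)), V^1_{≤M}(Ω^n, L^2(ℝ))) is K-closed in (L^1(Ω^n, L^1(ℝ)), L^1(Ω^n, L^2(ℝ))) with a constant depending only on M and not on n. That is, there is a constant C = C(M) such that for every f ∈ V^1_{≤M}(Ω^n, L^1(ℝ)) + V^1_{≤M}(Ω^n, L^2(ℝ)), every t > 0, and every decomposition f = f_0 + f_1 with f_0 ∈ L^1(Ω^n, L^1(ℝ)) and f_1 ∈ L^1(Ω^n, L^2(ℝ)), there exists a decomposition f = g_0 + g_1 with g_0 ∈ V^1_{≤M}(Ω^n, L^1(ℝ)), g_1 ∈ V^1_{≤M}(Ω^n, L^2(ℝ)), and ‖g_0‖_{L^1(Ω^n,L^1(ℝ))} + t ‖g_1‖_{L^1(Ω^n,L^2(ℝ))} ≤ C (‖f_0‖_{L^1(Ω^n,L^1(ℝ))} + t ‖f_1‖_{L^1(Ω^n,L^2(ℝ))}). -/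

import Mathlib

open MeasureTheory
open scoped ENNReal

universe u

variable {Ω : Type u} [MeasurableSpace Ω]

/-- The norm of `L¹(Ω^n, L¹(ℝ))`. -/
noncomputable def normL1L1R (μ : Measure Ω) {n : ℕ} (F : (Fin n → Ω) → ℝ → ℝ) : ℝ≥0∞ :=
  ∫⁻ x : Fin n → Ω, ∫⁻ s : ℝ, ENNReal.ofReal |F x s| ∂volume ∂Measure.pi fun _ => μ

/-- The norm of `L¹(Ω^n, L²(ℝ))`. -/
noncomputable def normL1L2R (μ : Measure Ω) {n : ℕ} (F : (Fin n → Ω) → ℝ → ℝ) : ℝ≥0∞ :=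
  ∫⁻ x : Fin n → Ω, (∫⁻ s : ℝ, ENNReal.ofReal (F x s ^ 2) ∂volume) ^ ((1:ℝ)/2)
    ∂Measure.pi fun _ => μ

/-- Membership in `V^1_{≤M}(Ω^n, B)`: the closure, in the Bochner norm `N` (either
`L¹(Ω^n,L¹(ℝ))` or `L¹(Ω^n,L²(ℝ))`), of the span of functions
`x ↦ ∑_{m ≤ M} ∑_{i₁<⋯<i_m} g m i (x_{i₁},…,x_{i_m})` whose components are of mean zero
in each variable. -/
def MemV1leM (μ : Measure Ω) (M : ℕ) {n : ℕ}
    (N : ((Fin n → Ω) → ℝ → ℝ) → ℝ≥0∞) (F : (Fin n → Ω) → ℝ → ℝ) : Prop :=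
  Measurable (Function.uncurry F) ∧ N F < ⊤ ∧
  ∀ ε : ℝ, 0 < ε →
    ∃ g : (m : ℕ) → (Fin m → Fin n) → (Fin m → Ω) → ℝ → ℝ,
      (∀ m i, Measurable (Function.uncurry (g m i))) ∧
      (∀ m i, ¬ StrictMono i → g m i = 0) ∧
      (∀ m (i : Fin m → Fin n) (k : Fin m), ∀ᵐ s ∂(volume : Measure ℝ),
        ∀ᵐ y ∂(Measure.pi fun _ : Fin m => μ),
          ∫ z, g m i (Function.update y k z) s ∂μ = 0) ∧
      (∀ m i, N (fun x s => g m i (fun k => x (i k)) s) < ⊤) ∧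
      N (fun x s => F x s - ∑ m ∈ Finset.range (M + 1),
          ∑ i : Fin m → Fin n, g m i (fun k => x (i k)) s) ≤ ENNReal.ofReal ε



section numeric
set_option linter.unusedSectionVars false
open Finset

variable {ι : Type*} [DecidableEq ι]

lemma kc_icc_sum (a b : ℝ) (L J : Finset ι) (h : L ⊆ J) :
    ∑ I ∈ J.powerset with L ⊆ I, a ^ I.card * b ^ (J.card - I.card)
      = a ^ L.card * (a + b) ^ (J.card - L.card) := by
  have e : (J.powerset.filter (fun I => L ⊆ I)) = (J \ L).powerset.image (fun A => L ∪ A) := by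
    rw [← Finset.Icc_eq_image_powerset h]
    ext I; simp [and_comm]
  rw [e, Finset.sum_image]
  · have hc : (J \ L).card = J.card - L.card := Finset.card_sdiff_of_subset h
    rw [← hc, ← Finset.sum_pow_mul_eq_add_pow, Finset.mul_sum]
    apply Finset.sum_congr rfl
    intro A hA
    have hA' := Finset.mem_powerset.1 hA
    have hd : Disjoint L A := Finset.disjoint_left.2 fun x hx hx' =>
      (Finset.mem_sdiff.1 (hA' hx')).2 hx
    rw [Finset.card_union_of_disjoint hd, pow_add, mul_assoc]
    congr 3
    omega
  · intro A hA B hB hAB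
    have hA' := Finset.mem_powerset.1 (Finset.mem_coe.1 hA)
    have hB' := Finset.mem_powerset.1 (Finset.mem_coe.1 hB)
    have hdA : Disjoint L A := Finset.disjoint_left.2 fun x hx hx' =>
      (Finset.mem_sdiff.1 (hA' hx')).2 hx
    have hdB : Disjoint L B := Finset.disjoint_left.2 fun x hx hx' =>
      (Finset.mem_sdiff.1 (hB' hx')).2 hx
    have := congrArg (fun s => s \ L) hAB
    simpa [Finset.union_sdiff_left, Finset.sdiff_eq_self_of_disjoint hdA.symm,
      Finset.sdiff_eq_self_of_disjoint hdB.symm] using this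

/-- Moebius transform. -/
noncomputable def kcM (α : Finset ι → ℝ) (I : Finset ι) : ℝ :=
  ∑ J ∈ I.powerset, (-1) ^ (I.card + J.card) * α J

lemma kcM_inv (α : Finset ι → ℝ) (J : Finset ι) :
    ∑ I ∈ J.powerset, kcM α I = α J := by
  have h1 : ∑ I ∈ J.powerset, kcM α I =
      ∑ L ∈ J.powerset, ∑ I ∈ J.powerset with L ⊆ I, (-1) ^ (I.card + L.card) * α L := by
    unfold kcM
    apply Finset.sum_comm'
    intro x y
    simp only [mem_powerset, mem_filter]
    constructor
    · rintro ⟨h, h'⟩; exact ⟨⟨h, h'⟩, h'.trans h⟩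
    · rintro ⟨⟨h, h'⟩, _⟩; exact ⟨h, h'⟩
  have h2 : ∀ L ∈ J.powerset,
      ∑ I ∈ J.powerset with L ⊆ I, (-1 : ℝ) ^ (I.card + L.card) * α L
        = if L = J then α J else 0 := by
    intro L hL
    have hL' := mem_powerset.1 hL
    have := kc_icc_sum (-1) 1 L J hL'
    simp only [one_pow, mul_one, neg_add_cancel] at this
    have e : ∑ I ∈ J.powerset with L ⊆ I, (-1 : ℝ) ^ (I.card + L.card) * α L
        = (∑ I ∈ J.powerset with L ⊆ I, (-1 : ℝ) ^ I.card) * ((-1) ^ L.card * α L) := by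
      rw [Finset.sum_mul]
      apply Finset.sum_congr rfl
      intro I _
      rw [pow_add]; ring
    rw [e, this]
    by_cases hLJ : L = J
    · subst hLJ
      simp [← mul_assoc, ← mul_pow]
    · have : J.card - L.card ≠ 0 := by
        have := Finset.card_lt_card (Finset.ssubset_iff_subset_ne.2 ⟨hL', hLJ⟩)
        omega
      simp [hLJ, this]
  rw [h1, Finset.sum_congr rfl h2]
  simp

lemma kc_bonami (U : Finset ι) : ∀ c : Finset ι → ℝ,
    ∑ S ∈ U.powerset, (∑ I ∈ U.powerset, (-1) ^ (I ∩ S).card * c I) ^ 4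
      ≤ 2 ^ U.card * (∑ I ∈ U.powerset, 3 ^ I.card * c I ^ 2) ^ 2 := by
  induction U using Finset.induction_on with
  | empty => intro c; simp; nlinarith [sq_nonneg (c ∅)]
  | insert i U hi ih =>
    intro c
    set b : Finset ι → ℝ := fun I => c (insert i I)
    have hA := ih c
    have hB := ih b
    set A := ∑ I ∈ U.powerset, (3:ℝ) ^ I.card * c I ^ 2
    set B := ∑ I ∈ U.powerset, (3:ℝ) ^ I.card * b I ^ 2
    have hA0 : 0 ≤ A := Finset.sum_nonneg fun _ _ => by positivity
    have hB0 : 0 ≤ B := Finset.sum_nonneg fun _ _ => by positivity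
    set f : Finset ι → ℝ := fun S => ∑ I ∈ U.powerset, (-1) ^ (I ∩ S).card * c I
    set g : Finset ι → ℝ := fun S => ∑ I ∈ U.powerset, (-1) ^ (I ∩ S).card * b I
    have e1 : ∀ S ∈ U.powerset, (∑ I ∈ (insert i U).powerset, (-1) ^ (I ∩ S).card * c I)
        = f S + g S := by
      intro S hS
      have hiS : i ∉ S := fun h => hi (mem_powerset.1 hS h)
      rw [Finset.sum_powerset_insert hi]
      congr 1
      apply Finset.sum_congr rfl
      intro I hI
      rw [Finset.insert_inter_of_notMem hiS]
    have e2 : ∀ S ∈ U.powerset, (∑ I ∈ (insert i U).powerset,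
        (-1) ^ (I ∩ insert i S).card * c I) = f S - g S := by
      intro S hS
      have hiS : i ∉ S := fun h => hi (mem_powerset.1 hS h)
      rw [Finset.sum_powerset_insert hi, sub_eq_add_neg]
      simp only [f, g, ← Finset.sum_neg_distrib]
      congr 1
      · apply Finset.sum_congr rfl
        intro I hI
        have hiI : i ∉ I := fun h => hi (mem_powerset.1 hI h)
        rw [Finset.inter_insert_of_notMem hiI]
      · apply Finset.sum_congr rfl
        intro I hI
        have hiI : i ∉ I := fun h => hi (mem_powerset.1 hI h)
        rw [← Finset.insert_inter_distrib, Finset.card_insert_of_notMem (by simp [hiI]), pow_succ]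
        simp [b]
    have e3 : ∑ I ∈ (insert i U).powerset, (3:ℝ) ^ I.card * c I ^ 2 = A + 3 * B := by
      rw [Finset.sum_powerset_insert hi, Finset.mul_sum]
      congr 1
      apply Finset.sum_congr rfl
      intro I hI
      have hiI : i ∉ I := fun h => hi (mem_powerset.1 hI h)
      rw [Finset.card_insert_of_notMem hiI, pow_succ]; ring
    rw [Finset.sum_powerset_insert hi, e3, Finset.card_insert_of_notMem hi,
      ← Finset.sum_add_distrib]
    rw [Finset.sum_congr rfl (g := fun S => (f S + g S) ^ 4 + (f S - g S) ^ 4)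
      (fun S hS => by rw [e1 S hS, e2 S hS])]
    have e4 : ∑ S ∈ U.powerset, ((f S + g S) ^ 4 + (f S - g S) ^ 4)
        = 2 * ∑ S ∈ U.powerset, f S ^ 4 + 12 * ∑ S ∈ U.powerset, f S ^ 2 * g S ^ 2
          + 2 * ∑ S ∈ U.powerset, g S ^ 4 := by
      simp only [Finset.mul_sum, ← Finset.sum_add_distrib]
      apply Finset.sum_congr rfl
      intro S _; ring
    rw [e4]
    have hcs := Finset.sum_mul_sq_le_sq_mul_sq U.powerset (fun S => f S ^ 2) (fun S => g S ^ 2)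
    simp only [← pow_mul] at hcs
    norm_num at hcs
    set N : ℝ := 2 ^ U.card
    have hN : 0 < N := by positivity
    have hfg : ∑ S ∈ U.powerset, f S ^ 2 * g S ^ 2 ≤ N * (A * B) := by
      rw [← sq_le_sq₀ (Finset.sum_nonneg fun _ _ => by positivity) (by positivity)]
      calc _ ≤ _ := hcs
        _ ≤ (N * A ^ 2) * (N * B ^ 2) := by
            apply mul_le_mul hA hB (Finset.sum_nonneg fun _ _ => by positivity) (by positivity)
        _ = _ := by ring
    rw [pow_succ]
    have : 0 ≤ N * B^2 := by positivity
    change 2 * ∑ S ∈ U.powerset, f S ^ 4 + _ + 2 * ∑ S ∈ U.powerset, g S ^ 4 ≤ _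
    change ∑ S ∈ U.powerset, f S ^ 4 ≤ _ at hA
    change ∑ S ∈ U.powerset, g S ^ 4 ≤ _ at hB
    nlinarith

lemma kc_parseval (U : Finset ι) : ∀ c : Finset ι → ℝ,
    ∑ S ∈ U.powerset, (∑ I ∈ U.powerset, (-1) ^ (I ∩ S).card * c I) ^ 2
      = 2 ^ U.card * (∑ I ∈ U.powerset, c I ^ 2) := by
  induction U using Finset.induction_on with
  | empty => intro c; simp
  | insert i U hi ih =>
    intro c
    set b : Finset ι → ℝ := fun I => c (insert i I)
    have hA := ih c
    have hB := ih b
    set f : Finset ι → ℝ := fun S => ∑ I ∈ U.powerset, (-1) ^ (I ∩ S).card * c I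
    set g : Finset ι → ℝ := fun S => ∑ I ∈ U.powerset, (-1) ^ (I ∩ S).card * b I
    have e1 : ∀ S ∈ U.powerset, (∑ I ∈ (insert i U).powerset, (-1) ^ (I ∩ S).card * c I)
        = f S + g S := by
      intro S hS
      have hiS : i ∉ S := fun h => hi (mem_powerset.1 hS h)
      rw [Finset.sum_powerset_insert hi]
      congr 1
      apply Finset.sum_congr rfl
      intro I hI
      rw [Finset.insert_inter_of_notMem hiS]
    have e2 : ∀ S ∈ U.powerset, (∑ I ∈ (insert i U).powerset,
        (-1) ^ (I ∩ insert i S).card * c I) = f S - g S := by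
      intro S hS
      have hiS : i ∉ S := fun h => hi (mem_powerset.1 hS h)
      rw [Finset.sum_powerset_insert hi, sub_eq_add_neg]
      simp only [f, g, ← Finset.sum_neg_distrib]
      congr 1
      · apply Finset.sum_congr rfl
        intro I hI
        have hiI : i ∉ I := fun h => hi (mem_powerset.1 hI h)
        rw [Finset.inter_insert_of_notMem hiI]
      · apply Finset.sum_congr rfl
        intro I hI
        have hiI : i ∉ I := fun h => hi (mem_powerset.1 hI h)
        rw [← Finset.insert_inter_distrib, Finset.card_insert_of_notMem (by simp [hiI]), pow_succ]
        simp [b]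
    rw [Finset.sum_powerset_insert hi, Finset.card_insert_of_notMem hi,
      Finset.sum_powerset_insert hi, ← Finset.sum_add_distrib]
    rw [Finset.sum_congr rfl (g := fun S => 2 * f S ^ 2 + 2 * g S ^ 2)
      (fun S hS => by rw [e1 S hS, e2 S hS]; ring)]
    rw [Finset.sum_add_distrib, ← Finset.mul_sum, ← Finset.mul_sum]
    change ∑ S ∈ U.powerset, f S ^ 2 = _ at hA
    change ∑ S ∈ U.powerset, g S ^ 2 = _ at hB
    rw [hA, hB, pow_succ]
    simp only [b]
    ring

variable [Fintype ι]

lemma kcM_T (α : Finset ι → ℝ) (S : Finset ι) (ρ : ℝ) :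
    ∑ A ∈ S.powerset, ρ ^ A.card * (1 - ρ) ^ (S.card - A.card) * α (Sᶜ ∪ A)
      = ∑ I : Finset ι, ρ ^ (I ∩ S).card * kcM α I := by
  have h1 : ∀ A ∈ S.powerset, ρ ^ A.card * (1 - ρ) ^ (S.card - A.card) * α (Sᶜ ∪ A)
      = ∑ I : Finset ι, if I ∩ S ⊆ A then
          ρ ^ A.card * (1 - ρ) ^ (S.card - A.card) * kcM α I else 0 := by
    intro A hA
    rw [← kcM_inv α (Sᶜ ∪ A), Finset.mul_sum, ← Finset.sum_filter]
    apply Finset.sum_congr _ (fun _ _ => rfl)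
    ext I
    simp only [mem_powerset, mem_filter, mem_univ, true_and]
    constructor
    · intro h x hx
      have := h (mem_inter.1 hx).1
      simp only [mem_union, mem_compl] at this
      exact this.resolve_left (fun h => h (mem_inter.1 hx).2)
    · intro h x hx
      simp only [mem_union, mem_compl]
      by_cases hxS : x ∈ S
      · exact Or.inr (h (mem_inter.2 ⟨hx, hxS⟩))
      · exact Or.inl hxS
  rw [Finset.sum_congr rfl h1, Finset.sum_comm]
  apply Finset.sum_congr rfl
  intro I _
  rw [← Finset.sum_filter, ← Finset.sum_mul, kc_icc_sum _ _ _ _ Finset.inter_subset_right]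
  simp

lemma kcM_D (α : Finset ι → ℝ) (K : Finset ι) :
    ∑ J ∈ K.powerset, (-1) ^ J.card * α Jᶜ = ∑ I : Finset ι with K ⊆ I, kcM α I := by
  have h1 : ∀ J ∈ K.powerset, (-1 : ℝ) ^ J.card * α Jᶜ
      = ∑ I : Finset ι, if J ⊆ Iᶜ then (-1) ^ J.card * kcM α I else 0 := by
    intro J _
    rw [← kcM_inv α Jᶜ, Finset.mul_sum, ← Finset.sum_filter]
    apply Finset.sum_congr _ (fun _ _ => rfl)
    ext I
    simp only [mem_powerset, mem_filter, mem_univ, true_and]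
    rw [Finset.subset_compl_comm]
  rw [Finset.sum_congr rfl h1, Finset.sum_comm, Finset.sum_filter]
  apply Finset.sum_congr rfl
  intro I _
  have e : K.powerset.filter (fun J => J ⊆ Iᶜ) = (K \ I).powerset := by
    ext J
    simp only [mem_filter, mem_powerset, Finset.subset_iff, mem_sdiff, mem_compl]
    constructor
    · rintro ⟨h, h'⟩ x hx; exact ⟨h hx, h' hx⟩
    · intro h; exact ⟨fun x hx => (h hx).1, fun x hx => (h hx).2⟩
  rw [← Finset.sum_filter, ← Finset.sum_mul, e]
  have := Finset.sum_pow_mul_eq_add_pow (-1 : ℝ) 1 (K \ I)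
  simp only [one_pow, mul_one, neg_add_cancel] at this
  rw [this]
  by_cases h : K ⊆ I
  · simp [h, Finset.sdiff_eq_empty_iff_subset.2 h]
  · have : (K \ I).card ≠ 0 := by
      rw [Finset.card_ne_zero]; exact Finset.sdiff_nonempty.2 h
    simp [h, this]

/-- if `α` only depends on `J ∩ I`, the Moebius transform vanishes off subsets of `I`. -/
lemma kcM_eq_zero (α : Finset ι → ℝ) (I L : Finset ι) (h : ∀ J, α J = α (J ∩ I))
    (hL : ¬ L ⊆ I) : kcM α L = 0 := by
  obtain ⟨i, hiL, hiI⟩ := Finset.not_subset.1 hL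
  unfold kcM
  rw [← Finset.insert_erase hiL, Finset.sum_powerset_insert (Finset.notMem_erase _ _),
    ← Finset.sum_add_distrib]
  apply Finset.sum_eq_zero
  intro J hJ
  have hiJ : i ∉ J := fun h => Finset.notMem_erase i L (mem_powerset.1 hJ h)
  rw [Finset.card_insert_of_notMem hiJ, h (insert i J), Finset.insert_inter_of_notMem hiI,
    ← h J]
  ring


lemma kc_interp (M : ℕ) : ∃ l ρ : ℕ → ℝ, (∀ r, 0 ≤ ρ r ∧ ρ r ≤ 1) ∧
    ∀ k ≤ M, ∑ r ∈ range (M + 1), l r * ρ r ^ k = (-1) ^ k := by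
  set ρ : ℕ → ℝ := fun r => 1 / ((r : ℝ) + 1)
  have hinj : Set.InjOn ρ (range (M + 1) : Finset ℕ) := by
    intro a _ b _ h
    simp only [ρ, one_div, inv_inj, add_left_inj, Nat.cast_inj] at h
    exact h
  refine ⟨fun r => (Lagrange.basis (range (M + 1)) ρ r).eval (-1), ρ, fun r => ⟨by positivity, ?_⟩,
    fun k hk => ?_⟩
  · simp only [ρ]; rw [div_le_one (by positivity)]; linarith [(Nat.cast_nonneg r : (0:ℝ) ≤ r)]
  · have h := Lagrange.eq_interpolate (f := (Polynomial.X : Polynomial ℝ) ^ k) hinj (by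
      rw [Polynomial.degree_X_pow, card_range]; exact_mod_cast Nat.lt_succ_of_le hk)
    have h2 := congrArg (Polynomial.eval (-1 : ℝ)) h
    simp only [Lagrange.interpolate_apply, Polynomial.eval_finsetSum, Polynomial.eval_mul,
      Polynomial.eval_C, Polynomial.eval_pow, Polynomial.eval_X] at h2
    rw [h2]
    exact Finset.sum_congr rfl fun r _ => mul_comm _ _

lemma kc_khinchine (M : ℕ) (c : Finset ι → ℝ) (hc : ∀ I, M < I.card → c I = 0) :
    √(∑ I, c I ^ 2) ≤ 3 * 3 ^ M * ((2 ^ Fintype.card ι)⁻¹ *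
      ∑ S : Finset ι, |∑ I, (-1) ^ (I ∩ S).card * c I|) := by
  have h4 := kc_bonami (univ : Finset ι) c
  have h2 := kc_parseval (univ : Finset ι) c
  simp only [powerset_univ, card_univ] at h4 h2
  set A := ∑ I, c I ^ 2 with hA
  have hA0 : 0 ≤ A := Finset.sum_nonneg fun _ _ => by positivity
  have hw : ∑ I, (3:ℝ) ^ I.card * c I ^ 2 ≤ 3 ^ M * A := by
    rw [hA, Finset.mul_sum]
    apply Finset.sum_le_sum
    intro I _
    by_cases h : M < I.card
    · simp [hc I h]
    · gcongr
      · norm_num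
      · omega
  set N : ℝ := 2 ^ Fintype.card ι
  have hN : 0 < N := by positivity
  have h4' : ∑ S : Finset ι, (∑ I, (-1) ^ (I ∩ S).card * c I) ^ 4 ≤ N * (3 ^ M * A) ^ 2 := by
    refine h4.trans ?_
    have : 0 ≤ ∑ I, (3:ℝ) ^ I.card * c I ^ 2 := Finset.sum_nonneg fun _ _ => by positivity
    gcongr
  set g : Finset ι → ℝ := fun S => ∑ I, (-1) ^ (I ∩ S).card * c I
  change ∑ S, g S ^ 4 ≤ _ at h4'
  change ∑ S, g S ^ 2 = _ at h2
  change _ ≤ 3 * 3 ^ M * (N⁻¹ * ∑ S, |g S|)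
  rcases hA0.eq_or_lt with h0 | hpos
  · rw [← h0]; simp; positivity
  set q := √A
  have hq : 0 < q := Real.sqrt_pos.2 hpos
  have hqq : q ^ 2 = A := Real.sq_sqrt hA0
  set T : ℝ := 3 ^ M
  have hT : 0 < T := by positivity
  set θ : ℝ := 1 / (2 * T * q)
  have hθ : 0 < θ := by positivity
  have key : ∀ S, θ * g S ^ 2 - θ ^ 3 * g S ^ 4 ≤ |g S| := by
    intro S
    rw [← sq_abs (g S), ← (by decide : Even 4).pow_abs (g S)]
    set x := |g S|
    have hx : 0 ≤ x := abs_nonneg _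
    have hu : (θ * x) ^ 2 ≤ θ * x + (θ * x) ^ 4 := by
      have hu0 : 0 ≤ θ * x := by positivity
      set u := θ * x
      rcases le_total u 1 with h | h
      · nlinarith [pow_nonneg hu0 4]
      · nlinarith [pow_le_pow_right₀ h (show 2 ≤ 4 by norm_num)]
    have : θ * (θ * x ^ 2 - θ ^ 3 * x ^ 4) ≤ θ * x := by nlinarith
    exact le_of_mul_le_mul_left this hθ
  have hs : θ * (N * A) - θ ^ 3 * (N * (T * A) ^ 2) ≤ ∑ S, |g S| := by
    have := Finset.sum_le_sum (s := univ) fun S _ => key S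
    rw [Finset.sum_sub_distrib, ← Finset.mul_sum, ← Finset.mul_sum, h2] at this
    have := mul_le_mul_of_nonneg_left h4' (by positivity : 0 ≤ θ ^ 3)
    linarith
  have e : θ * (N * A) - θ ^ 3 * (N * (T * A) ^ 2) = N * (3 * q / (8 * T)) := by
    rw [← hqq]; simp only [θ]; field_simp; ring
  rw [e] at hs
  calc q ≤ 3 * T * (3 * q / (8 * T)) := by
        have : 3 * T * (3 * q / (8 * T)) = 9 / 8 * q := by field_simp; ring
        rw [this]; linarith
    _ = 3 * T * (N⁻¹ * (N * (3 * q / (8 * T)))) := by field_simp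
    _ ≤ _ := by gcongr

/-- The numerical square function estimate. -/
lemma kc_square (M : ℕ) : ∃ C : ℝ, 0 < C ∧ ∀ n : ℕ, ∃ w : Finset (Fin n) → ℝ,
    (∀ J, 0 ≤ w J) ∧ ∑ J, w J ≤ C ∧ ∀ α : Finset (Fin n) → ℝ,
      (∀ I, M < I.card → kcM α I = 0) → √(∑ I, kcM α I ^ 2) ≤ ∑ J, w J * |α J| := by
  obtain ⟨l, ρ, hρ, hl⟩ := kc_interp M
  set Λ := ∑ r ∈ range (M + 1), |l r|
  have hΛ : 0 ≤ Λ := Finset.sum_nonneg fun _ _ => abs_nonneg _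
  refine ⟨3 * 3 ^ M * Λ + 1, by positivity, fun n => ?_⟩
  set v : Finset (Fin n) → ℕ → Finset (Fin n) → ℝ := fun S r A =>
    |l r| * (ρ r ^ A.card * (1 - ρ r) ^ (S.card - A.card))
  have hv : ∀ S r A, 0 ≤ v S r A := fun S r A =>
    mul_nonneg (abs_nonneg _) (mul_nonneg (pow_nonneg (hρ r).1 _)
      (pow_nonneg (by linarith [(hρ r).2]) _))
  set N : ℝ := 2 ^ Fintype.card (Fin n)
  have hN : 0 < N := by positivity
  set w : Finset (Fin n) → ℝ := fun J => 3 * 3 ^ M * (N⁻¹ * ∑ S : Finset (Fin n),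
    ∑ r ∈ range (M + 1), ∑ A ∈ S.powerset, if Sᶜ ∪ A = J then v S r A else 0)
  have hwf : ∀ β : Finset (Fin n) → ℝ, ∑ J, w J * β J = 3 * 3 ^ M * (N⁻¹ * ∑ S : Finset (Fin n),
      ∑ r ∈ range (M + 1), ∑ A ∈ S.powerset, v S r A * β (Sᶜ ∪ A)) := by
    intro β
    simp only [w, mul_assoc, ← Finset.mul_sum]
    congr 3
    simp only [Finset.sum_mul]
    rw [Finset.sum_comm]
    refine Finset.sum_congr rfl fun S _ => ?_
    rw [Finset.sum_comm]
    refine Finset.sum_congr rfl fun r _ => ?_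
    rw [Finset.sum_comm]
    refine Finset.sum_congr rfl fun A _ => ?_
    simp
  refine ⟨w, fun J => ?_, ?_, fun α hα => ?_⟩
  · have : 0 ≤ ∑ S : Finset (Fin n), ∑ r ∈ range (M + 1), ∑ A ∈ S.powerset,
        if Sᶜ ∪ A = J then v S r A else 0 := by
      refine Finset.sum_nonneg fun S _ => Finset.sum_nonneg fun r _ => Finset.sum_nonneg fun A _ => ?_
      split_ifs
      · exact hv _ _ _
      · exact le_rfl
    positivity
  · have h := hwf (fun _ => 1)
    simp only [mul_one] at h
    rw [h]
    have : ∀ S : Finset (Fin n), ∑ r ∈ range (M + 1), ∑ A ∈ S.powerset, v S r A = Λ := by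
      intro S
      refine Finset.sum_congr rfl fun r _ => ?_
      simp only [v]
      rw [← Finset.mul_sum, Finset.sum_pow_mul_eq_add_pow]
      simp
    simp only [this]
    simp only [sum_const, card_univ, Fintype.card_finset, nsmul_eq_mul]
    push_cast
    change 3 * 3 ^ M * (N⁻¹ * (N * Λ)) ≤ _
    rw [inv_mul_cancel_left₀ hN.ne']
    linarith
  · rw [hwf (fun J => |α J|)]
    refine (kc_khinchine M (kcM α) hα).trans ?_
    gcongr with S _
    have e : ∑ I : Finset (Fin n), (-1 : ℝ) ^ (I ∩ S).card * kcM α I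
        = ∑ r ∈ range (M + 1), l r * ∑ A ∈ S.powerset,
          ρ r ^ A.card * (1 - ρ r) ^ (S.card - A.card) * α (Sᶜ ∪ A) := by
      simp only [kcM_T, Finset.mul_sum]
      rw [Finset.sum_comm]
      refine Finset.sum_congr rfl fun I _ => ?_
      by_cases h : M < I.card
      · simp [hα I h]
      · rw [← hl (I ∩ S).card ((Finset.card_le_card Finset.inter_subset_left).trans (not_lt.1 h)),
          Finset.sum_mul]
        exact Finset.sum_congr rfl fun r _ => by ring
    rw [e]
    refine (Finset.abs_sum_le_sum_abs _ _).trans (Finset.sum_le_sum fun r _ => ?_)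
    rw [abs_mul]
    simp only [v, mul_assoc]
    rw [← Finset.mul_sum]
    refine mul_le_mul_of_nonneg_left ?_ (abs_nonneg _)
    refine (Finset.abs_sum_le_sum_abs _ _).trans (Finset.sum_le_sum fun A _ => ?_)
    rw [abs_mul, abs_mul, abs_of_nonneg (pow_nonneg (hρ r).1 _),
      abs_of_nonneg (pow_nonneg (by linarith [(hρ r).2]) _)]

end numeric

section operators
set_option linter.unusedSectionVars false

lemma kc_cs {α : Type*} [MeasurableSpace α] (ν : Measure α) (f g : α → ℝ≥0∞)
    (hf : Measurable f) (hg : Measurable g) :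
    ∫⁻ a, f a * g a ∂ν ≤ (∫⁻ a, f a ^ 2 ∂ν) ^ ((1:ℝ)/2) * (∫⁻ a, g a ^ 2 ∂ν) ^ ((1:ℝ)/2) := by
  have := ENNReal.lintegral_mul_le_Lp_mul_Lq ν Real.HolderConjugate.two_two
    hf.aemeasurable hg.aemeasurable
  simpa using this

lemma kc_mink {α β : Type*} [MeasurableSpace α] [MeasurableSpace β] (ν : Measure α)
    (σ : Measure β) [SFinite ν] [SFinite σ] (g : α → β → ℝ≥0∞)
    (hg : Measurable (Function.uncurry g)) :
    (∫⁻ s, (∫⁻ y, g y s ∂ν) ^ 2 ∂σ) ^ ((1:ℝ)/2) ≤ ∫⁻ y, (∫⁻ s, g y s ^ 2 ∂σ) ^ ((1:ℝ)/2) ∂ν := by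
  have hg1 : ∀ y, Measurable (g y) := fun y => hg.comp measurable_prodMk_left
  have hg2 : ∀ s, Measurable (fun y => g y s) := fun s => hg.comp measurable_prodMk_right
  set a : α → ℝ≥0∞ := fun y => (∫⁻ s, g y s ^ 2 ∂σ) ^ ((1:ℝ)/2)
  have ha : Measurable a := by
    apply Measurable.pow_const
    exact Measurable.lintegral_prod_right' (f := fun p : α × β => g p.1 p.2 ^ 2) (hg.pow_const 2)
  have h1 : ∫⁻ s, (∫⁻ y, g y s ∂ν) ^ 2 ∂σ ≤ (∫⁻ y, a y ∂ν) ^ 2 := by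
    calc ∫⁻ s, (∫⁻ y, g y s ∂ν) ^ 2 ∂σ
        = ∫⁻ s, ∫⁻ y, g y s * ∫⁻ y', g y' s ∂ν ∂ν ∂σ := by
          refine lintegral_congr fun s => ?_
          rw [sq, lintegral_mul_const _ (hg2 s)]
      _ = ∫⁻ y, ∫⁻ s, g y s * ∫⁻ y', g y' s ∂ν ∂σ ∂ν := by
          apply lintegral_lintegral_swap
          apply Measurable.aemeasurable
          apply Measurable.mul
          · exact hg.comp measurable_swap
          · exact (Measurable.lintegral_prod_left' (f := fun p : α × β => g p.1 p.2) hg).comp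
              measurable_fst
      _ ≤ ∫⁻ y, a y * ∫⁻ y', a y' ∂ν ∂ν := by
          refine lintegral_mono fun y => ?_
          calc ∫⁻ s, g y s * ∫⁻ y', g y' s ∂ν ∂σ = ∫⁻ s, ∫⁻ y', g y s * g y' s ∂ν ∂σ := by
                refine lintegral_congr fun s => ?_
                rw [lintegral_const_mul _ (hg2 s)]
            _ = ∫⁻ y', ∫⁻ s, g y s * g y' s ∂σ ∂ν := by
                apply lintegral_lintegral_swap
                apply Measurable.aemeasurable
                exact ((hg1 y).comp measurable_fst).mul (hg.comp measurable_swap)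
            _ ≤ ∫⁻ y', a y * a y' ∂ν := by
                refine lintegral_mono fun y' => ?_
                exact kc_cs σ _ _ (hg1 y) (hg1 y')
            _ = _ := by rw [lintegral_const_mul _ ha]
      _ = _ := by rw [lintegral_mul_const _ ha, sq]
  calc _ ≤ ((∫⁻ y, a y ∂ν) ^ 2) ^ ((1:ℝ)/2) := ENNReal.rpow_le_rpow h1 (by norm_num)
    _ = _ := by rw [← ENNReal.rpow_natCast, ← ENNReal.rpow_mul]; norm_num

variable {n : ℕ}

/-- Take the coordinates in `K` from `x`, the others from `y`. -/
def kcmix (K : Finset (Fin n)) (x y : Fin n → Ω) : Fin n → Ω :=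
  fun i => if i ∈ K then x i else y i

lemma kcmix_univ (x y : Fin n → Ω) : kcmix Finset.univ x y = x := by
  funext i; simp [kcmix]

lemma kcmix_mix (K L : Finset (Fin n)) (x y z : Fin n → Ω) :
    kcmix L (kcmix K x y) z = kcmix (K ∩ L) x (kcmix L y z) := by
  funext i; simp only [kcmix, Finset.mem_inter]; split_ifs <;> first | rfl | tauto

lemma kcmix_mix' (K L : Finset (Fin n)) (x y : Fin n → Ω) :
    kcmix L (kcmix K x y) y = kcmix (K ∩ L) x y := by
  funext i; simp only [kcmix, Finset.mem_inter]; split_ifs <;> first | rfl | tauto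

lemma kcmix_swap (K : Finset (Fin n)) (x y : Fin n → Ω) :
    kcmix K (kcmix K x y) (kcmix K y x) = x := by
  funext i; simp only [kcmix]; split_ifs <;> rfl

lemma kcmix_meas (K : Finset (Fin n)) :
    Measurable (fun p : (Fin n → Ω) × (Fin n → Ω) => kcmix K p.1 p.2) := by
  rw [measurable_pi_iff]
  intro i
  simp only [kcmix]
  split_ifs
  · exact (measurable_pi_apply i).comp measurable_fst
  · exact (measurable_pi_apply i).comp measurable_snd

noncomputable abbrev kcP (μ : Measure Ω) (n : ℕ) : Measure (Fin n → Ω) := Measure.pi fun _ => μ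

noncomputable abbrev kcZ (μ : Measure Ω) (n : ℕ) : Measure ((Fin n → Ω) × ℝ) := (kcP μ n).prod volume

variable (μ : Measure Ω) [IsProbabilityMeasure μ]

lemma kc_mp2 (K : Finset (Fin n)) :
    MeasurePreserving (fun p : (Fin n → Ω) × (Fin n → Ω) => (kcmix K p.1 p.2, kcmix K p.2 p.1))
      ((kcP μ n).prod (kcP μ n)) ((kcP μ n).prod (kcP μ n)) := by
  have e := measurePreserving_arrowProdEquivProdArrow Ω Ω (Fin n) (fun _ => μ) (fun _ => μ)
  have hs : ∀ i : Fin n, MeasurePreserving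
      (fun q : Ω × Ω => if i ∈ K then q else q.swap) (μ.prod μ) (μ.prod μ) := by
    intro i
    split_ifs
    · exact MeasurePreserving.id _
    · exact Measure.measurePreserving_swap
  have h := measurePreserving_pi (fun _ : Fin n => μ.prod μ) (fun _ : Fin n => μ.prod μ) hs
  have := (e.comp h).comp e.symm
  convert this using 1
  funext p
  ext i
  · simp only [Function.comp, kcmix, MeasurableEquiv.arrowProdEquivProdArrow,
      Equiv.arrowProdEquivProdArrow]
    simp
    split_ifs <;> rfl
  · simp only [Function.comp, kcmix, MeasurableEquiv.arrowProdEquivProdArrow,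
      Equiv.arrowProdEquivProdArrow]
    simp
    split_ifs <;> rfl

lemma kc_mp1 (K : Finset (Fin n)) :
    MeasurePreserving (fun p : (Fin n → Ω) × (Fin n → Ω) => kcmix K p.1 p.2)
      ((kcP μ n).prod (kcP μ n)) (kcP μ n) :=
  measurePreserving_fst.comp (kc_mp2 μ K)

lemma kc_mpZ2 (K : Finset (Fin n)) :
    MeasurePreserving (fun p : ((Fin n → Ω) × ℝ) × (Fin n → Ω) =>
        ((kcmix K p.1.1 p.2, p.1.2), kcmix K p.2 p.1.1))
      ((kcZ μ n).prod (kcP μ n)) ((kcZ μ n).prod (kcP μ n)) := by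
  have h1 := measurePreserving_prodAssoc (kcP μ n) (volume : Measure ℝ) (kcP μ n)
  have h2 : MeasurePreserving (Prod.map id Prod.swap :
      (Fin n → Ω) × (ℝ × (Fin n → Ω)) → (Fin n → Ω) × ((Fin n → Ω) × ℝ))
      ((kcP μ n).prod ((volume : Measure ℝ).prod (kcP μ n)))
      ((kcP μ n).prod ((kcP μ n).prod volume)) :=
    (MeasurePreserving.id _).prod Measure.measurePreserving_swap
  have h2' : MeasurePreserving (Prod.map id Prod.swap :
      (Fin n → Ω) × ((Fin n → Ω) × ℝ) → (Fin n → Ω) × (ℝ × (Fin n → Ω)))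
      ((kcP μ n).prod ((kcP μ n).prod volume))
      ((kcP μ n).prod ((volume : Measure ℝ).prod (kcP μ n))) :=
    (MeasurePreserving.id _).prod Measure.measurePreserving_swap
  have h3 := measurePreserving_prodAssoc (kcP μ n) (kcP μ n) (volume : Measure ℝ)
  have h4 := (kc_mp2 μ K).prod (MeasurePreserving.id (volume : Measure ℝ))
  exact (h1.symm.comp (h2'.comp (h3.comp (h4.comp (h3.symm.comp (h2.comp h1))))))

lemma kc_mpZ (K : Finset (Fin n)) :
    MeasurePreserving (fun p : ((Fin n → Ω) × ℝ) × (Fin n → Ω) => (kcmix K p.1.1 p.2, p.1.2))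
      ((kcZ μ n).prod (kcP μ n)) (kcZ μ n) :=
  measurePreserving_fst.comp (kc_mpZ2 μ K)

lemma kc_ae_mix (K : Finset (Fin n)) {p : (Fin n → Ω) × ℝ → Prop} (h : ∀ᵐ z ∂kcZ μ n, p z) :
    ∀ᵐ z ∂kcZ μ n, ∀ᵐ y ∂kcP μ n, p (kcmix K z.1 y, z.2) :=
  Measure.ae_ae_of_ae_prod ((kc_mpZ μ K).quasiMeasurePreserving.ae h)

/-- averaging out the coordinates outside `K`, nonnegative functions -/
noncomputable def kclav (K : Finset (Fin n)) (f : (Fin n → Ω) × ℝ → ℝ≥0∞)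
    (z : (Fin n → Ω) × ℝ) : ℝ≥0∞ := ∫⁻ y, f (kcmix K z.1 y, z.2) ∂kcP μ n

/-- averaging out the coordinates outside `K` -/
noncomputable def kcav (K : Finset (Fin n)) (f : (Fin n → Ω) × ℝ → ℝ)
    (z : (Fin n → Ω) × ℝ) : ℝ := ∫ y, f (kcmix K z.1 y, z.2) ∂kcP μ n

/-- The Hoeffding component. -/
noncomputable def kccmp (I : Finset (Fin n)) (f : (Fin n → Ω) × ℝ → ℝ)
    (z : (Fin n → Ω) × ℝ) : ℝ := kcM (fun J => kcav μ J f z) I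

def KcDep {β : Type*} (I : Finset (Fin n)) (f : (Fin n → Ω) × ℝ → β) : Prop :=
  ∀ x y s, f (kcmix I x y, s) = f (x, s)

lemma KcDep.mono {β : Type*} {I J : Finset (Fin n)} {f : (Fin n → Ω) × ℝ → β} (h : KcDep I f)
    (hIJ : I ⊆ J) : KcDep J f := by
  intro x y s
  rw [← h (kcmix J x y) y s, kcmix_mix', Finset.inter_eq_right.2 hIJ, h]

lemma KcDep.mix {β : Type*} {I : Finset (Fin n)} {f : (Fin n → Ω) × ℝ → β} (h : KcDep I f)
    (J : Finset (Fin n)) (x y : Fin n → Ω) (s : ℝ) :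
    f (kcmix J x y, s) = f (kcmix (J ∩ I) x y, s) := by
  rw [← h (kcmix J x y) y s, kcmix_mix']

lemma kcmeas_aux (K : Finset (Fin n)) :
    Measurable (fun p : ((Fin n → Ω) × ℝ) × (Fin n → Ω) => (kcmix K p.1.1 p.2, p.1.2)) :=
  ((kcmix_meas K).comp ((measurable_fst.comp measurable_fst).prodMk measurable_snd)).prodMk
    (measurable_snd.comp measurable_fst)

lemma kcmeas_slice (K : Finset (Fin n)) (z : (Fin n → Ω) × ℝ) :
    Measurable (fun y : Fin n → Ω => ((kcmix K z.1 y, z.2) : (Fin n → Ω) × ℝ)) :=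
  (kcmeas_aux K).comp measurable_prodMk_left

lemma kclav_meas (K : Finset (Fin n)) {f : (Fin n → Ω) × ℝ → ℝ≥0∞} (hf : Measurable f) :
    Measurable (kclav μ K f) :=
  Measurable.lintegral_prod_right' (hf.comp (kcmeas_aux K))

lemma kcav_meas (K : Finset (Fin n)) {f : (Fin n → Ω) × ℝ → ℝ} (hf : Measurable f) :
    Measurable (kcav μ K f) :=
  (StronglyMeasurable.integral_prod_right' (hf.comp (kcmeas_aux K)).stronglyMeasurable).measurable

lemma kccmp_meas (K : Finset (Fin n)) {f : (Fin n → Ω) × ℝ → ℝ} (hf : Measurable f) :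
    Measurable (kccmp μ K f) := by
  unfold kccmp kcM
  exact Finset.measurable_fun_sum _ fun J _ => (kcav_meas μ J hf).const_mul _

lemma kclint_lav (K : Finset (Fin n)) {f : (Fin n → Ω) × ℝ → ℝ≥0∞} (hf : Measurable f) :
    ∫⁻ z, kclav μ K f z ∂kcZ μ n = ∫⁻ z, f z ∂kcZ μ n := by
  have hm : Measurable (fun p : ((Fin n → Ω) × ℝ) × (Fin n → Ω) => f (kcmix K p.1.1 p.2, p.1.2)) :=
    hf.comp (kcmeas_aux K)
  rw [← (kc_mpZ μ K).lintegral_comp hf, lintegral_prod _ hm.aemeasurable]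
  rfl

lemma kclav_selfadj (K : Finset (Fin n)) {f g : (Fin n → Ω) × ℝ → ℝ≥0∞} (hf : Measurable f)
    (hg : Measurable g) :
    ∫⁻ z, f z * kclav μ K g z ∂kcZ μ n = ∫⁻ z, kclav μ K f z * g z ∂kcZ μ n := by
  have h1 : ∫⁻ z, f z * kclav μ K g z ∂kcZ μ n
      = ∫⁻ p : ((Fin n → Ω) × ℝ) × (Fin n → Ω), f p.1 * g (kcmix K p.1.1 p.2, p.1.2)
        ∂((kcZ μ n).prod (kcP μ n)) := by
    have hm : Measurable (fun p : ((Fin n → Ω) × ℝ) × (Fin n → Ω) =>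
        f p.1 * g (kcmix K p.1.1 p.2, p.1.2)) :=
      (hf.comp measurable_fst).mul (hg.comp (kcmeas_aux K))
    rw [lintegral_prod _ hm.aemeasurable]
    refine lintegral_congr fun z => ?_
    exact (lintegral_const_mul _ (hg.comp (kcmeas_slice K z))).symm
  have h2 : ∫⁻ z, kclav μ K f z * g z ∂kcZ μ n
      = ∫⁻ p : ((Fin n → Ω) × ℝ) × (Fin n → Ω), f (kcmix K p.1.1 p.2, p.1.2) * g p.1
        ∂((kcZ μ n).prod (kcP μ n)) := by
    have hm : Measurable (fun p : ((Fin n → Ω) × ℝ) × (Fin n → Ω) =>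
        f (kcmix K p.1.1 p.2, p.1.2) * g p.1) :=
      (hf.comp (kcmeas_aux K)).mul (hg.comp measurable_fst)
    rw [lintegral_prod _ hm.aemeasurable]
    refine lintegral_congr fun z => ?_
    exact (lintegral_mul_const _ (hf.comp (kcmeas_slice K z))).symm
  have hm : Measurable (fun p : ((Fin n → Ω) × ℝ) × (Fin n → Ω) =>
      f (kcmix K p.1.1 p.2, p.1.2) * g p.1) :=
    (hf.comp (kcmeas_aux K)).mul (hg.comp measurable_fst)
  rw [h1, h2, ← (kc_mpZ2 μ K).lintegral_comp hm]
  simp only [kcmix_swap]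

lemma kclav_dep (K : Finset (Fin n)) (f : (Fin n → Ω) × ℝ → ℝ≥0∞) : KcDep K (kclav μ K f) := by
  intro x y s
  unfold kclav
  refine lintegral_congr fun y' => ?_
  congr 2
  funext i; simp only [kcmix]; split_ifs <;> rfl

lemma kcav_dep (K : Finset (Fin n)) (f : (Fin n → Ω) × ℝ → ℝ) : KcDep K (kcav μ K f) := by
  intro x y s
  unfold kcav
  refine integral_congr_ae (Filter.Eventually.of_forall fun y' => ?_)
  show f (_, _) = f (_, _)
  congr 2
  funext i; simp only [kcmix]; split_ifs <;> rfl

lemma kccmp_dep (K : Finset (Fin n)) (f : (Fin n → Ω) × ℝ → ℝ) : KcDep K (kccmp μ K f) := by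
  intro x y s
  unfold kccmp kcM
  refine Finset.sum_congr rfl fun J hJ => ?_
  beta_reduce
  rw [(kcav_dep μ J f).mono (Finset.mem_powerset.1 hJ) x y s]

lemma kcav_of_dep {I : Finset (Fin n)} {f : (Fin n → Ω) × ℝ → ℝ} (h : KcDep I f)
    (J : Finset (Fin n)) (z : (Fin n → Ω) × ℝ) : kcav μ J f z = kcav μ (J ∩ I) f z := by
  unfold kcav
  simp only [h.mix J]

lemma kclav_of_dep {I : Finset (Fin n)} {f : (Fin n → Ω) × ℝ → ℝ≥0∞} (h : KcDep I f)
    (J : Finset (Fin n)) (z : (Fin n → Ω) × ℝ) : kclav μ J f z = kclav μ (J ∩ I) f z := by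
  unfold kclav
  simp only [h.mix J]

lemma kclav_self {I : Finset (Fin n)} {f : (Fin n → Ω) × ℝ → ℝ≥0∞} (h : KcDep I f)
    (z : (Fin n → Ω) × ℝ) : kclav μ I f z = f z := by
  unfold kclav
  simp [h z.1 _ z.2]

lemma kccmp_of_dep {I : Finset (Fin n)} {f : (Fin n → Ω) × ℝ → ℝ} (h : KcDep I f)
    {L : Finset (Fin n)} (hL : ¬ L ⊆ I) (z : (Fin n → Ω) × ℝ) : kccmp μ L f z = 0 :=
  kcM_eq_zero _ I L (fun J => kcav_of_dep μ h J z) hL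

lemma kcav_univ (f : (Fin n → Ω) × ℝ → ℝ) (z : (Fin n → Ω) × ℝ) :
    kcav μ Finset.univ f z = f z := by
  simp [kcav, kcmix_univ]

lemma kccmp_sum (f : (Fin n → Ω) × ℝ → ℝ) (z : (Fin n → Ω) × ℝ) :
    ∑ I, kccmp μ I f z = f z := by
  have := kcM_inv (fun J => kcav μ J f z) Finset.univ
  rw [kcav_univ] at this
  simpa [kccmp] using this

def KcGood (f : (Fin n → Ω) × ℝ → ℝ) (z : (Fin n → Ω) × ℝ) : Prop :=
  ∀ J, Integrable (fun y => f (kcmix J z.1 y, z.2)) (kcP μ n)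

variable {μ}

lemma KcGood.integ {f : (Fin n → Ω) × ℝ → ℝ} {z : (Fin n → Ω) × ℝ} (hz : KcGood μ f z)
    (hf : Measurable f) (K L : Finset (Fin n)) :
    Integrable (fun p : (Fin n → Ω) × (Fin n → Ω) => f (kcmix L (kcmix K z.1 p.1) p.2, z.2))
      ((kcP μ n).prod (kcP μ n)) := by
  simp only [kcmix_mix]
  exact ((kc_mp1 μ L).integrable_comp (hf.comp (kcmeas_slice (K ∩ L) z)).aestronglyMeasurable).2
    (hz (K ∩ L))

lemma KcGood.av {f : (Fin n → Ω) × ℝ → ℝ} {z : (Fin n → Ω) × ℝ} (hz : KcGood μ f z)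
    (hf : Measurable f) (L : Finset (Fin n)) : KcGood μ (kcav μ L f) z :=
  fun K => (hz.integ hf K L).integral_prod_left

lemma KcGood.av_av {f : (Fin n → Ω) × ℝ → ℝ} {z : (Fin n → Ω) × ℝ} (hz : KcGood μ f z)
    (hf : Measurable f) (K L : Finset (Fin n)) :
    kcav μ K (kcav μ L f) z = kcav μ (K ∩ L) f z := by
  have h1 : kcav μ K (kcav μ L f) z = ∫ p : (Fin n → Ω) × (Fin n → Ω),
      f (kcmix L (kcmix K z.1 p.1) p.2, z.2) ∂((kcP μ n).prod (kcP μ n)) := by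
    rw [integral_prod _ (hz.integ hf K L)]; rfl
  rw [h1]
  simp only [kcmix_mix]
  rw [← integral_map (f := fun y => f (kcmix (K ∩ L) z.1 y, z.2)) (kc_mp1 μ L).measurable.aemeasurable
    (hf.comp (kcmeas_slice (K ∩ L) z)).aestronglyMeasurable, (kc_mp1 μ L).map_eq]
  rfl

lemma KcGood.add {f g : (Fin n → Ω) × ℝ → ℝ} {z : (Fin n → Ω) × ℝ} (hf : KcGood μ f z)
    (hg : KcGood μ g z) : KcGood μ (fun z => f z + g z) z := fun J => (hf J).add (hg J)

lemma KcGood.sub {f g : (Fin n → Ω) × ℝ → ℝ} {z : (Fin n → Ω) × ℝ} (hf : KcGood μ f z)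
    (hg : KcGood μ g z) : KcGood μ (fun z => f z - g z) z := fun J => (hf J).sub (hg J)

lemma KcGood.smul {f : (Fin n → Ω) × ℝ → ℝ} {z : (Fin n → Ω) × ℝ} (hf : KcGood μ f z)
    (c : ℝ) : KcGood μ (fun z => c * f z) z := fun J => (hf J).const_mul c

lemma KcGood.sum {ι : Type*} (s : Finset ι) {f : ι → (Fin n → Ω) × ℝ → ℝ} {z : (Fin n → Ω) × ℝ}
    (hf : ∀ i ∈ s, KcGood μ (f i) z) : KcGood μ (fun z => ∑ i ∈ s, f i z) z :=
  fun J => integrable_finsetSum _ fun i hi => hf i hi J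

lemma kcM_add {ι : Type*} [DecidableEq ι] (α β : Finset ι → ℝ) (I : Finset ι) :
    kcM (fun J => α J + β J) I = kcM α I + kcM β I := by
  unfold kcM; rw [← Finset.sum_add_distrib]; exact Finset.sum_congr rfl fun _ _ => by ring

lemma kcM_smul {ι : Type*} [DecidableEq ι] (c : ℝ) (α : Finset ι → ℝ) (I : Finset ι) :
    kcM (fun J => c * α J) I = c * kcM α I := by
  unfold kcM; rw [Finset.mul_sum]; exact Finset.sum_congr rfl fun _ _ => by ring

lemma KcGood.cmp_add {f g : (Fin n → Ω) × ℝ → ℝ} {z : (Fin n → Ω) × ℝ} (hf : KcGood μ f z)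
    (hg : KcGood μ g z) (I : Finset (Fin n)) :
    kccmp μ I (fun z => f z + g z) z = kccmp μ I f z + kccmp μ I g z := by
  unfold kccmp
  rw [← kcM_add]
  congr 1
  funext J
  exact integral_add (hf J) (hg J)

lemma kccmp_smul (c : ℝ) (f : (Fin n → Ω) × ℝ → ℝ) (z : (Fin n → Ω) × ℝ) (I : Finset (Fin n)) :
    kccmp μ I (fun z => c * f z) z = c * kccmp μ I f z := by
  unfold kccmp
  rw [← kcM_smul]
  congr 1
  funext J
  exact integral_const_mul _ _

lemma KcGood.cmp_sum {ι : Type*} (s : Finset ι) {f : ι → (Fin n → Ω) × ℝ → ℝ}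
    {z : (Fin n → Ω) × ℝ} (hf : ∀ i ∈ s, KcGood μ (f i) z) (I : Finset (Fin n)) :
    kccmp μ I (fun z => ∑ i ∈ s, f i z) z = ∑ i ∈ s, kccmp μ I (f i) z := by
  classical
  induction s using Finset.induction_on with
  | empty =>
    simp only [Finset.sum_empty]
    have := kccmp_smul (μ := μ) 0 (fun _ => (0:ℝ)) z I
    simpa using this
  | insert i s hi ih =>
    simp only [Finset.sum_insert hi]
    rw [KcGood.cmp_add (hf i (Finset.mem_insert_self _ _))
      (KcGood.sum s fun j hj => hf j (Finset.mem_insert_of_mem hj)),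
      ih fun j hj => hf j (Finset.mem_insert_of_mem hj)]

lemma KcGood.cmp {f : (Fin n → Ω) × ℝ → ℝ} {z : (Fin n → Ω) × ℝ} (hz : KcGood μ f z)
    (hf : Measurable f) (I : Finset (Fin n)) : KcGood μ (kccmp μ I f) z :=
  KcGood.sum _ fun J _ => (hz.av hf J).smul _

lemma KcGood.av_sum {ι : Type*} (s : Finset ι) {f : ι → (Fin n → Ω) × ℝ → ℝ}
    {z : (Fin n → Ω) × ℝ} (hf : ∀ i ∈ s, KcGood μ (f i) z) (J : Finset (Fin n)) :
    kcav μ J (fun z => ∑ i ∈ s, f i z) z = ∑ i ∈ s, kcav μ J (f i) z :=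
  integral_finsetSum _ fun i hi => hf i hi J

/-- `av J (cmp I f) = 0` unless `I ⊆ J`. -/
lemma KcGood.av_cmp {f : (Fin n → Ω) × ℝ → ℝ} {z : (Fin n → Ω) × ℝ} (hz : KcGood μ f z)
    (hf : Measurable f) {I J : Finset (Fin n)} (h : ¬ I ⊆ J) : kcav μ J (kccmp μ I f) z = 0 := by
  have h1 : kcav μ J (kccmp μ I f) z = kcM (fun L => kcav μ (J ∩ L) f z) I := by
    have := KcGood.av_sum (μ := μ) I.powerset
      (f := fun L z => (-1) ^ (I.card + L.card) * kcav μ L f z) (z := z)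
      (fun L _ => (hz.av hf L).smul _) J
    refine this.trans ?_
    unfold kcM
    refine Finset.sum_congr rfl fun L _ => ?_
    beta_reduce
    rw [← hz.av_av hf J L]
    exact integral_const_mul _ _
  rw [h1]
  refine kcM_eq_zero _ J I (fun L => ?_) h
  congr 1
  ext i; simp; tauto

lemma kcav_cmp_self {f : (Fin n → Ω) × ℝ → ℝ} {z : (Fin n → Ω) × ℝ} (I : Finset (Fin n)) :
    kcav μ I (kccmp μ I f) z = kccmp μ I f z := by
  unfold kcav
  simp [(kccmp_dep μ I f) z.1 _ z.2]

end operators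

section lattice
set_option linter.unusedSectionVars false

open Filter Topology

variable {n : ℕ} (μ : Measure Ω) [IsProbabilityMeasure μ]

noncomputable def kcn0 (f : (Fin n → Ω) × ℝ → ℝ≥0∞) : ℝ≥0∞ := ∫⁻ z, f z ∂kcZ μ n

noncomputable def kcn1 (f : (Fin n → Ω) × ℝ → ℝ≥0∞) : ℝ≥0∞ :=
  ∫⁻ x, (∫⁻ s, f (x, s) ^ 2) ^ ((1:ℝ)/2) ∂kcP μ n

noncomputable def kcn2 (f : (Fin n → Ω) × ℝ → ℝ≥0∞) : ℝ≥0∞ := (∫⁻ z, f z ^ 2 ∂kcZ μ n) ^ ((1:ℝ)/2)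

structure KcLat (N : ((Fin n → Ω) × ℝ → ℝ≥0∞) → ℝ≥0∞) : Prop where
  mono : ∀ f g, (∀ᵐ z ∂kcZ μ n, f z ≤ g z) → N f ≤ N g
  add : ∀ f g, Measurable f → Measurable g → N (fun z => f z + g z) ≤ N f + N g
  smul : ∀ (c : ℝ≥0∞) f, Measurable f → N (fun z => c * f z) = c * N f
  lav : ∀ K f, Measurable f → N (kclav μ K f) ≤ N f
  fin : ∀ f, Measurable f → N f < ⊤ → ∀ᵐ z ∂kcZ μ n, f z < ⊤
  zero : ∀ f, Measurable f → N f = 0 → ∀ᵐ z ∂kcZ μ n, f z = 0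
  dom : ∀ f, Measurable f → N f < ⊤ → ∀ B : ℕ → Set ((Fin n → Ω) × ℝ), (∀ k, MeasurableSet (B k)) →
    (∀ z, ∀ᶠ k in atTop, z ∉ B k) → Tendsto (fun k => N ((B k).indicator f)) atTop (𝓝 0)

lemma kc_ind_tend {α : Type*} {f : α → ℝ≥0∞} {B : ℕ → Set α} {z : α} (h : ∀ᶠ k in atTop, z ∉ B k) :
    Tendsto (fun k => (B k).indicator f z) atTop (𝓝 0) := by
  apply tendsto_const_nhds.congr'
  filter_upwards [h] with k hk
  simp [hk]

lemma kclat0 : KcLat μ (kcn0 (n := n) μ) where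
  mono f g h := lintegral_mono_ae h
  add f g hf hg := (lintegral_add_left hf g).le
  smul c f hf := lintegral_const_mul c hf
  lav K f hf := (kclint_lav μ K hf).le
  fin f hf h := ae_lt_top hf h.ne
  zero f hf h := (lintegral_eq_zero_iff hf).1 h
  dom f hf h B hB hz := by
    have := tendsto_lintegral_of_dominated_convergence (μ := kcZ μ n)
      (F := fun k => (B k).indicator f) (f := fun _ => 0) f
      (fun k => hf.indicator (hB k)) (fun k => ae_of_all _ fun z => Set.indicator_le_self _ _ _)
      h.ne (ae_of_all _ fun z => kc_ind_tend (hz z))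
    simpa [kcn0] using this

lemma kc_half_sq (a : ℝ≥0∞) : (a ^ ((1:ℝ)/2)) ^ 2 = a := by
  rw [← ENNReal.rpow_natCast, ← ENNReal.rpow_mul]; norm_num

lemma kc_sq_half (a : ℝ≥0∞) : (a ^ 2) ^ ((1:ℝ)/2) = a := by
  rw [← ENNReal.rpow_natCast, ← ENNReal.rpow_mul]; norm_num

lemma kc_tri {α : Type*} [MeasurableSpace α] (ν : Measure α) {f g : α → ℝ≥0∞}
    (hf : Measurable f) (hg : Measurable g) :
    (∫⁻ a, (f a + g a) ^ 2 ∂ν) ^ ((1:ℝ)/2) ≤ (∫⁻ a, f a ^ 2 ∂ν) ^ ((1:ℝ)/2)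
      + (∫⁻ a, g a ^ 2 ∂ν) ^ ((1:ℝ)/2) := by
  have := ENNReal.lintegral_Lp_add_le (p := 2) (μ := ν) hf.aemeasurable hg.aemeasurable (by norm_num)
  simpa using this

lemma kc_sc {α : Type*} [MeasurableSpace α] (ν : Measure α) (c : ℝ≥0∞) {f : α → ℝ≥0∞}
    (hf : Measurable f) :
    (∫⁻ a, (c * f a) ^ 2 ∂ν) ^ ((1:ℝ)/2) = c * (∫⁻ a, f a ^ 2 ∂ν) ^ ((1:ℝ)/2) := by
  simp only [mul_pow]
  rw [lintegral_const_mul _ (hf.pow_const 2), ENNReal.mul_rpow_of_nonneg _ _ (by norm_num),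
    kc_sq_half]

lemma kc_domsq {α : Type*} [MeasurableSpace α] (ν : Measure α) {f : α → ℝ≥0∞}
    (hf : Measurable f) (h : (∫⁻ a, f a ^ 2 ∂ν) ^ ((1:ℝ)/2) < ⊤) {B : ℕ → Set α}
    (hB : ∀ k, MeasurableSet (B k)) (hz : ∀ z, ∀ᶠ k in atTop, z ∉ B k) :
    Tendsto (fun k => (∫⁻ a, (B k).indicator f a ^ 2 ∂ν) ^ ((1:ℝ)/2)) atTop (𝓝 0) := by
  have h' : ∫⁻ a, f a ^ 2 ∂ν ≠ ⊤ := by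
    intro h2; rw [h2] at h; simp at h
  have := tendsto_lintegral_of_dominated_convergence (μ := ν)
      (F := fun k a => (B k).indicator f a ^ 2) (f := fun _ => 0) (fun a => f a ^ 2)
      (fun k => (hf.indicator (hB k)).pow_const 2) (fun k => ae_of_all _ fun z => by
        simp only []
        gcongr
        exact Set.indicator_le_self _ _ _)
      h' (ae_of_all _ fun z => by
        have h3 := ((ENNReal.continuous_pow 2).tendsto _).comp (kc_ind_tend (f := f) (hz z))
        simpa [Function.comp_def] using h3)
  have h4 := ((ENNReal.continuous_rpow_const (y := (1:ℝ)/2)).tendsto _).comp this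
  simpa [Function.comp_def] using h4

lemma kc_fin2 {α : Type*} [MeasurableSpace α] (ν : Measure α) {f : α → ℝ≥0∞}
    (hf : Measurable f) (h : (∫⁻ a, f a ^ 2 ∂ν) ^ ((1:ℝ)/2) < ⊤) : ∀ᵐ a ∂ν, f a < ⊤ := by
  have h' : ∫⁻ a, f a ^ 2 ∂ν ≠ ⊤ := by
    intro h2; rw [h2] at h; simp at h
  filter_upwards [ae_lt_top (hf.pow_const 2) h'] with a ha
  by_contra h5
  simp at h5
  simp [h5] at ha

lemma kc_zero2 {α : Type*} [MeasurableSpace α] (ν : Measure α) {f : α → ℝ≥0∞}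
    (hf : Measurable f) (h : (∫⁻ a, f a ^ 2 ∂ν) ^ ((1:ℝ)/2) = 0) : ∀ᵐ a ∂ν, f a = 0 := by
  have h' : ∫⁻ a, f a ^ 2 ∂ν = 0 := by
    rw [ENNReal.rpow_eq_zero_iff] at h
    rcases h with h | h
    · exact h.1
    · norm_num at h
  filter_upwards [(lintegral_eq_zero_iff (hf.pow_const 2)).1 h'] with a ha
  simpa using ha

lemma kclav_sq (K : Finset (Fin n)) {f : (Fin n → Ω) × ℝ → ℝ≥0∞} (hf : Measurable f) (z) :
    kclav μ K f z ^ 2 ≤ kclav μ K (fun z => f z ^ 2) z := by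
  have := kc_cs (kcP μ n) (fun y => f (kcmix K z.1 y, z.2)) (fun _ => 1)
    (hf.comp (kcmeas_slice K z)) measurable_const
  simp only [mul_one, one_pow, lintegral_one, measure_univ, ENNReal.one_rpow] at this
  calc kclav μ K f z ^ 2 ≤ _ := pow_le_pow_left₀ zero_le this 2
    _ = _ := kc_half_sq _

lemma kclat2 : KcLat μ (kcn2 (n := n) μ) where
  mono f g h := by
    unfold kcn2
    refine ENNReal.rpow_le_rpow (lintegral_mono_ae ?_) (by norm_num)
    filter_upwards [h] with z hz
    gcongr
  add f g hf hg := kc_tri _ hf hg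
  smul c f hf := kc_sc _ c hf
  lav K f hf := by
    unfold kcn2
    refine ENNReal.rpow_le_rpow ?_ (by norm_num)
    exact (lintegral_mono fun z => kclav_sq μ K hf z).trans (kclint_lav μ K (hf.pow_const 2)).le
  fin f hf h := kc_fin2 _ hf h
  zero f hf h := kc_zero2 _ hf h
  dom f hf h B hB hz := kc_domsq _ hf h hB hz

lemma kcn1_inner_meas {f : (Fin n → Ω) × ℝ → ℝ≥0∞} (hf : Measurable f) :
    Measurable (fun x => (∫⁻ s, f (x, s) ^ 2) ^ ((1:ℝ)/2)) :=
  (Measurable.lintegral_prod_right' (f := fun p => f p ^ 2) (hf.pow_const 2)).pow_const _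

lemma kclat1 : KcLat μ (kcn1 (n := n) μ) where
  mono f g h := by
    unfold kcn1
    refine lintegral_mono_ae ?_
    filter_upwards [Measure.ae_ae_of_ae_prod h] with x hx
    refine ENNReal.rpow_le_rpow (lintegral_mono_ae ?_) (by norm_num)
    filter_upwards [hx] with s hs
    gcongr
  add f g hf hg := by
    unfold kcn1
    rw [← lintegral_add_left (kcn1_inner_meas hf)]
    exact lintegral_mono fun x => kc_tri _ (hf.comp measurable_prodMk_left)
      (hg.comp measurable_prodMk_left)
  smul c f hf := by
    unfold kcn1
    rw [← lintegral_const_mul _ (kcn1_inner_meas hf)]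
    exact lintegral_congr fun x => kc_sc _ c (hf.comp measurable_prodMk_left)
  lav K f hf := by
    unfold kcn1
    have hm := kcn1_inner_meas hf
    calc _ ≤ ∫⁻ x, ∫⁻ y, (∫⁻ s, f (kcmix K x y, s) ^ 2) ^ ((1:ℝ)/2) ∂kcP μ n ∂kcP μ n := by
          refine lintegral_mono fun x => ?_
          refine kc_mink (kcP μ n) volume (fun y s => f (kcmix K x y, s)) ?_
          exact hf.comp (((kcmix_meas K).comp (measurable_const.prodMk measurable_fst)).prodMk
            measurable_snd)
      _ = ∫⁻ p : (Fin n → Ω) × (Fin n → Ω), (∫⁻ s, f (kcmix K p.1 p.2, s) ^ 2) ^ ((1:ℝ)/2)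
            ∂((kcP μ n).prod (kcP μ n)) := by
          have hm2 : Measurable (fun p : (Fin n → Ω) × (Fin n → Ω) =>
            (∫⁻ s, f (kcmix K p.1 p.2, s) ^ 2) ^ ((1:ℝ)/2)) := hm.comp (kcmix_meas K)
          rw [lintegral_prod _ hm2.aemeasurable]
      _ = _ := (kc_mp1 μ K).lintegral_comp hm
  fin f hf h := by
    rw [Measure.ae_prod_iff_ae_ae (measurableSet_lt hf measurable_const)]
    filter_upwards [ae_lt_top (kcn1_inner_meas hf) h.ne] with x hx
    exact kc_fin2 _ (hf.comp measurable_prodMk_left) hx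
  zero f hf h := by
    rw [Measure.ae_prod_iff_ae_ae (measurableSet_eq_fun hf measurable_const)]
    filter_upwards [(lintegral_eq_zero_iff (kcn1_inner_meas hf)).1 h] with x hx
    exact kc_zero2 _ (hf.comp measurable_prodMk_left) hx
  dom f hf h B hB hz := by
    have := tendsto_lintegral_of_dominated_convergence (μ := kcP μ n)
      (F := fun k x => (∫⁻ s, (B k).indicator f (x, s) ^ 2) ^ ((1:ℝ)/2)) (f := fun _ => 0)
      (fun x => (∫⁻ s, f (x, s) ^ 2) ^ ((1:ℝ)/2))
      (fun k => kcn1_inner_meas (hf.indicator (hB k))) (fun k => ae_of_all _ fun x => by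
        simp only []
        refine ENNReal.rpow_le_rpow (lintegral_mono fun s => ?_) (by norm_num)
        gcongr
        exact Set.indicator_le_self _ _ _)
      h.ne (by
        filter_upwards [ae_lt_top (kcn1_inner_meas hf) h.ne] with x hx
        exact kc_domsq volume (f := fun s => f (x, s)) (hf.comp measurable_prodMk_left) hx
          (B := fun k => {s | (x, s) ∈ B k}) (fun k => measurable_prodMk_left (hB k))
          fun s => hz (x, s))
    simpa [kcn1] using this

lemma kcn1_le_n2 {f : (Fin n → Ω) × ℝ → ℝ≥0∞} (hf : Measurable f) : kcn1 μ f ≤ kcn2 μ f := by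
  have := kc_cs (kcP μ n) (fun x => (∫⁻ s, f (x, s) ^ 2) ^ ((1:ℝ)/2)) (fun _ => 1)
    (kcn1_inner_meas hf) measurable_const
  simp only [mul_one, one_pow, lintegral_one, measure_univ, ENNReal.one_rpow, kc_half_sq] at this
  refine this.trans (le_of_eq ?_)
  unfold kcn2
  rw [lintegral_prod _ (hf.pow_const 2).aemeasurable]

lemma kc_norm0 (F : (Fin n → Ω) → ℝ → ℝ) (hF : Measurable (Function.uncurry F)) :
    normL1L1R μ F = kcn0 μ (fun z => ‖Function.uncurry F z‖ₑ) := by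
  unfold kcn0 normL1L1R
  rw [lintegral_prod _ hF.enorm.aemeasurable]
  simp only [Real.enorm_eq_ofReal_abs]
  rfl

lemma kc_norm1 (F : (Fin n → Ω) → ℝ → ℝ) (_hF : Measurable (Function.uncurry F)) :
    normL1L2R μ F = kcn1 μ (fun z => ‖Function.uncurry F z‖ₑ) := by
  unfold kcn1 normL1L2R
  simp only [Real.enorm_eq_ofReal_abs, ← ENNReal.ofReal_pow (abs_nonneg _), sq_abs]
  rfl

lemma kc_memLp {f : (Fin n → Ω) × ℝ → ℝ} (hf : Measurable f) :
    MemLp f 2 (kcZ μ n) ↔ kcn2 μ (fun z => ‖f z‖ₑ) < ⊤ := by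
  unfold MemLp
  have : eLpNorm f 2 (kcZ μ n) = kcn2 μ (fun z => ‖f z‖ₑ) := by
    rw [eLpNorm_eq_lintegral_rpow_enorm_toReal (by norm_num) (by norm_num)]
    simp [kcn2]
  rw [this]
  exact ⟨fun h => h.2, fun h => ⟨hf.aestronglyMeasurable, h⟩⟩

variable {μ} {N : ((Fin n → Ω) × ℝ → ℝ≥0∞) → ℝ≥0∞}

lemma KcLat.null (hN : KcLat μ N) : N (fun _ => 0) = 0 := by
  have := hN.smul 0 (fun _ => 0) measurable_const
  simpa using this

lemma KcLat.sum (hN : KcLat μ N) {ι : Type*} (s : Finset ι) (f : ι → (Fin n → Ω) × ℝ → ℝ≥0∞)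
    (hf : ∀ i ∈ s, Measurable (f i)) : N (fun z => ∑ i ∈ s, f i z) ≤ ∑ i ∈ s, N (f i) := by
  classical
  induction s using Finset.induction_on with
  | empty => simp [hN.null]
  | insert i s hi ih =>
    simp only [Finset.sum_insert hi]
    refine (hN.add _ _ (hf i (Finset.mem_insert_self _ _))
      (Finset.measurable_fun_sum _ fun j hj => hf j (Finset.mem_insert_of_mem hj))).trans ?_
    gcongr
    exact ih fun j hj => hf j (Finset.mem_insert_of_mem hj)

lemma KcLat.good (hN : KcLat μ N) {f : (Fin n → Ω) × ℝ → ℝ} (hf : Measurable f)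
    (h : N (fun z => ‖f z‖ₑ) < ⊤) : ∀ᵐ z ∂kcZ μ n, KcGood μ f z := by
  unfold KcGood
  rw [ae_all_iff]
  intro J
  filter_upwards [hN.fin _ (kclav_meas μ J hf.enorm) ((hN.lav J _ hf.enorm).trans_lt h)] with z hz
  exact ⟨(hf.comp (kcmeas_slice J z)).aestronglyMeasurable, hz⟩

lemma kcav_enorm (J : Finset (Fin n)) (f : (Fin n → Ω) × ℝ → ℝ) (z) :
    ‖kcav μ J f z‖ₑ ≤ kclav μ J (fun z => ‖f z‖ₑ) z := enorm_integral_le_lintegral_enorm _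

lemma kccmp_enorm (I : Finset (Fin n)) (f : (Fin n → Ω) × ℝ → ℝ) (z) :
    ‖kccmp μ I f z‖ₑ ≤ ∑ J ∈ I.powerset, kclav μ J (fun z => ‖f z‖ₑ) z := by
  unfold kccmp kcM
  refine (enorm_sum_le _ _).trans (Finset.sum_le_sum fun J _ => ?_)
  simpa [enorm_mul, enorm_pow] using kcav_enorm J f z

lemma KcLat.cmp_le (hN : KcLat μ N) {f : (Fin n → Ω) × ℝ → ℝ} (hf : Measurable f)
    (I : Finset (Fin n)) :
    N (fun z => ‖kccmp μ I f z‖ₑ) ≤ 2 ^ n * N (fun z => ‖f z‖ₑ) := by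
  calc _ ≤ N (fun z => ∑ J ∈ I.powerset, kclav μ J (fun z => ‖f z‖ₑ) z) :=
        hN.mono _ _ (ae_of_all _ fun z => kccmp_enorm I f z)
    _ ≤ ∑ J ∈ I.powerset, N (kclav μ J (fun z => ‖f z‖ₑ)) :=
        hN.sum _ _ fun J _ => kclav_meas μ J hf.enorm
    _ ≤ ∑ J ∈ I.powerset, N (fun z => ‖f z‖ₑ) := Finset.sum_le_sum fun J _ => hN.lav J _ hf.enorm
    _ ≤ ∑ J : Finset (Fin n), N (fun z => ‖f z‖ₑ) :=
        Finset.sum_le_sum_of_subset (Finset.subset_univ _)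
    _ = _ := by simp

lemma KcLat.congr (hN : KcLat μ N) {f g : (Fin n → Ω) × ℝ → ℝ≥0∞} (h : ∀ᵐ z ∂kcZ μ n, f z = g z) :
    N f = N g :=
  le_antisymm (hN.mono _ _ (h.mono fun _ h => h.le)) (hN.mono _ _ (h.mono fun _ h => h.ge))

lemma KcLat.eadd (hN : KcLat μ N) {f g : (Fin n → Ω) × ℝ → ℝ} (hf : Measurable f)
    (hg : Measurable g) :
    N (fun z => ‖f z + g z‖ₑ) ≤ N (fun z => ‖f z‖ₑ) + N (fun z => ‖g z‖ₑ) :=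
  (hN.mono _ _ (ae_of_all _ fun _ => enorm_add_le _ _)).trans (hN.add _ _ hf.enorm hg.enorm)

lemma KcLat.esub (hN : KcLat μ N) {f g : (Fin n → Ω) × ℝ → ℝ} (hf : Measurable f)
    (hg : Measurable g) :
    N (fun z => ‖f z - g z‖ₑ) ≤ N (fun z => ‖f z‖ₑ) + N (fun z => ‖g z‖ₑ) :=
  (hN.mono _ _ (ae_of_all _ fun _ => enorm_sub_le)).trans (hN.add _ _ hf.enorm hg.enorm)

lemma KcLat.esum (hN : KcLat μ N) {ι : Type*} (s : Finset ι) (f : ι → (Fin n → Ω) × ℝ → ℝ)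
    (hf : ∀ i ∈ s, Measurable (f i)) :
    N (fun z => ‖∑ i ∈ s, f i z‖ₑ) ≤ ∑ i ∈ s, N (fun z => ‖f i z‖ₑ) :=
  (hN.mono _ _ (ae_of_all _ fun _ => enorm_sum_le _ _)).trans
    (hN.sum _ _ fun i hi => (hf i hi).enorm)

end lattice

section membership
set_option linter.unusedSectionVars false

open Filter Topology

variable {n : ℕ} (μ : Measure Ω) [IsProbabilityMeasure μ]

def KcInV (M : ℕ) (f : (Fin n → Ω) × ℝ → ℝ) : Prop :=
  ∀ I : Finset (Fin n), M < I.card → ∀ᵐ z ∂kcZ μ n, kccmp μ I f z = 0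

variable {μ} {N : ((Fin n → Ω) × ℝ → ℝ≥0∞) → ℝ≥0∞} {M : ℕ}

lemma kc_inV_of_mem (hN : KcLat μ N) {NN : ((Fin n → Ω) → ℝ → ℝ) → ℝ≥0∞}
    (hNN : ∀ F, Measurable (Function.uncurry F) → NN F = N (fun z => ‖Function.uncurry F z‖ₑ))
    {u : (Fin n → Ω) → ℝ → ℝ} (hu : MemV1leM μ M NN u) : KcInV μ M (Function.uncurry u) := by
  obtain ⟨hum, huN, happ⟩ := hu
  rw [hNN _ hum] at huN
  intro I hI
  have key : ∀ ε : ℝ, 0 < ε → N (fun z => ‖kccmp μ I (Function.uncurry u) z‖ₑ)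
      ≤ 2 ^ n * ENNReal.ofReal ε := by
    intro ε hε
    obtain ⟨g, hg1, -, -, hg4, hg5⟩ := happ ε hε
    have hgm : ∀ m i, Measurable (fun z : (Fin n → Ω) × ℝ => g m i (fun k => z.1 (i k)) z.2) := by
      intro m i
      refine (hg1 m i).comp (Measurable.prodMk ?_ measurable_snd)
      exact measurable_pi_iff.2 fun k => (measurable_pi_apply (i k)).comp measurable_fst
    set G : (Fin n → Ω) × ℝ → ℝ := fun z => ∑ m ∈ Finset.range (M + 1),
          ∑ i : Fin m → Fin n, g m i (fun k => z.1 (i k)) z.2 with hG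
    have hGm : Measurable G := Finset.measurable_fun_sum _ fun m _ =>
      Finset.measurable_fun_sum _ fun i _ => hgm m i
    have hgood : ∀ᵐ z ∂kcZ μ n, ∀ m i, KcGood μ
        (fun z : (Fin n → Ω) × ℝ => g m i (fun k => z.1 (i k)) z.2) z := by
      rw [ae_all_iff]; intro m
      rw [ae_all_iff]; intro i
      refine hN.good (hgm m i) ?_
      have := hg4 m i
      rwa [hNN (fun x s => g m i (fun k => x (i k)) s) (hgm m i)] at this
    have h0 : ∀ᵐ z ∂kcZ μ n, kccmp μ I (Function.uncurry u) z
        = kccmp μ I (fun z => Function.uncurry u z - G z) z := by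
      filter_upwards [hgood, hN.good hum huN] with z hz hzu
      have hzG : KcGood μ G z := KcGood.sum _ fun m _ => KcGood.sum _ fun i _ => hz m i
      have e1 : kccmp μ I G z = 0 := by
        rw [hG, KcGood.cmp_sum _ fun m _ => KcGood.sum _ fun i _ => hz m i]
        refine Finset.sum_eq_zero fun m hm => ?_
        rw [KcGood.cmp_sum _ fun i _ => hz m i]
        refine Finset.sum_eq_zero fun i _ => ?_
        refine kccmp_of_dep μ (I := Finset.univ.image i) ?_ ?_ z
        · intro x y s
          simp [kcmix]
        · intro hc
          have h1 := Finset.card_le_card hc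
          have h2 : (Finset.univ.image i).card ≤ m := by
            simpa using Finset.card_image_le (s := Finset.univ) (f := i)
          have h3 := Finset.mem_range.1 hm
          omega
      have e2 := KcGood.cmp_add (hzu.sub hzG) hzG I
      simp only [sub_add_cancel] at e2
      rw [e1, add_zero] at e2
      exact e2
    have hm2 : Measurable (fun z => Function.uncurry u z - G z) := hum.sub hGm
    calc _ = N (fun z => ‖kccmp μ I (fun z => Function.uncurry u z - G z) z‖ₑ) :=
          hN.congr (h0.mono fun z hz => by rw [hz])
      _ ≤ 2 ^ n * N (fun z => ‖Function.uncurry u z - G z‖ₑ) := hN.cmp_le hm2 I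
      _ ≤ _ := by
          gcongr
          have : Measurable (Function.uncurry fun x s => u x s - G (x, s)) := hm2
          exact (hNN _ this).symm.le.trans hg5
  have hz : N (fun z => ‖kccmp μ I (Function.uncurry u) z‖ₑ) = 0 := by
    refine le_antisymm (ge_of_tendsto (x := 𝓝[>] (0:ℝ)) (f := fun ε : ℝ => 2 ^ n * ENNReal.ofReal ε) ?_
      (eventually_nhdsWithin_of_forall key)) zero_le
    have h1 : Tendsto (fun ε : ℝ => ENNReal.ofReal ε) (𝓝[>] (0:ℝ)) (𝓝 0) := by
      have := (ENNReal.continuous_ofReal.tendsto 0).mono_left (nhdsWithin_le_nhds (s := Set.Ioi 0))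
      simpa using this
    have := ENNReal.Tendsto.const_mul (a := 2 ^ n) h1 (Or.inr (by finiteness))
    simpa using this
  filter_upwards [hN.zero _ (kccmp_meas μ I hum).enorm hz] with z h
  simpa using h

/-- truncation set -/
def kcA (k : ℕ) (f : (Fin n → Ω) × ℝ → ℝ) : Set ((Fin n → Ω) × ℝ) :=
  {z | |f z| ≤ k ∧ |z.2| ≤ k}

lemma kcA_meas (k : ℕ) {f : (Fin n → Ω) × ℝ → ℝ} (hf : Measurable f) : MeasurableSet (kcA k f) :=
  (measurableSet_le hf.abs measurable_const).inter
    (measurableSet_le measurable_snd.abs measurable_const)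

/-- truncation -/
noncomputable def kctr (k : ℕ) (f : (Fin n → Ω) × ℝ → ℝ) : (Fin n → Ω) × ℝ → ℝ :=
  (kcA k f).indicator f

lemma kctr_meas (k : ℕ) {f : (Fin n → Ω) × ℝ → ℝ} (hf : Measurable f) : Measurable (kctr k f) :=
  hf.indicator (kcA_meas k hf)

lemma kctr_bound (k : ℕ) (f : (Fin n → Ω) × ℝ → ℝ) (z) : |kctr k f z| ≤ k := by
  unfold kctr
  by_cases h : z ∈ kcA k f
  · simpa [h] using h.1
  · simp [h]

lemma kctr_good (k : ℕ) {f : (Fin n → Ω) × ℝ → ℝ} (hf : Measurable f) (z) :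
    KcGood μ (kctr k f) z := by
  intro J
  refine Integrable.of_bound ((kctr_meas k hf).comp (kcmeas_slice J z)).aestronglyMeasurable k ?_
  exact ae_of_all _ fun y => kctr_bound k f _

lemma kctr_n2 (k : ℕ) {f : (Fin n → Ω) × ℝ → ℝ} (hf : Measurable f) :
    kcn2 μ (fun z => ‖kctr k f z‖ₑ) < ⊤ := by
  unfold kcn2
  refine ENNReal.rpow_lt_top_of_nonneg (by norm_num) (ne_of_lt ?_)
  have hS : MeasurableSet {z : (Fin n → Ω) × ℝ | |z.2| ≤ k} :=
    measurableSet_le measurable_snd.abs measurable_const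
  calc ∫⁻ z, ‖kctr k f z‖ₑ ^ 2 ∂kcZ μ n
      ≤ ∫⁻ z, {z : (Fin n → Ω) × ℝ | |z.2| ≤ k}.indicator (fun _ => ENNReal.ofReal k ^ 2) z ∂kcZ μ n := by
        refine lintegral_mono fun z => ?_
        by_cases h : |z.2| ≤ k
        · simp only [Set.indicator, Set.mem_ofPred_eq, h, if_true]
          rw [Real.enorm_eq_ofReal_abs]
          gcongr
          exact kctr_bound k f z
        · have : z ∉ kcA k f := fun h' => h h'.2
          simp [kctr, this]
    _ = ENNReal.ofReal k ^ 2 * kcZ μ n {z : (Fin n → Ω) × ℝ | |z.2| ≤ k} :=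
        lintegral_indicator_const hS _
    _ < ⊤ := by
        refine ENNReal.mul_lt_top (by finiteness) ?_
        have : {z : (Fin n → Ω) × ℝ | |z.2| ≤ k} = Set.univ ×ˢ Set.Icc (-(k:ℝ)) k := by
          ext z; simp [abs_le]
        rw [this, Measure.prod_prod]
        simp

lemma kctr_tend (hN : KcLat μ N) {f : (Fin n → Ω) × ℝ → ℝ} (hf : Measurable f)
    (h : N (fun z => ‖f z‖ₑ) < ⊤) :
    Tendsto (fun k => N (fun z => ‖f z - kctr k f z‖ₑ)) atTop (𝓝 0) := by
  have := hN.dom _ hf.enorm h (fun k => (kcA k f)ᶜ) (fun k => (kcA_meas k hf).compl) (by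
    intro z
    obtain ⟨k0, hk0⟩ := exists_nat_ge (max |f z| |z.2|)
    filter_upwards [eventually_ge_atTop k0] with k hk
    simp only [Set.mem_compl_iff, not_not]
    have : (k0 : ℝ) ≤ k := by exact_mod_cast hk
    exact ⟨(le_max_left _ _).trans (hk0.trans this), (le_max_right _ _).trans (hk0.trans this)⟩)
  refine this.congr fun k => ?_
  congr 1
  funext z
  by_cases h : z ∈ kcA k f <;> simp [kctr, h]

variable (μ M) in
/-- truncation, projected -/
noncomputable def kctrV (k : ℕ) (f : (Fin n → Ω) × ℝ → ℝ) (z : (Fin n → Ω) × ℝ) : ℝ :=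
  ∑ I : Finset (Fin n) with I.card ≤ M, kccmp μ I (kctr k f) z

lemma kctrV_meas (k : ℕ) {f : (Fin n → Ω) × ℝ → ℝ} (hf : Measurable f) :
    Measurable (kctrV μ M k f) :=
  Finset.measurable_fun_sum _ fun I _ => kccmp_meas μ I (kctr_meas k hf)

lemma kctrV_inV (k : ℕ) {f : (Fin n → Ω) × ℝ → ℝ} (hf : Measurable f) :
    KcInV μ M (kctrV μ M k f) := by
  intro L hL
  refine ae_of_all _ fun z => ?_
  unfold kctrV
  rw [KcGood.cmp_sum _ fun I _ => (kctr_good k hf z).cmp (kctr_meas k hf) I]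
  refine Finset.sum_eq_zero fun I hI => ?_
  refine kccmp_of_dep μ (kccmp_dep μ I _) (fun h => ?_) z
  have := Finset.card_le_card h
  simp at hI
  omega

lemma kc_inV_sum {f : (Fin n → Ω) × ℝ → ℝ} (hV : KcInV μ M f) :
    ∀ᵐ z ∂kcZ μ n, f z = ∑ I : Finset (Fin n) with I.card ≤ M, kccmp μ I f z := by
  have : ∀ᵐ z ∂kcZ μ n, ∀ I : Finset (Fin n), M < I.card → kccmp μ I f z = 0 := by
    rw [ae_all_iff]; intro I
    by_cases h : M < I.card
    · filter_upwards [hV I h] with z hz _ using hz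
    · exact ae_of_all _ fun z h' => absurd h' h
  filter_upwards [this] with z hz
  conv_lhs => rw [← kccmp_sum μ f z]
  rw [Finset.sum_filter]
  refine Finset.sum_congr rfl fun I _ => ?_
  split_ifs with h
  · rfl
  · exact hz I (not_le.1 h)

lemma kctrV_tend (hN : KcLat μ N) {f : (Fin n → Ω) × ℝ → ℝ} (hf : Measurable f)
    (h : N (fun z => ‖f z‖ₑ) < ⊤) (hV : KcInV μ M f) :
    Tendsto (fun k => N (fun z => ‖f z - kctrV μ M k f z‖ₑ)) atTop (𝓝 0) := by
  have hb : ∀ k, N (fun z => ‖f z - kctrV μ M k f z‖ₑ)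
      ≤ (2 ^ n * 2 ^ n) * N (fun z => ‖f z - kctr k f z‖ₑ) := by
    intro k
    have hm : Measurable (fun z => f z - kctr k f z) := hf.sub (kctr_meas k hf)
    calc _ = N (fun z => ‖∑ I : Finset (Fin n) with I.card ≤ M,
            kccmp μ I (fun z => f z - kctr k f z) z‖ₑ) := by
          refine hN.congr ?_
          filter_upwards [kc_inV_sum hV, hN.good hf h] with z hz hg
          unfold kctrV
          conv_lhs => rw [hz]
          rw [← Finset.sum_sub_distrib]
          congr 1
          refine Finset.sum_congr rfl fun I _ => ?_
          have e := KcGood.cmp_add (hg.sub (kctr_good k hf z)) (kctr_good k hf z) I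
          simp only [sub_add_cancel] at e
          rw [e]; ring
      _ ≤ ∑ I : Finset (Fin n) with I.card ≤ M,
            N (fun z => ‖kccmp μ I (fun z => f z - kctr k f z) z‖ₑ) :=
          hN.esum _ _ fun I _ => kccmp_meas μ I hm
      _ ≤ ∑ I : Finset (Fin n) with I.card ≤ M, 2 ^ n * N (fun z => ‖f z - kctr k f z‖ₑ) :=
          Finset.sum_le_sum fun I _ => hN.cmp_le hm I
      _ ≤ ∑ I : Finset (Fin n), 2 ^ n * N (fun z => ‖f z - kctr k f z‖ₑ) :=
          Finset.sum_le_sum_of_subset (Finset.subset_univ _)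
      _ = _ := by simp [mul_assoc]
  refine tendsto_of_tendsto_of_tendsto_of_le_of_le tendsto_const_nhds ?_ (fun _ => zero_le) hb
  have := ENNReal.Tendsto.const_mul (a := 2 ^ n * 2 ^ n) (kctr_tend hN hf h)
    (Or.inr (by finiteness))
  simpa using this

lemma kctrV_fin (hN : KcLat μ N) {k : ℕ} {f : (Fin n → Ω) × ℝ → ℝ} (hf : Measurable f)
    (h : N (fun z => ‖kctr k f z‖ₑ) < ⊤) : N (fun z => ‖kctrV μ M k f z‖ₑ) < ⊤ := by
  refine (hN.esum _ _ fun I _ => kccmp_meas μ I (kctr_meas k hf)).trans_lt ?_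
  refine ENNReal.sum_lt_top.2 fun I _ => ?_
  refine (hN.cmp_le (kctr_meas k hf) I).trans_lt ?_
  exact ENNReal.mul_lt_top (by finiteness) h

lemma kctr_fin (hN : KcLat μ N) {k : ℕ} {f : (Fin n → Ω) × ℝ → ℝ} 
    (h : N (fun z => ‖f z‖ₑ) < ⊤) : N (fun z => ‖kctr k f z‖ₑ) < ⊤ := by
  refine (hN.mono _ _ (ae_of_all _ fun z => ?_)).trans_lt h
  by_cases h : z ∈ kcA k f <;> simp [kctr, h]

lemma kcav_update {f : (Fin n → Ω) × ℝ → ℝ} (hf : Measurable f) (x : Fin n → Ω) (s : ℝ)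
    (j : Fin n) : ∫ z, f (Function.update x j z, s) ∂μ = kcav μ {j}ᶜ f (x, s) := by
  unfold kcav
  have hm : ∀ y : Fin n → Ω, kcmix {j}ᶜ x y = Function.update x j (y j) := by
    intro y
    funext i
    by_cases h : i = j
    · subst h; simp [kcmix]
    · simp [kcmix, h]
  simp only [hm]
  have mp := measurePreserving_eval (fun _ : Fin n => μ) j
  conv_lhs => rw [← mp.map_eq]
  rw [integral_map mp.measurable.aemeasurable]
  · refine Measurable.aestronglyMeasurable ?_
    exact hf.comp ((measurable_update x).prodMk measurable_const)

lemma kc_extend_meas {m : ℕ} (i : Fin m → Fin n) (hi : Function.Injective i) (ω : Ω) :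
    Measurable (fun y : Fin m → Ω => Function.extend i y (fun _ => ω)) := by
  rw [measurable_pi_iff]
  intro j
  by_cases h : ∃ k, i k = j
  · obtain ⟨k, rfl⟩ := h
    simp only [hi.extend_apply]
    exact measurable_pi_apply k
  · simp only [Function.extend_apply' _ _ _ h]
    exact measurable_const

lemma kc_extend_mix {m : ℕ} (i : Fin m → Fin n) (hi : Function.Injective i) (ω : Ω)
    (x : Fin n → Ω) :
    Function.extend i (fun k => x (i k)) (fun _ => ω) = kcmix (Finset.univ.image i) x (fun _ => ω) := by
  funext j
  by_cases h : ∃ k, i k = j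
  · obtain ⟨k, rfl⟩ := h
    simp [kcmix, hi.extend_apply]
  · rw [Function.extend_apply' _ _ _ h]
    have : j ∉ Finset.univ.image i := by simpa using h
    simp [kcmix, this]

lemma kc_extend_update {m : ℕ} (i : Fin m → Fin n) (hi : Function.Injective i) (ω z : Ω)
    (y : Fin m → Ω) (k : Fin m) :
    Function.extend i (Function.update y k z) (fun _ => ω)
      = Function.update (Function.extend i y (fun _ => ω)) (i k) z := by
  funext j
  by_cases h : ∃ k, i k = j
  · obtain ⟨k', rfl⟩ := h
    by_cases hk : k' = k
    · subst hk; simp [hi.extend_apply]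
    · simp [hi.extend_apply, Function.update_of_ne hk, Function.update_of_ne (hi.ne hk)]
  · have : j ≠ i k := fun h' => h ⟨k, h'.symm⟩
    rw [Function.update_of_ne this, Function.extend_apply' _ _ _ h, Function.extend_apply' _ _ _ h]

lemma kc_sum_strict (m : ℕ) (a : Finset (Fin n) → ℝ) :
    ∑ i : Fin m → Fin n, (if StrictMono i then a (Finset.univ.image i) else 0)
      = ∑ I : Finset (Fin n) with I.card = m, a I := by
  classical
  rw [← Finset.sum_filter]
  refine Finset.sum_nbij (fun i => Finset.univ.image i) ?_ ?_ ?_ (fun _ _ => rfl)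
  · intro i hi
    simp at hi ⊢
    rw [Finset.card_image_of_injective _ hi.injective]; simp
  · intro i hi j hj h
    simp at hi hj h
    refine (StrictMono.range_inj hi hj).1 ?_
    have := congrArg (fun s : Finset (Fin n) => (s : Set (Fin n))) h
    simpa using this
  · intro I hI
    simp at hI
    refine ⟨I.orderEmbOfFin hI, by simpa using (I.orderEmbOfFin hI).strictMono, ?_⟩
    apply Finset.coe_injective
    simp

lemma kc_mem_of_inV (hN : KcLat μ N) {NN : ((Fin n → Ω) → ℝ → ℝ) → ℝ≥0∞}
    (hNN : ∀ F, Measurable (Function.uncurry F) → NN F = N (fun z => ‖Function.uncurry F z‖ₑ))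
    {f : (Fin n → Ω) × ℝ → ℝ} (hf : Measurable f) (hfin : N (fun z => ‖f z‖ₑ) < ⊤)
    (hV : KcInV μ M f) : MemV1leM μ M NN (fun x s => f (x, s)) := by
  obtain ⟨ω⟩ : Nonempty Ω := nonempty_of_isProbabilityMeasure μ
  refine ⟨hf, ?_, fun ε hε => ?_⟩
  · exact (hNN (fun x s => f (x, s)) hf).trans_lt hfin
  obtain ⟨k, hk⟩ := ((kctrV_tend hN hf hfin hV).eventually_le_const
    (show 0 < ENNReal.ofReal ε by simpa using hε)).exists
  set h := kctr k f with hh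
  have hhm : Measurable h := kctr_meas k hf
  have hhg : ∀ z, KcGood μ h z := kctr_good k hf
  classical
  set g : (m : ℕ) → (Fin m → Fin n) → (Fin m → Ω) → ℝ → ℝ := fun m i y s =>
    if StrictMono i then kccmp μ (Finset.univ.image i) h (Function.extend i y (fun _ => ω), s) else 0
    with hg
  have hgx : ∀ m (i : Fin m → Fin n) x s, g m i (fun k => x (i k)) s
      = if StrictMono i then kccmp μ (Finset.univ.image i) h (x, s) else 0 := by
    intro m i x s
    simp only [hg]
    split_ifs with hi
    · rw [kc_extend_mix i hi.injective, kccmp_dep]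
    · rfl
  refine ⟨g, ?_, ?_, ?_, ?_, ?_⟩
  · intro m i
    by_cases hi : StrictMono i
    · simp only [hg, hi, if_true]
      exact (kccmp_meas μ _ hhm).comp
        (((kc_extend_meas i hi.injective ω).comp measurable_fst).prodMk measurable_snd)
    · simp only [hg, hi, if_false]
      exact measurable_const
  · intro m i hi
    funext y s
    simp [hg, hi]
  · intro m i k'
    refine ae_of_all _ fun s => ae_of_all _ fun y => ?_
    by_cases hi : StrictMono i
    · simp only [hg, hi, if_true, kc_extend_update i hi.injective]
      rw [kcav_update (kccmp_meas μ _ hhm)]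
      refine (hhg _).av_cmp hhm fun hc => ?_
      have := hc (Finset.mem_image_of_mem i (Finset.mem_univ k'))
      simp at this
    · simp [hg, hi]
  · intro m i
    simp only [hgx]
    by_cases hi : StrictMono i
    · simp only [hi, if_true]
      have hmI : Measurable (Function.uncurry fun x s => kccmp μ (Finset.univ.image i) h (x, s)) :=
        kccmp_meas μ (Finset.univ.image i) hhm
      rw [hNN _ hmI]
      refine (hN.cmp_le hhm _).trans_lt (ENNReal.mul_lt_top (by finiteness) (kctr_fin hN hfin))
    · simp only [hi, if_false]
      rw [hNN _ measurable_const]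
      simpa [Function.uncurry_def] using hN.null.trans_lt (by simp)
  · simp only [hgx]
    have e : ∀ x s, ∑ m ∈ Finset.range (M + 1), ∑ i : Fin m → Fin n,
        (if StrictMono i then kccmp μ (Finset.univ.image i) h (x, s) else 0)
        = kctrV μ M k f (x, s) := by
      intro x s
      unfold kctrV
      rw [← Finset.sum_fiberwise_of_maps_to (s := {I : Finset (Fin n) | I.card ≤ M})
        (t := Finset.range (M + 1)) (g := fun I => I.card)
        (fun I hI => by simp at hI ⊢; omega)]
      refine Finset.sum_congr rfl fun m hm => ?_
      rw [kc_sum_strict m (fun I => kccmp μ I h (x, s))]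
      refine Finset.sum_congr ?_ fun _ _ => rfl
      ext I
      simp at hm ⊢
      omega
    simp only [e]
    have hm2 : Measurable (Function.uncurry fun x s => f (x, s) - kctrV μ M k f (x, s)) :=
      hf.sub (kctrV_meas k hf)
    rw [hNN _ hm2]
    exact hk

end membership

section hilbert
set_option linter.unusedSectionVars false

open Filter Topology

variable {n : ℕ} (μ : Measure Ω) [IsProbabilityMeasure μ]

def KcL2 (f : (Fin n → Ω) × ℝ → ℝ) : Prop := Measurable f ∧ MemLp f 2 (kcZ μ n)

variable {μ} {M : ℕ}

lemma KcL2.fin {f : (Fin n → Ω) × ℝ → ℝ} (hf : KcL2 μ f) : kcn2 μ (fun z => ‖f z‖ₑ) < ⊤ :=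
  (kc_memLp μ hf.1).1 hf.2

lemma KcL2.mk {f : (Fin n → Ω) × ℝ → ℝ} (hf : Measurable f) (h : kcn2 μ (fun z => ‖f z‖ₑ) < ⊤) :
    KcL2 μ f := ⟨hf, (kc_memLp μ hf).2 h⟩

lemma KcL2.good {f : (Fin n → Ω) × ℝ → ℝ} (hf : KcL2 μ f) : ∀ᵐ z ∂kcZ μ n, KcGood μ f z :=
  (kclat2 μ).good hf.1 hf.fin

lemma KcL2.add {f g : (Fin n → Ω) × ℝ → ℝ} (hf : KcL2 μ f) (hg : KcL2 μ g) :
    KcL2 μ (fun z => f z + g z) := ⟨hf.1.add hg.1, hf.2.add hg.2⟩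

lemma KcL2.sub {f g : (Fin n → Ω) × ℝ → ℝ} (hf : KcL2 μ f) (hg : KcL2 μ g) :
    KcL2 μ (fun z => f z - g z) := ⟨hf.1.sub hg.1, hf.2.sub hg.2⟩

lemma KcL2.smul {f : (Fin n → Ω) × ℝ → ℝ} (hf : KcL2 μ f) (c : ℝ) :
    KcL2 μ (fun z => c * f z) := ⟨hf.1.const_mul c, hf.2.const_mul c⟩

lemma KcL2.sum {ι : Type*} (s : Finset ι) {f : ι → (Fin n → Ω) × ℝ → ℝ}
    (hf : ∀ i ∈ s, KcL2 μ (f i)) : KcL2 μ (fun z => ∑ i ∈ s, f i z) :=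
  ⟨Finset.measurable_fun_sum _ fun i hi => (hf i hi).1, memLp_finsetSum _ fun i hi => (hf i hi).2⟩

lemma KcL2.av {f : (Fin n → Ω) × ℝ → ℝ} (hf : KcL2 μ f) (J : Finset (Fin n)) :
    KcL2 μ (kcav μ J f) := by
  refine KcL2.mk (kcav_meas μ J hf.1) ?_
  refine ((kclat2 μ).mono _ _ (ae_of_all _ fun z => kcav_enorm J f z)).trans_lt ?_
  exact ((kclat2 μ).lav J _ hf.1.enorm).trans_lt hf.fin

lemma KcL2.cmp {f : (Fin n → Ω) × ℝ → ℝ} (hf : KcL2 μ f) (I : Finset (Fin n)) :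
    KcL2 μ (kccmp μ I f) := KcL2.sum _ fun J _ => (hf.av J).smul _

/-- the indicator -/
noncomputable def kcind (A : Set ((Fin n → Ω) × ℝ)) : (Fin n → Ω) × ℝ → ℝ := A.indicator fun _ => 1

lemma kcind_meas {A : Set ((Fin n → Ω) × ℝ)} (hA : MeasurableSet A) : Measurable (kcind A) :=
  measurable_const.indicator hA

lemma KcL2.ind {f : (Fin n → Ω) × ℝ → ℝ} (hf : KcL2 μ f) {A : Set ((Fin n → Ω) × ℝ)}
    (hA : MeasurableSet A) : KcL2 μ (fun z => kcind A z * f z) := by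
  have hm : Measurable (fun z => kcind A z * f z) := (kcind_meas hA).mul hf.1
  refine ⟨hm, hf.2.of_le hm.aestronglyMeasurable (ae_of_all _ fun z => ?_)⟩
  by_cases h : z ∈ A <;> simp [kcind, h]

lemma KcL2.integrable {f g : (Fin n → Ω) × ℝ → ℝ} (hf : KcL2 μ f) (hg : KcL2 μ g) :
    Integrable (fun z => f z * g z) (kcZ μ n) := hf.2.integrable_mul hg.2

lemma kc_sa {f g : (Fin n → Ω) × ℝ → ℝ} (hf : KcL2 μ f) (hg : KcL2 μ g) (K : Finset (Fin n)) :
    ∫ z, f z * kcav μ K g z ∂kcZ μ n = ∫ z, kcav μ K f z * g z ∂kcZ μ n := by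
  have mf : MeasurePreserving (Prod.fst : ((Fin n → Ω) × ℝ) × (Fin n → Ω) → _)
    ((kcZ μ n).prod (kcP μ n)) (kcZ μ n) := measurePreserving_fst
  have a1 : MemLp (fun p : ((Fin n → Ω) × ℝ) × (Fin n → Ω) => f p.1) 2
    ((kcZ μ n).prod (kcP μ n)) := hf.2.comp_measurePreserving mf
  have a2 : MemLp (fun p : ((Fin n → Ω) × ℝ) × (Fin n → Ω) => g p.1) 2
    ((kcZ μ n).prod (kcP μ n)) := hg.2.comp_measurePreserving mf
  have b1 : MemLp (fun p : ((Fin n → Ω) × ℝ) × (Fin n → Ω) => f (kcmix K p.1.1 p.2, p.1.2)) 2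
    ((kcZ μ n).prod (kcP μ n)) := hf.2.comp_measurePreserving (kc_mpZ μ K)
  have b2 : MemLp (fun p : ((Fin n → Ω) × ℝ) × (Fin n → Ω) => g (kcmix K p.1.1 p.2, p.1.2)) 2
    ((kcZ μ n).prod (kcP μ n)) := hg.2.comp_measurePreserving (kc_mpZ μ K)
  have i1 : Integrable (fun p : ((Fin n → Ω) × ℝ) × (Fin n → Ω) =>
      f p.1 * g (kcmix K p.1.1 p.2, p.1.2)) ((kcZ μ n).prod (kcP μ n)) := a1.integrable_mul b2
  have i2 : Integrable (fun p : ((Fin n → Ω) × ℝ) × (Fin n → Ω) =>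
      f (kcmix K p.1.1 p.2, p.1.2) * g p.1) ((kcZ μ n).prod (kcP μ n)) := b1.integrable_mul a2
  have h1 : ∫ z, f z * kcav μ K g z ∂kcZ μ n
      = ∫ p : ((Fin n → Ω) × ℝ) × (Fin n → Ω), f p.1 * g (kcmix K p.1.1 p.2, p.1.2)
        ∂((kcZ μ n).prod (kcP μ n)) := by
    rw [integral_prod _ i1]
    simp only [integral_const_mul]
    rfl
  have h2 : ∫ z, kcav μ K f z * g z ∂kcZ μ n
      = ∫ p : ((Fin n → Ω) × ℝ) × (Fin n → Ω), f (kcmix K p.1.1 p.2, p.1.2) * g p.1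
        ∂((kcZ μ n).prod (kcP μ n)) := by
    rw [integral_prod _ i2]
    simp only [integral_mul_const]
    rfl
  rw [h1, h2]
  have mp := kc_mpZ2 (n := n) μ K
  have := integral_map (μ := (kcZ μ n).prod (kcP μ n)) mp.measurable.aemeasurable
    (f := fun p : ((Fin n → Ω) × ℝ) × (Fin n → Ω) => f (kcmix K p.1.1 p.2, p.1.2) * g p.1)
    (by rw [mp.map_eq]; exact i2.aestronglyMeasurable)
  rw [mp.map_eq] at this
  rw [this]
  simp only [kcmix_swap]

lemma kc_sac {f g : (Fin n → Ω) × ℝ → ℝ} (hf : KcL2 μ f) (hg : KcL2 μ g) (I : Finset (Fin n)) :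
    ∫ z, f z * kccmp μ I g z ∂kcZ μ n = ∫ z, kccmp μ I f z * g z ∂kcZ μ n := by
  unfold kccmp kcM
  simp only [Finset.mul_sum, Finset.sum_mul]
  rw [integral_finsetSum _ fun J _ => hf.integrable ((hg.av J).smul _),
    integral_finsetSum _ fun J _ => KcL2.integrable ((hf.av J).smul _) hg]
  refine Finset.sum_congr rfl fun J _ => ?_
  simp only [mul_assoc, mul_left_comm (f _)]
  rw [integral_const_mul, integral_const_mul, kc_sa hf hg]

lemma kc_orth_aux {f g : (Fin n → Ω) × ℝ → ℝ} (hf : KcL2 μ f) (hg : KcL2 μ g)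
    {A : Set ((Fin n → Ω) × ℝ)} (hA : MeasurableSet A) {I L : Finset (Fin n)}
    (hdep : KcDep L (kcind A)) (hIL : ¬ I ⊆ L) :
    ∫ z, kcind A z * kccmp μ I f z * kccmp μ L g z ∂kcZ μ n = 0 := by
  have h1 : ∀ z, kccmp μ L g z = kcav μ L (kccmp μ L g) z := fun z => (kcav_cmp_self L).symm
  calc _ = ∫ z, (kcind A z * kccmp μ I f z) * kcav μ L (kccmp μ L g) z ∂kcZ μ n := by
        simp only [← h1]
    _ = ∫ z, kcav μ L (fun z => kcind A z * kccmp μ I f z) z * kccmp μ L g z ∂kcZ μ n :=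
        kc_sa ((hf.cmp I).ind hA) (hg.cmp L) L
    _ = 0 := by
        refine integral_eq_zero_of_ae ?_
        filter_upwards [hf.good] with z hz
        have : kcav μ L (fun z => kcind A z * kccmp μ I f z) z
            = kcind A z * kcav μ L (kccmp μ I f) z := by
          unfold kcav
          simp only [hdep z.1 _ z.2]
          exact integral_const_mul _ _
        rw [this, hz.av_cmp hf.1 hIL]
        simp

lemma kc_orth {f g : (Fin n → Ω) × ℝ → ℝ} (hf : KcL2 μ f) (hg : KcL2 μ g)
    {A : Set ((Fin n → Ω) × ℝ)} (hA : MeasurableSet A) {I L K : Finset (Fin n)}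
    (hdep : KcDep K (kcind A)) (hI : K ⊆ I) (hL : K ⊆ L) (hIL : I ≠ L) :
    ∫ z, kcind A z * kccmp μ I f z * kccmp μ L g z ∂kcZ μ n = 0 := by
  by_cases h : I ⊆ L
  · have h' : ¬ L ⊆ I := fun h2 => hIL (Finset.Subset.antisymm h h2)
    rw [← kc_orth_aux hg hf hA (hdep.mono hI) h']
    congr 1
    funext z; ring
  · exact kc_orth_aux hf hg hA (hdep.mono hL) h

/-- `∫ f φ = ∑ ∫ f_I φ_I` -/
lemma kc_inner {f φ : (Fin n → Ω) × ℝ → ℝ} (hf : KcL2 μ f) (hφ : KcL2 μ φ) (hV : KcInV μ M f) :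
    ∫ z, f z * φ z ∂kcZ μ n
      = ∑ I : Finset (Fin n) with I.card ≤ M, ∫ z, kccmp μ I f z * kccmp μ I φ z ∂kcZ μ n := by
  have h1 : ∫ z, f z * φ z ∂kcZ μ n
      = ∫ z, ∑ I : Finset (Fin n) with I.card ≤ M, kccmp μ I f z * φ z ∂kcZ μ n := by
    refine integral_congr_ae ?_
    filter_upwards [kc_inV_sum hV] with z hz
    rw [← Finset.sum_mul, ← hz]
  rw [h1, integral_finsetSum _ fun I _ => (hf.cmp I).integrable hφ]
  refine Finset.sum_congr rfl fun I _ => ?_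
  have h2 : ∀ z, kccmp μ I f z * φ z = ∑ L, kccmp μ I f z * kccmp μ L φ z := by
    intro z
    rw [← Finset.mul_sum, kccmp_sum]
  simp only [h2]
  rw [integral_finsetSum _ fun L _ => (hf.cmp I).integrable (hφ.cmp L)]
  refine Finset.sum_eq_single I (fun L _ hL => ?_) (by simp)
  have := kc_orth hf hφ (A := Set.univ) MeasurableSet.univ (I := I) (L := L) (K := ∅)
    (fun x y s => by simp [kcind]) (by simp) (by simp) hL.symm
  simpa [kcind] using this

variable (μ M) in
/-- the partial sum over `I ⊇ K`, `|I| ≤ M` -/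
noncomputable def kcpsi (K : Finset (Fin n)) (f : (Fin n → Ω) × ℝ → ℝ) (z : (Fin n → Ω) × ℝ) : ℝ :=
  ∑ I : Finset (Fin n) with K ⊆ I ∧ I.card ≤ M, kccmp μ I f z

lemma KcL2.psi {f : (Fin n → Ω) × ℝ → ℝ} (hf : KcL2 μ f) (K : Finset (Fin n)) :
    KcL2 μ (kcpsi μ M K f) := KcL2.sum _ fun I _ => hf.cmp I

lemma kcpsi_inV {f : (Fin n → Ω) × ℝ → ℝ} (hf : KcL2 μ f) (K : Finset (Fin n)) :
    KcInV μ M (kcpsi μ M K f) := by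
  intro L hL
  filter_upwards [hf.good] with z hz
  unfold kcpsi
  rw [KcGood.cmp_sum _ fun I _ => hz.cmp hf.1 I]
  refine Finset.sum_eq_zero fun I hI => ?_
  refine kccmp_of_dep μ (kccmp_dep μ I _) (fun h => ?_) z
  have := Finset.card_le_card h
  simp at hI
  omega

/-- adjointness -/
lemma kcpsi_sa {f φ : (Fin n → Ω) × ℝ → ℝ} (hf : KcL2 μ f) (hφ : KcL2 μ φ) (K : Finset (Fin n)) :
    ∫ z, kcpsi μ M K f z * φ z ∂kcZ μ n = ∫ z, f z * kcpsi μ M K φ z ∂kcZ μ n := by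
  unfold kcpsi
  simp only [Finset.mul_sum, Finset.sum_mul]
  rw [integral_finsetSum _ fun I _ => (hf.cmp I).integrable hφ,
    integral_finsetSum _ fun I _ => hf.integrable (hφ.cmp I)]
  exact Finset.sum_congr rfl fun I _ => (kc_sac hf hφ I).symm

/-- norm of the inner truncated projection -/
lemma kcpsi_norm {N : ((Fin n → Ω) × ℝ → ℝ≥0∞) → ℝ≥0∞} (hN : KcLat μ N)
    {φ : (Fin n → Ω) × ℝ → ℝ} (hφ : KcL2 μ φ) {K : Finset (Fin n)} (hK : K.card ≤ M)
    {A : Set ((Fin n → Ω) × ℝ)} (hA : MeasurableSet A) (hdep : KcDep K (kcind A)) :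
    N (fun z => ‖kcpsi μ M K (fun z => kcind A z * kcpsi μ M K φ z) z‖ₑ)
      ≤ 2 ^ M * N (fun z => ‖kcind A z * kcpsi μ M K φ z‖ₑ) := by
  set g : (Fin n → Ω) × ℝ → ℝ := fun z => kcind A z * kcpsi μ M K φ z with hg
  have hg2 : KcL2 μ g := (hφ.psi K).ind hA
  have hz0 : ∀ᵐ z ∂kcZ μ n, ∀ I : Finset (Fin n), M < I.card → K ⊆ I → kccmp μ I g z = 0 := by
    filter_upwards [ae_all_iff.2 fun I => ((hφ.cmp I).ind hA).good] with z hz I hI hKI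
    have : g = fun z => ∑ L : Finset (Fin n) with K ⊆ L ∧ L.card ≤ M, kcind A z * kccmp μ L φ z := by
      funext z; simp only [hg, kcpsi, Finset.mul_sum]
    rw [this, KcGood.cmp_sum _ fun L _ => hz L]
    refine Finset.sum_eq_zero fun L hL => ?_
    simp at hL
    refine kccmp_of_dep μ (I := L) (fun x y s => ?_) (fun h => ?_) z
    · rw [hdep.mono hL.1, kccmp_dep]
    · have := Finset.card_le_card h
      omega
  calc _ ≤ N (fun z => ∑ J ∈ K.powerset, kclav μ Jᶜ (fun z => ‖g z‖ₑ) z) := by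
        refine hN.mono _ _ ?_
        filter_upwards [hz0] with z hz
        have e1 : kcpsi μ M K g z = ∑ I : Finset (Fin n) with K ⊆ I, kccmp μ I g z := by
          unfold kcpsi
          refine Finset.sum_subset_zero_on_sdiff (fun I hI => by simp at hI ⊢; exact hI.1)
            (fun I hI => ?_) (fun _ _ => rfl)
          simp at hI
          exact hz I (hI.2 hI.1) hI.1
        rw [e1]
        have e2 := kcM_D (fun J => kcav μ J g z) K
        unfold kccmp
        rw [← e2]
        refine (enorm_sum_le _ _).trans (Finset.sum_le_sum fun J _ => ?_)
        simpa [enorm_mul, enorm_pow] using kcav_enorm Jᶜ g z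
    _ ≤ ∑ J ∈ K.powerset, N (kclav μ Jᶜ (fun z => ‖g z‖ₑ)) :=
        hN.sum _ _ fun J _ => kclav_meas μ Jᶜ hg2.1.enorm
    _ ≤ ∑ J ∈ K.powerset, N (fun z => ‖g z‖ₑ) :=
        Finset.sum_le_sum fun J _ => hN.lav Jᶜ _ hg2.1.enorm
    _ = 2 ^ K.card * N (fun z => ‖g z‖ₑ) := by simp
    _ ≤ _ := by
        gcongr
        norm_num

variable (μ M) in
noncomputable def kcw (K : Finset (Fin n)) (φ : (Fin n → Ω) × ℝ → ℝ) (z : (Fin n → Ω) × ℝ) : ℝ≥0∞ :=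
  ∑ I : Finset (Fin n) with K ⊆ I ∧ I.card ≤ M, kclav μ K (fun z => ‖kccmp μ I φ z‖ₑ ^ 2) z

lemma kcw_meas (K : Finset (Fin n)) {φ : (Fin n → Ω) × ℝ → ℝ} (hφ : Measurable φ) :
    Measurable (kcw μ M K φ) :=
  Finset.measurable_fun_sum _ fun I _ => kclav_meas μ K ((kccmp_meas μ I hφ).enorm.pow_const 2)

lemma kcw_dep (K : Finset (Fin n)) (φ : (Fin n → Ω) × ℝ → ℝ) : KcDep K (kcw μ M K φ) := by
  intro x y s
  unfold kcw
  exact Finset.sum_congr rfl fun I _ => kclav_dep μ K _ x y s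

lemma kc_enorm_sq (a : ℝ) : ‖a‖ₑ ^ 2 = ENNReal.ofReal (a * a) := by
  rw [Real.enorm_eq_ofReal_abs, ← ENNReal.ofReal_pow (abs_nonneg _), sq_abs, sq]

lemma kc_ofReal_sq {f : (Fin n → Ω) × ℝ → ℝ} (hf : KcL2 μ f) :
    ENNReal.ofReal (∫ z, f z * f z ∂kcZ μ n) = ∫⁻ z, ‖f z‖ₑ ^ 2 ∂kcZ μ n := by
  rw [ofReal_integral_eq_lintegral_ofReal (hf.integrable hf) (ae_of_all _ fun z => mul_self_nonneg _)]
  simp only [kc_enorm_sq]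

lemma kcind_sq (A : Set ((Fin n → Ω) × ℝ)) (z) : kcind A z * kcind A z = kcind A z := by
  by_cases h : z ∈ A <;> simp [kcind, h]

/-- the energy identity -/
lemma kc_energy {φ : (Fin n → Ω) × ℝ → ℝ} (hφ : KcL2 μ φ) {K : Finset (Fin n)} 
    {A : Set ((Fin n → Ω) × ℝ)} (hA : MeasurableSet A) (hdep : KcDep K (kcind A)) :
    ∫⁻ z in A, kcw μ M K φ z ∂kcZ μ n
      = ∫⁻ z, ‖kcind A z * kcpsi μ M K φ z‖ₑ ^ 2 ∂kcZ μ n := by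
  have hl : ∫⁻ z in A, kcw μ M K φ z ∂kcZ μ n
      = ∑ I : Finset (Fin n) with K ⊆ I ∧ I.card ≤ M,
        ENNReal.ofReal (∫ z, kcind A z * kccmp μ I φ z * kccmp μ I φ z ∂kcZ μ n) := by
    unfold kcw
    rw [lintegral_finsetSum' _ fun I _ =>
      (kclav_meas μ K ((kccmp_meas μ I hφ.1).enorm.pow_const 2)).aemeasurable]
    refine Finset.sum_congr rfl fun I hI => ?_
    have hAd : KcDep K (A.indicator (fun _ => (1:ℝ≥0∞))) := by
      intro x y s
      have := hdep x y s
      by_cases h1 : (kcmix K x y, s) ∈ A <;> by_cases h2 : (x, s) ∈ A <;> simp_all [kcind]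
    have hm : Measurable (A.indicator (fun _ => (1:ℝ≥0∞))) := measurable_const.indicator hA
    have hI2 := (hφ.cmp I).ind hA
    have e : ∀ z, kcind A z * kccmp μ I φ z * kccmp μ I φ z
        = (kcind A z * kccmp μ I φ z) * (kcind A z * kccmp μ I φ z) := by
      intro z
      linear_combination (-kccmp μ I φ z * kccmp μ I φ z) * kcind_sq A z
    simp only [e]
    rw [kc_ofReal_sq hI2, ← lintegral_indicator hA]
    calc _ = ∫⁻ z, A.indicator (fun _ => 1) z * kclav μ K (fun z => ‖kccmp μ I φ z‖ₑ ^ 2) z ∂kcZ μ n := by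
          refine lintegral_congr fun z => ?_
          by_cases h : z ∈ A <;> simp [h]
      _ = ∫⁻ z, kclav μ K (A.indicator (fun _ => 1)) z * ‖kccmp μ I φ z‖ₑ ^ 2 ∂kcZ μ n :=
          kclav_selfadj μ K hm ((kccmp_meas μ I hφ.1).enorm.pow_const 2)
      _ = _ := by
          refine lintegral_congr fun z => ?_
          rw [kclav_self μ hAd]
          by_cases h : z ∈ A <;> simp [kcind, h]
  rw [hl, ← ENNReal.ofReal_sum_of_nonneg, ← kc_ofReal_sq ((hφ.psi K).ind hA)]
  · congr 1
    have e : ∀ z, kcind A z * kcpsi μ M K φ z * (kcind A z * kcpsi μ M K φ z)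
        = ∑ I : Finset (Fin n) with K ⊆ I ∧ I.card ≤ M,
          ∑ L : Finset (Fin n) with K ⊆ L ∧ L.card ≤ M,
            kcind A z * kccmp μ I φ z * kccmp μ L φ z := by
      intro z
      have : kcind A z * kcpsi μ M K φ z * (kcind A z * kcpsi μ M K φ z)
        = kcind A z * kcpsi μ M K φ z * kcpsi μ M K φ z := by
        linear_combination (kcpsi μ M K φ z * kcpsi μ M K φ z) * kcind_sq A z
      rw [this]
      simp only [kcpsi, Finset.mul_sum, Finset.sum_mul]
      first | rfl | rw [Finset.sum_comm]
    simp only [e]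
    have hint : ∀ I L, Integrable (fun z => kcind A z * kccmp μ I φ z * kccmp μ L φ z) (kcZ μ n) :=
      fun I L => ((hφ.cmp I).ind hA).integrable (hφ.cmp L)
    rw [integral_finsetSum _ fun I _ => integrable_finsetSum _ fun L _ => hint I L]
    refine Finset.sum_congr rfl fun I hI => ?_
    rw [integral_finsetSum _ fun L _ => hint I L]
    symm
    apply Finset.sum_eq_single I
    · intro L hL hLI
      simp at hI hL
      exact kc_orth hφ hφ hA hdep hI.1 hL.1 hLI.symm
    · exact fun h => absurd hI h
  · intro I _
    refine integral_nonneg fun z => ?_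
    have : 0 ≤ kcind A z := by by_cases h : z ∈ A <;> simp [kcind, h]
    show 0 ≤ kcind A z * kccmp μ I φ z * kccmp μ I φ z
    rw [mul_assoc]
    exact mul_nonneg this (mul_self_nonneg _)

/-- testing -/
lemma kc_test {N : ((Fin n → Ω) × ℝ → ℝ≥0∞) → ℝ≥0∞} (hN : KcLat μ N) (c : ℝ≥0∞)
    {φ : (Fin n → Ω) × ℝ → ℝ} (hφ : KcL2 μ φ)
    (hT : ∀ G, KcL2 μ G → KcInV μ M G → N (fun z => ‖G z‖ₑ) < ⊤ →
      ENNReal.ofReal (∫ z, G z * φ z ∂kcZ μ n) ≤ c * N (fun z => ‖G z‖ₑ))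
    {K : Finset (Fin n)} (hK : K.card ≤ M)
    {A : Set ((Fin n → Ω) × ℝ)} (hA : MeasurableSet A) (hdep : KcDep K (kcind A))
    (hfin : N (fun z => ‖kcind A z * kcpsi μ M K φ z‖ₑ) < ⊤) :
    ∫⁻ z in A, kcw μ M K φ z ∂kcZ μ n
      ≤ c * (2 ^ M * N (fun z => ‖kcind A z * kcpsi μ M K φ z‖ₑ)) := by
  have hg := (hφ.psi (M := M) K).ind hA
  have hn := kcpsi_norm (M := M) hN hφ hK hA hdep
  have h1 := hT _ (hg.psi K) (kcpsi_inV hg K) (hn.trans_lt (ENNReal.mul_lt_top (by finiteness) hfin))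
  rw [kcpsi_sa hg hφ] at h1
  rw [kc_energy hφ hA hdep, ← kc_ofReal_sq hg]
  have e : ∀ z, kcind A z * kcpsi μ M K φ z * (kcind A z * kcpsi μ M K φ z)
        = kcind A z * kcpsi μ M K φ z * kcpsi μ M K φ z := by
    intro z
    linear_combination (kcpsi μ M K φ z * kcpsi μ M K φ z) * kcind_sq A z
  simp only [e]
  refine h1.trans ?_
  gcongr

lemma kc_alg {a b c : ℝ≥0∞} (ha : a < ⊤) (h : a ≤ c * (a ^ ((1:ℝ)/2) * b ^ ((1:ℝ)/2))) :
    a ≤ c ^ 2 * b := by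
  by_cases h0 : a = 0
  · simp [h0]
  have h1 : a ^ ((1:ℝ)/2) * a ^ ((1:ℝ)/2) = a := by rw [← sq, kc_half_sq]
  have h2 : a ^ ((1:ℝ)/2) ≠ 0 := fun h => h0 (by rw [← h1, h]; simp)
  have h3 : a ^ ((1:ℝ)/2) ≠ ⊤ := (ENNReal.rpow_lt_top_of_nonneg (by norm_num) ha.ne).ne
  have h4 : a ^ ((1:ℝ)/2) ≤ c * b ^ ((1:ℝ)/2) := by
    rw [← ENNReal.mul_le_mul_iff_right h2 h3, h1]
    refine h.trans (le_of_eq (by ring))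
  calc a = (a ^ ((1:ℝ)/2)) ^ 2 := (kc_half_sq a).symm
    _ ≤ (c * b ^ ((1:ℝ)/2)) ^ 2 := by gcongr
    _ = _ := by rw [mul_pow, kc_half_sq]

end hilbert

section estimate
set_option linter.unusedSectionVars false

open Filter Topology

variable {n : ℕ} {μ : Measure Ω} [IsProbabilityMeasure μ] {M : ℕ}

lemma kc_dep_ind {K : Finset (Fin n)} {w : (Fin n → Ω) × ℝ → ℝ≥0∞} (hw : KcDep K w) (c : ℝ≥0∞) :
    KcDep K (kcind {z | c < w z}) := by
  intro x y s
  have := hw x y s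
  simp only [kcind, Set.indicator, Set.mem_ofPred_eq, this]

lemma kc_w_bound {φ : (Fin n → Ω) × ℝ → ℝ} (hφ : KcL2 μ φ)
    (hT : ∀ G, KcL2 μ G → KcInV μ M G → kcn0 μ (fun z => ‖G z‖ₑ) < ⊤ →
      ENNReal.ofReal (∫ z, G z * φ z ∂kcZ μ n) ≤ 1 * kcn0 μ (fun z => ‖G z‖ₑ))
    {K : Finset (Fin n)} (hK : K.card ≤ M) : ∀ᵐ z ∂kcZ μ n, kcw μ M K φ z ≤ 4 ^ M := by
  set A : Set ((Fin n → Ω) × ℝ) := {z | 4 ^ M < kcw μ M K φ z} with hAdef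
  have hw := kcw_meas (μ := μ) (M := M) K hφ.1
  have hA : MeasurableSet A := measurableSet_lt measurable_const hw
  have hdep : KcDep K (kcind A) := kc_dep_ind (kcw_dep K φ) _
  have hg := (hφ.psi (M := M) K).ind hA
  set a := ∫⁻ z in A, kcw μ M K φ z ∂kcZ μ n with ha
  have he : a = ∫⁻ z, ‖kcind A z * kcpsi μ M K φ z‖ₑ ^ 2 ∂kcZ μ n := kc_energy hφ hA hdep
  have hafin : a < ⊤ := by
    rw [he, ← kc_ofReal_sq hg]; exact ENNReal.ofReal_lt_top
  have h4 : 4 ^ M * kcZ μ n A ≤ a := by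
    rw [← setLIntegral_const]
    exact setLIntegral_mono hw fun z hz => le_of_lt hz
  have hAfin : kcZ μ n A < ⊤ := by
    refine lt_of_le_of_lt ?_ hafin
    refine le_trans ?_ h4
    exact le_mul_of_one_le_left zero_le (one_le_pow₀ (by norm_num))
  have hn0 : kcn0 μ (fun z => ‖kcind A z * kcpsi μ M K φ z‖ₑ)
      ≤ a ^ ((1:ℝ)/2) * (kcZ μ n A) ^ ((1:ℝ)/2) := by
    have := kc_cs (kcZ μ n) (fun z => ‖kcind A z * kcpsi μ M K φ z‖ₑ)
      (A.indicator fun _ => 1) hg.1.enorm (measurable_const.indicator hA)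
    rw [← he] at this
    calc _ = ∫⁻ z, ‖kcind A z * kcpsi μ M K φ z‖ₑ * A.indicator (fun _ => 1) z ∂kcZ μ n := by
          refine lintegral_congr fun z => ?_
          by_cases h : z ∈ A <;> simp [kcind, h]
      _ ≤ _ := this
      _ = _ := by
          congr 2
          rw [← lintegral_indicator_one hA]
          refine lintegral_congr fun z => ?_
          by_cases h : z ∈ A <;> simp [h]
  have hfin : kcn0 μ (fun z => ‖kcind A z * kcpsi μ M K φ z‖ₑ) < ⊤ := hn0.trans_lt
    (ENNReal.mul_lt_top (ENNReal.rpow_lt_top_of_nonneg (by norm_num) hafin.ne)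
      (ENNReal.rpow_lt_top_of_nonneg (by norm_num) hAfin.ne))
  have ht := kc_test (kclat0 μ) 1 hφ hT hK hA hdep hfin
  have h5 : a ≤ 2 ^ M * (a ^ ((1:ℝ)/2) * (kcZ μ n A) ^ ((1:ℝ)/2)) := by
    rw [one_mul] at ht
    exact ht.trans (by gcongr)
  have h6 := kc_alg hafin h5
  have h7 : ((2:ℝ≥0∞) ^ M) ^ 2 = 4 ^ M := by rw [← pow_mul, mul_comm, pow_mul]; norm_num
  rw [h7] at h6
  by_contra hcon
  have hne : kcZ μ n A ≠ 0 := by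
    intro h0
    apply hcon
    rw [ae_iff]
    simpa only [not_le] using h0
  have := setLIntegral_strict_mono hA hne hw
    (f := fun _ => 4 ^ M) (by rw [setLIntegral_const]; exact (ENNReal.mul_lt_top (by finiteness) hAfin).ne)
    (ae_of_all _ fun z hz => hz)
  rw [setLIntegral_const] at this
  exact absurd h6 (not_le.2 this)

variable (μ M) in
noncomputable def kcq (K : Finset (Fin n)) (φ : (Fin n → Ω) × ℝ → ℝ) (x : Fin n → Ω) : ℝ≥0∞ :=
  ∫⁻ s, kcw μ M K φ (x, s)

lemma kcq_meas (K : Finset (Fin n)) {φ : (Fin n → Ω) × ℝ → ℝ} (hφ : Measurable φ) :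
    Measurable (kcq μ M K φ) := Measurable.lintegral_prod_right' (kcw_meas K hφ)

lemma kc_q_bound {φ : (Fin n → Ω) × ℝ → ℝ} (hφ : KcL2 μ φ) {T : ℝ≥0∞} (hTT : T < ⊤)
    (hT : ∀ G, KcL2 μ G → KcInV μ M G → kcn1 μ (fun z => ‖G z‖ₑ) < ⊤ →
      ENNReal.ofReal (∫ z, G z * φ z ∂kcZ μ n) ≤ T * kcn1 μ (fun z => ‖G z‖ₑ))
    {K : Finset (Fin n)} (hK : K.card ≤ M) : ∀ᵐ x ∂kcP μ n, kcq μ M K φ x ≤ 4 ^ M * T ^ 2 := by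
  set B : Set (Fin n → Ω) := {x | 4 ^ M * T ^ 2 < kcq μ M K φ x} with hBdef
  have hw := kcw_meas (μ := μ) (M := M) K hφ.1
  have hq := kcq_meas (μ := μ) (M := M) K hφ.1
  have hB : MeasurableSet B := measurableSet_lt measurable_const hq
  set A : Set ((Fin n → Ω) × ℝ) := {z | 4 ^ M * T ^ 2 < kcq μ M K φ z.1} with hAdef
  have hA : MeasurableSet A := measurable_fst hB
  have hdep : KcDep K (kcind A) := by
    refine kc_dep_ind (w := fun z => kcq μ M K φ z.1) (fun x y s => ?_) _
    exact lintegral_congr fun s => kcw_dep K φ x y s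
  have hAB : ∀ x s, (x, s) ∈ A ↔ x ∈ B := fun x s => Iff.rfl
  have hg := (hφ.psi (M := M) K).ind hA
  set a := ∫⁻ z in A, kcw μ M K φ z ∂kcZ μ n with ha
  have he : a = ∫⁻ z, ‖kcind A z * kcpsi μ M K φ z‖ₑ ^ 2 ∂kcZ μ n := kc_energy hφ hA hdep
  have hafin : a < ⊤ := by
    rw [he, ← kc_ofReal_sq hg]; exact ENNReal.ofReal_lt_top
  have haB : a = ∫⁻ x in B, kcq μ M K φ x ∂kcP μ n := by
    rw [ha, ← lintegral_indicator hA, lintegral_prod _ (hw.indicator hA).aemeasurable,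
      ← lintegral_indicator hB]
    refine lintegral_congr fun x => ?_
    by_cases h : x ∈ B
    · simp [Set.indicator, hAB, h, kcq]
    · simp [Set.indicator, hAB, h]
  have hn1 : kcn1 μ (fun z => ‖kcind A z * kcpsi μ M K φ z‖ₑ)
      ≤ a ^ ((1:ℝ)/2) * (kcP μ n B) ^ ((1:ℝ)/2) := by
    have := kc_cs (kcP μ n) (fun x => (∫⁻ s, ‖kcind A (x, s) * kcpsi μ M K φ (x, s)‖ₑ ^ 2) ^ ((1:ℝ)/2))
      (B.indicator fun _ => 1) (kcn1_inner_meas hg.1.enorm) (measurable_const.indicator hB)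
    simp only [kc_half_sq] at this
    rw [he, lintegral_prod _ (hg.1.enorm.pow_const 2).aemeasurable]
    calc _ = ∫⁻ x, (∫⁻ s, ‖kcind A (x, s) * kcpsi μ M K φ (x, s)‖ₑ ^ 2) ^ ((1:ℝ)/2)
            * B.indicator (fun _ => 1) x ∂kcP μ n := by
          refine lintegral_congr fun x => ?_
          by_cases h : x ∈ B
          · simp [h]
          · simp [kcind, Set.indicator, hAB, h]
      _ ≤ _ := this
      _ = _ := by
          congr 2
          rw [← lintegral_indicator_one hB]
          refine lintegral_congr fun z => ?_
          by_cases h : z ∈ B <;> simp [h]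
  have hfin : kcn1 μ (fun z => ‖kcind A z * kcpsi μ M K φ z‖ₑ) < ⊤ := hn1.trans_lt
    (ENNReal.mul_lt_top (ENNReal.rpow_lt_top_of_nonneg (by norm_num) hafin.ne)
      (ENNReal.rpow_lt_top_of_nonneg (by norm_num) (measure_lt_top _ _).ne))
  have ht := kc_test (kclat1 μ) T hφ hT hK hA hdep hfin
  have h5 : a ≤ (T * 2 ^ M) * (a ^ ((1:ℝ)/2) * (kcP μ n B) ^ ((1:ℝ)/2)) := by
    rw [← mul_assoc] at ht
    exact ht.trans (by gcongr)
  have h6 := kc_alg hafin h5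
  have h7 : (T * (2:ℝ≥0∞) ^ M) ^ 2 = 4 ^ M * T ^ 2 := by
    rw [mul_pow, ← pow_mul, mul_comm M 2, pow_mul, mul_comm]; norm_num
  rw [h7] at h6
  by_contra hcon
  have hne : kcP μ n B ≠ 0 := by
    intro h0
    apply hcon
    rw [ae_iff]
    simpa only [not_le] using h0
  have := setLIntegral_strict_mono hB hne hq
    (f := fun _ => 4 ^ M * T ^ 2) (by
      rw [setLIntegral_const]
      exact (ENNReal.mul_lt_top (ENNReal.mul_lt_top (by finiteness) (by finiteness)) (measure_lt_top _ _)).ne)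
    (ae_of_all _ fun z hz => hz)
  rw [setLIntegral_const, ← haB] at this
  exact absurd h6 (not_le.2 this)

variable (μ M) in
noncomputable def kcQ (φ : (Fin n → Ω) × ℝ → ℝ) (z : (Fin n → Ω) × ℝ) : ℝ≥0∞ :=
  ∑ I : Finset (Fin n) with I.card ≤ M, ‖kccmp μ I φ z‖ₑ ^ 2

lemma kcQ_meas {φ : (Fin n → Ω) × ℝ → ℝ} (hφ : Measurable φ) : Measurable (kcQ μ M φ) :=
  Finset.measurable_fun_sum _ fun I _ => (kccmp_meas μ I hφ).enorm.pow_const 2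

lemma kc_lavQ {φ : (Fin n → Ω) × ℝ → ℝ} (hφ : Measurable φ) (J : Finset (Fin n)) (z) :
    kclav μ J (kcQ μ M φ) z ≤ ∑ K ∈ J.powerset, kcw μ M K φ z := by
  have h1 : kclav μ J (kcQ μ M φ) z
      = ∑ I : Finset (Fin n) with I.card ≤ M, kclav μ J (fun z => ‖kccmp μ I φ z‖ₑ ^ 2) z := by
    unfold kclav kcQ
    exact lintegral_finsetSum _ fun I _ =>
      (((kccmp_meas μ I hφ).enorm.pow_const 2).comp (kcmeas_slice J z))
  rw [h1]
  unfold kcw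
  have h2 : ∀ K, ∑ I : Finset (Fin n) with K ⊆ I ∧ I.card ≤ M,
        kclav μ K (fun z => ‖kccmp μ I φ z‖ₑ ^ 2) z
      = ∑ I : Finset (Fin n) with I.card ≤ M,
        if K ⊆ I then kclav μ K (fun z => ‖kccmp μ I φ z‖ₑ ^ 2) z else 0 := by
    intro K
    rw [← Finset.sum_filter, Finset.filter_filter]
    refine Finset.sum_congr ?_ fun _ _ => rfl
    ext I; simp [and_comm]
  simp only [h2]
  rw [Finset.sum_comm]
  refine Finset.sum_le_sum fun I _ => ?_
  have hd : KcDep I (fun z => ‖kccmp μ I φ z‖ₑ ^ 2) := fun x y s => by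
    simp only [kccmp_dep μ I φ x y s]
  rw [kclav_of_dep μ hd]
  have := Finset.single_le_sum (f := fun K => if K ⊆ I then
    kclav μ K (fun z => ‖kccmp μ I φ z‖ₑ ^ 2) z else 0) (s := J.powerset) (fun _ _ => zero_le)
    (a := J ∩ I) (by simp [Finset.inter_subset_left])
  simpa [Finset.inter_subset_right] using this

variable (μ M) in
noncomputable def kcqq (φ : (Fin n → Ω) × ℝ → ℝ) (x : Fin n → Ω) : ℝ≥0∞ :=
  ∫⁻ s, kcQ μ M φ (x, s)

lemma kcqq_meas {φ : (Fin n → Ω) × ℝ → ℝ} (hφ : Measurable φ) : Measurable (kcqq μ M φ) :=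
  Measurable.lintegral_prod_right' (kcQ_meas hφ)

lemma kc_lavq {φ : (Fin n → Ω) × ℝ → ℝ} (hφ : Measurable φ) (J : Finset (Fin n)) (z) :
    kclav μ J (fun z => kcqq μ M φ z.1) z ≤ ∑ K ∈ J.powerset, kcq μ M K φ z.1 := by
  calc _ = ∫⁻ y, (∫⁻ s, kcQ μ M φ (kcmix J z.1 y, s)) ∂kcP μ n := rfl
    _ = ∫⁻ s, (∫⁻ y, kcQ μ M φ (kcmix J z.1 y, s) ∂kcP μ n) := by
        refine lintegral_lintegral_swap (Measurable.aemeasurable ?_)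
        exact (kcQ_meas hφ).comp (((kcmix_meas J).comp (measurable_const.prodMk measurable_fst)).prodMk
            measurable_snd)
    _ ≤ ∫⁻ s, ∑ K ∈ J.powerset, kcw μ M K φ (z.1, s) :=
        lintegral_mono fun s => kc_lavQ hφ J (z.1, s)
    _ = ∑ K ∈ J.powerset, kcq μ M K φ z.1 := 
        lintegral_finsetSum _ fun K _ => (kcw_meas K hφ).comp measurable_prodMk_left

variable (μ M) in
def kcG (φ : (Fin n → Ω) × ℝ → ℝ) (T : ℝ≥0∞) : Set ((Fin n → Ω) × ℝ) :=
  {z | kcQ μ M φ z ≤ 4 * 8 ^ M ∧ kcqq μ M φ z.1 ≤ 4 * 8 ^ M * T ^ 2}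

lemma kcG_meas {φ : (Fin n → Ω) × ℝ → ℝ} (hφ : Measurable φ) (T : ℝ≥0∞) :
    MeasurableSet (kcG μ M φ T) :=
  (measurableSet_le (kcQ_meas hφ) measurable_const).inter
    (measurableSet_le ((kcqq_meas hφ).comp measurable_fst) measurable_const)

lemma kc_pow_bound {J : Finset (Fin n)} (hJ : J.card ≤ M) (a : Finset (Fin n) → ℝ≥0∞) (b : ℝ≥0∞)
    (h : ∀ K : Finset (Fin n), K.card ≤ M → a K ≤ 4 ^ M * b) : ∑ K ∈ J.powerset, a K ≤ 8 ^ M * b := by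
  calc ∑ K ∈ J.powerset, a K ≤ ∑ K ∈ J.powerset, 4 ^ M * b := by
        refine Finset.sum_le_sum fun K hK => h K ?_
        exact (Finset.card_le_card (Finset.mem_powerset.1 hK)).trans hJ
    _ = 2 ^ J.card * (4 ^ M * b) := by simp
    _ ≤ 2 ^ M * (4 ^ M * b) := by gcongr; norm_num
    _ = _ := by rw [← mul_assoc, ← mul_pow]; norm_num

lemma kc_half {φ : (Fin n → Ω) × ℝ → ℝ} (hφ : KcL2 μ φ) {T : ℝ≥0∞} (hTT : T < ⊤) (hT0 : T ≠ 0)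
    (h0 : ∀ K : Finset (Fin n), K.card ≤ M → ∀ᵐ z ∂kcZ μ n, kcw μ M K φ z ≤ 4 ^ M)
    (h1 : ∀ K : Finset (Fin n), K.card ≤ M → ∀ᵐ x ∂kcP μ n, kcq μ M K φ x ≤ 4 ^ M * T ^ 2)
    {J : Finset (Fin n)} (hJ : J.card ≤ M) :
    ∀ᵐ z ∂kcZ μ n, 1 ≤ 2 * kclav μ J ((kcG μ M φ T).indicator fun _ => 1) z := by
  have h0' : ∀ᵐ z ∂kcZ μ n, ∀ K : Finset (Fin n), K.card ≤ M → kcw μ M K φ z ≤ 4 ^ M := by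
    rw [ae_all_iff]; intro K
    by_cases h : K.card ≤ M
    · filter_upwards [h0 K h] with z hz _ using hz
    · exact ae_of_all _ fun z h' => absurd h' h
  have h1' : ∀ᵐ z ∂kcZ μ n, ∀ K : Finset (Fin n), K.card ≤ M → kcq μ M K φ z.1 ≤ 4 ^ M * T ^ 2 := by
    refine (Measure.quasiMeasurePreserving_fst (μ := kcP μ n) (ν := (volume : Measure ℝ))).ae
      (p := fun x => ∀ K : Finset (Fin n), K.card ≤ M → kcq μ M K φ x ≤ 4 ^ M * T ^ 2) ?_
    rw [ae_all_iff]; intro K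
    by_cases h : K.card ≤ M
    · filter_upwards [h1 K h] with z hz _ using hz
    · exact ae_of_all _ fun z h' => absurd h' h
  filter_upwards [h0', h1'] with z hz0 hz1
  set e : ℝ≥0∞ := 8 ^ M * T ^ 2 with he
  have he0 : e ≠ 0 := by positivity
  have het : e ≠ ⊤ := by rw [he]; finiteness
  have hGm := kcG_meas (μ := μ) (M := M) hφ.1 T
  have hp : ∀ z, 4 * e ≤ 4 * e * (kcG μ M φ T).indicator (fun _ => 1) z
      + (T ^ 2 * kcQ μ M φ z + kcqq μ M φ z.1) := by
    intro z
    by_cases h : z ∈ kcG μ M φ T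
    · simp [h]
    · simp only [kcG, Set.mem_ofPred_eq, not_and_or, not_le] at h
      rcases h with h | h
      · calc 4 * e = T ^ 2 * (4 * 8 ^ M) := by rw [he]; ring
          _ ≤ T ^ 2 * kcQ μ M φ z := by gcongr
          _ ≤ _ := le_add_left (le_add_right le_rfl)
      · calc 4 * e = 4 * 8 ^ M * T ^ 2 := by rw [he]; ring
          _ ≤ kcqq μ M φ z.1 := h.le
          _ ≤ _ := le_add_left (le_add_left le_rfl)
  have hX : 4 * e ≤ 4 * e * kclav μ J ((kcG μ M φ T).indicator fun _ => 1) z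
      + (T ^ 2 * kclav μ J (kcQ μ M φ) z + kclav μ J (fun z => kcqq μ M φ z.1) z) := by
    have hsl := kcmeas_slice (Ω := Ω) J z
    have m1 : Measurable (fun y => (kcG μ M φ T).indicator (fun _ => (1:ℝ≥0∞)) (kcmix J z.1 y, z.2)) :=
      (measurable_const.indicator hGm).comp hsl
    have m2 : Measurable (fun y => kcQ μ M φ (kcmix J z.1 y, z.2)) := (kcQ_meas hφ.1).comp hsl
    calc 4 * e = ∫⁻ y, 4 * e ∂kcP μ n := by simp
      _ ≤ ∫⁻ y, (4 * e * (kcG μ M φ T).indicator (fun _ => 1) (kcmix J z.1 y, z.2)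
          + (T ^ 2 * kcQ μ M φ (kcmix J z.1 y, z.2) + kcqq μ M φ (kcmix J z.1 y))) ∂kcP μ n :=
          lintegral_mono fun y => hp _
      _ = _ := by
          rw [lintegral_add_left (m1.const_mul _), lintegral_add_left (m2.const_mul _),
            lintegral_const_mul _ m1, lintegral_const_mul _ m2]
          rfl
  have b0 : kclav μ J (kcQ μ M φ) z ≤ 8 ^ M := by
    refine (kc_lavQ hφ.1 J z).trans ?_
    have := kc_pow_bound hJ (fun K => kcw μ M K φ z) 1 (fun K hK => by simpa using hz0 K hK)
    simpa using this
  have b1 : kclav μ J (fun z => kcqq μ M φ z.1) z ≤ e :=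
    (kc_lavq hφ.1 J z).trans (kc_pow_bound hJ _ _ hz1)
  have hX2 : 2 * e + 2 * e ≤ 2 * e * (2 * kclav μ J ((kcG μ M φ T).indicator fun _ => 1) z) + 2 * e := by
    calc 2 * e + 2 * e = 4 * e := by ring
      _ ≤ _ := hX
      _ ≤ 4 * e * kclav μ J ((kcG μ M φ T).indicator fun _ => 1) z + (T ^ 2 * 8 ^ M + e) := by gcongr
      _ = _ := by rw [he]; ring
  have hX3 := (ENNReal.add_le_add_iff_right (by finiteness)).1 hX2
  have h2e : 2 * e ≠ 0 := by positivity
  rw [← ENNReal.mul_le_mul_iff_right h2e (by finiteness), mul_one]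
  exact hX3

end estimate

section mainest
set_option linter.unusedSectionVars false

open Filter Topology

variable {n : ℕ} {μ : Measure Ω} [IsProbabilityMeasure μ] {M : ℕ}

lemma kc_fcs {ι : Type*} (s : Finset ι) (f g : ι → ℝ≥0∞) :
    ∑ i ∈ s, f i * g i ≤ (∑ i ∈ s, f i ^ 2) ^ ((1:ℝ)/2) * (∑ i ∈ s, g i ^ 2) ^ ((1:ℝ)/2) := by
  have := ENNReal.inner_le_Lp_mul_Lq s f g (p := 2) (q := 2) Real.HolderConjugate.two_two
  simpa only [ENNReal.rpow_two] using this

lemma kc_sqrt_enorm {ι : Type*} (s : Finset ι) (a : ι → ℝ) :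
    (∑ i ∈ s, ‖a i‖ₑ ^ 2) ^ ((1:ℝ)/2) = ENNReal.ofReal √(∑ i ∈ s, a i ^ 2) := by
  have : ∑ i ∈ s, ‖a i‖ₑ ^ 2 = ENNReal.ofReal (∑ i ∈ s, a i ^ 2) := by
    rw [ENNReal.ofReal_sum_of_nonneg fun i _ => sq_nonneg _]
    refine Finset.sum_congr rfl fun i _ => ?_
    rw [kc_enorm_sq, sq]
  rw [this, ENNReal.ofReal_rpow_of_nonneg (Finset.sum_nonneg fun i _ => sq_nonneg _) (by norm_num),
    Real.sqrt_eq_rpow]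

/-- pointwise square function bound -/
lemma kc_ptw {w : Finset (Fin n) → ℝ} (hw0 : ∀ J, 0 ≤ w J)
    (hw : ∀ α : Finset (Fin n) → ℝ, (∀ I : Finset (Fin n), M < I.card → kcM α I = 0) →
      √(∑ I, kcM α I ^ 2) ≤ ∑ J, w J * |α J|)
    {F F0 F1 : (Fin n → Ω) × ℝ → ℝ} (hV : KcInV μ M F) (hF0 : Measurable F0) 
    (hdec : ∀ᵐ z ∂kcZ μ n, F z = F0 z + F1 z) :
    ∀ᵐ z ∂kcZ μ n, (∑ I : Finset (Fin n) with I.card ≤ M, ‖kccmp μ I F z‖ₑ ^ 2) ^ ((1:ℝ)/2)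
      ≤ (∑ J, ENNReal.ofReal (w J) * kclav μ J (fun z => ‖F0 z‖ₑ) z)
        + ∑ J, ENNReal.ofReal (w J) * kclav μ J (fun z => ‖F1 z‖ₑ) z := by
  have hV' : ∀ᵐ z ∂kcZ μ n, ∀ I : Finset (Fin n), M < I.card → kccmp μ I F z = 0 := by
    rw [ae_all_iff]; intro I
    by_cases h : M < I.card
    · filter_upwards [hV I h] with z hz _ using hz
    · exact ae_of_all _ fun z h' => absurd h' h
  have hmix : ∀ᵐ z ∂kcZ μ n, ∀ J : Finset (Fin n), ∀ᵐ y ∂kcP μ n,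
      F (kcmix J z.1 y, z.2) = F0 (kcmix J z.1 y, z.2) + F1 (kcmix J z.1 y, z.2) := by
    rw [ae_all_iff]; intro J
    exact kc_ae_mix μ J hdec
  filter_upwards [hV', hmix] with z hz hm
  calc (∑ I : Finset (Fin n) with I.card ≤ M, ‖kccmp μ I F z‖ₑ ^ 2) ^ ((1:ℝ)/2)
      ≤ (∑ I : Finset (Fin n), ‖kccmp μ I F z‖ₑ ^ 2) ^ ((1:ℝ)/2) := by
        gcongr
        exact Finset.subset_univ _
    _ = ENNReal.ofReal √(∑ I, kccmp μ I F z ^ 2) := kc_sqrt_enorm _ _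
    _ ≤ ENNReal.ofReal (∑ J, w J * |kcav μ J F z|) :=
        ENNReal.ofReal_le_ofReal (hw (fun J => kcav μ J F z) hz)
    _ = ∑ J, ENNReal.ofReal (w J) * ‖kcav μ J F z‖ₑ := by
        rw [ENNReal.ofReal_sum_of_nonneg fun J _ => mul_nonneg (hw0 J) (abs_nonneg _)]
        refine Finset.sum_congr rfl fun J _ => ?_
        rw [ENNReal.ofReal_mul (hw0 J), ← Real.norm_eq_abs, ofReal_norm]
    _ ≤ ∑ J, ENNReal.ofReal (w J) * (kclav μ J (fun z => ‖F0 z‖ₑ) z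
          + kclav μ J (fun z => ‖F1 z‖ₑ) z) := by
        refine Finset.sum_le_sum fun J _ => ?_
        gcongr
        refine (kcav_enorm J F z).trans ?_
        have hm0 : Measurable (fun y => ‖F0 (kcmix J z.1 y, z.2)‖ₑ) :=
          hF0.enorm.comp (kcmeas_slice J z)
        unfold kclav
        rw [← lintegral_add_left hm0]
        refine lintegral_mono_ae ?_
        filter_upwards [hm J] with y hy
        rw [hy]
        exact enorm_add_le _ _
    _ = _ := by
        simp only [mul_add, Finset.sum_add_distrib]

lemma kc_S_norm {N : ((Fin n → Ω) × ℝ → ℝ≥0∞) → ℝ≥0∞} (hN : KcLat μ N)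
    {w : Finset (Fin n) → ℝ} (hw0 : ∀ J, 0 ≤ w J) {C : ℝ} (hC : ∑ J, w J ≤ C)
    {f : (Fin n → Ω) × ℝ → ℝ≥0∞} (hf : Measurable f) :
    N (fun z => ∑ J, ENNReal.ofReal (w J) * kclav μ J f z) ≤ ENNReal.ofReal C * N f := by
  calc _ ≤ ∑ J, N (fun z => ENNReal.ofReal (w J) * kclav μ J f z) :=
        hN.sum _ _ fun J _ => (kclav_meas μ J hf).const_mul _
    _ ≤ ∑ J, ENNReal.ofReal (w J) * N f := by
        refine Finset.sum_le_sum fun J _ => ?_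
        rw [hN.smul _ _ (kclav_meas μ J hf)]
        gcongr
        exact hN.lav J f hf
    _ = ENNReal.ofReal (∑ J, w J) * N f := by
        rw [ENNReal.ofReal_sum_of_nonneg fun J _ => hw0 J, Finset.sum_mul]
    _ ≤ _ := by gcongr

variable (M) in
noncomputable def kcL : ℝ≥0∞ := (4 * 8 ^ M) ^ ((1:ℝ)/2)

lemma kc_step1 {φ : (Fin n → Ω) × ℝ → ℝ} (hφ : KcL2 μ φ) {T : ℝ≥0∞}
    (hh : ∀ J : Finset (Fin n), J.card ≤ M →
      ∀ᵐ z ∂kcZ μ n, 1 ≤ 2 * kclav μ J ((kcG μ M φ T).indicator fun _ => 1) z)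
    {F : (Fin n → Ω) × ℝ → ℝ} (hF : KcL2 μ F) (hV : KcInV μ M F) :
    ENNReal.ofReal (∫ z, F z * φ z ∂kcZ μ n) ≤
      2 * ∫⁻ z, (∑ I : Finset (Fin n) with I.card ≤ M, ‖kccmp μ I F z‖ₑ ^ 2) ^ ((1:ℝ)/2)
        * ((kcG μ M φ T).indicator (fun _ => 1) z * kcQ μ M φ z ^ ((1:ℝ)/2)) ∂kcZ μ n := by
  have hGm : Measurable ((kcG μ M φ T).indicator (fun _ => (1:ℝ≥0∞))) :=
    measurable_const.indicator (kcG_meas hφ.1 T)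
  have hm : ∀ I, Measurable (fun z => ‖kccmp μ I F z‖ₑ * ‖kccmp μ I φ z‖ₑ) := fun I =>
    (kccmp_meas μ I hF.1).enorm.mul (kccmp_meas μ I hφ.1).enorm
  calc ENNReal.ofReal (∫ z, F z * φ z ∂kcZ μ n)
      ≤ ‖∫ z, F z * φ z ∂kcZ μ n‖ₑ := Real.ofReal_le_enorm _
    _ = ‖∑ I : Finset (Fin n) with I.card ≤ M, ∫ z, kccmp μ I F z * kccmp μ I φ z ∂kcZ μ n‖ₑ := by
        rw [kc_inner hF hφ hV]
    _ ≤ ∑ I : Finset (Fin n) with I.card ≤ M, ‖∫ z, kccmp μ I F z * kccmp μ I φ z ∂kcZ μ n‖ₑ :=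
        enorm_sum_le _ _
    _ ≤ ∑ I : Finset (Fin n) with I.card ≤ M, 2 * ∫⁻ z, (‖kccmp μ I F z‖ₑ * ‖kccmp μ I φ z‖ₑ)
          * (kcG μ M φ T).indicator (fun _ => 1) z ∂kcZ μ n := by
        refine Finset.sum_le_sum fun I hI => ?_
        have hI' : I.card ≤ M := by simpa using hI
        have hd : KcDep I (fun z => ‖kccmp μ I F z‖ₑ * ‖kccmp μ I φ z‖ₑ) := fun x y s => by
          simp only [kccmp_dep μ I F x y s, kccmp_dep μ I φ x y s]
        calc _ ≤ ∫⁻ z, ‖kccmp μ I F z * kccmp μ I φ z‖ₑ ∂kcZ μ n :=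
              enorm_integral_le_lintegral_enorm _
          _ ≤ ∫⁻ z, 2 * ((‖kccmp μ I F z‖ₑ * ‖kccmp μ I φ z‖ₑ)
                * kclav μ I ((kcG μ M φ T).indicator fun _ => 1) z) ∂kcZ μ n := by
              refine lintegral_mono_ae ?_
              filter_upwards [hh I hI'] with z hz
              rw [enorm_mul]
              calc _ = (‖kccmp μ I F z‖ₑ * ‖kccmp μ I φ z‖ₑ) * 1 := (mul_one _).symm
                _ ≤ (‖kccmp μ I F z‖ₑ * ‖kccmp μ I φ z‖ₑ)
                    * (2 * kclav μ I ((kcG μ M φ T).indicator fun _ => 1) z) := by gcongr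
                _ = _ := by ring
          _ = 2 * ∫⁻ z, kclav μ I (fun z => ‖kccmp μ I F z‖ₑ * ‖kccmp μ I φ z‖ₑ) z
                * (kcG μ M φ T).indicator (fun _ => 1) z ∂kcZ μ n := by
              have hmm : Measurable (fun z => (‖kccmp μ I F z‖ₑ * ‖kccmp μ I φ z‖ₑ)
                * kclav μ I ((kcG μ M φ T).indicator fun _ => 1) z) :=
                (hm I).mul (kclav_meas μ I hGm)
              rw [lintegral_const_mul _ hmm, kclav_selfadj μ I (hm I) hGm]
          _ = _ := by simp only [kclav_self μ hd]
    _ = 2 * ∫⁻ z, (∑ I : Finset (Fin n) with I.card ≤ M, ‖kccmp μ I F z‖ₑ * ‖kccmp μ I φ z‖ₑ)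
          * (kcG μ M φ T).indicator (fun _ => 1) z ∂kcZ μ n := by
        rw [← Finset.mul_sum]
        simp only [Finset.sum_mul]
        congr 1
        exact (lintegral_finsetSum _ fun I _ => (hm I).mul hGm).symm
    _ ≤ _ := by
        gcongr 2 * ?_
        refine lintegral_mono fun z => ?_
        dsimp only
        rw [mul_comm ((kcG μ M φ T).indicator _ z), ← mul_assoc]
        gcongr
        exact kc_fcs _ _ _

lemma kc_main {w : Finset (Fin n) → ℝ} (hw0 : ∀ J, 0 ≤ w J) {C : ℝ} (hC : ∑ J, w J ≤ C)
    (hw : ∀ α : Finset (Fin n) → ℝ, (∀ I : Finset (Fin n), M < I.card → kcM α I = 0) →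
      √(∑ I, kcM α I ^ 2) ≤ ∑ J, w J * |α J|)
    {φ : (Fin n → Ω) × ℝ → ℝ} (hφ : KcL2 μ φ) {T : ℝ≥0∞} (hTT : T < ⊤) (hT0 : T ≠ 0)
    (h0 : ∀ G, KcL2 μ G → KcInV μ M G → kcn0 μ (fun z => ‖G z‖ₑ) < ⊤ →
      ENNReal.ofReal (∫ z, G z * φ z ∂kcZ μ n) ≤ 1 * kcn0 μ (fun z => ‖G z‖ₑ))
    (h1 : ∀ G, KcL2 μ G → KcInV μ M G → kcn1 μ (fun z => ‖G z‖ₑ) < ⊤ →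
      ENNReal.ofReal (∫ z, G z * φ z ∂kcZ μ n) ≤ T * kcn1 μ (fun z => ‖G z‖ₑ))
    {F F0 F1 : (Fin n → Ω) × ℝ → ℝ} (hF : KcL2 μ F) (hV : KcInV μ M F) 
    (hF0 : Measurable F0) (hF1 : Measurable F1)
    (hdec : ∀ᵐ z ∂kcZ μ n, F z = F0 z + F1 z) :
    ENNReal.ofReal (∫ z, F z * φ z ∂kcZ μ n) ≤
      2 * kcL M * ENNReal.ofReal C * (kcn0 μ (fun z => ‖F0 z‖ₑ) + T * kcn1 μ (fun z => ‖F1 z‖ₑ)) := by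
  have hh : ∀ J : Finset (Fin n), J.card ≤ M →
      ∀ᵐ z ∂kcZ μ n, 1 ≤ 2 * kclav μ J ((kcG μ M φ T).indicator fun _ => 1) z := fun J hJ =>
    kc_half hφ hTT hT0 (fun K hK => kc_w_bound hφ h0 hK) (fun K hK => kc_q_bound hφ hTT h1 hK) hJ
  set R : (Fin n → Ω) × ℝ → ℝ≥0∞ := fun z =>
    (kcG μ M φ T).indicator (fun _ => 1) z * kcQ μ M φ z ^ ((1:ℝ)/2) with hR
  have hGm : Measurable ((kcG μ M φ T).indicator (fun _ => (1:ℝ≥0∞))) :=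
    measurable_const.indicator (kcG_meas hφ.1 T)
  have hRm : Measurable R := hGm.mul ((kcQ_meas hφ.1).pow_const _)
  have hR0 : ∀ z, R z ≤ kcL M := by
    intro z
    by_cases h : z ∈ kcG μ M φ T
    · simp only [hR, Set.indicator_of_mem h, one_mul]
      exact ENNReal.rpow_le_rpow h.1 (by norm_num)
    · simp [hR, h]
  have hR1 : ∀ x, (∫⁻ s, R (x, s) ^ 2) ^ ((1:ℝ)/2) ≤ kcL M * T := by
    intro x
    have e : kcL M * T = (4 * 8 ^ M * T ^ 2) ^ ((1:ℝ)/2) := by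
      rw [ENNReal.mul_rpow_of_nonneg _ _ (by norm_num), kc_sq_half, kcL]
    rw [e]
    refine ENNReal.rpow_le_rpow ?_ (by norm_num)
    by_cases hx : kcqq μ M φ x ≤ 4 * 8 ^ M * T ^ 2
    · refine le_trans (lintegral_mono fun s => ?_) hx
      by_cases h : (x, s) ∈ kcG μ M φ T
      · simp only [hR, Set.indicator_of_mem h, one_mul, kc_half_sq]; exact le_rfl
      · simp [hR, h]
    · have : ∀ s, R (x, s) = 0 := by
        intro s
        have h : (x, s) ∉ kcG μ M φ T := fun h => hx h.2
        simp [hR, h]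
      simp [this]
  set S0 : (Fin n → Ω) × ℝ → ℝ≥0∞ := fun z =>
    ∑ J, ENNReal.ofReal (w J) * kclav μ J (fun z => ‖F0 z‖ₑ) z with hS0
  set S1 : (Fin n → Ω) × ℝ → ℝ≥0∞ := fun z =>
    ∑ J, ENNReal.ofReal (w J) * kclav μ J (fun z => ‖F1 z‖ₑ) z with hS1
  have hS0m : Measurable S0 := Finset.measurable_fun_sum _ fun J _ =>
    (kclav_meas μ J hF0.enorm).const_mul _
  have hS1m : Measurable S1 := Finset.measurable_fun_sum _ fun J _ =>
    (kclav_meas μ J hF1.enorm).const_mul _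
  have hm0 : Measurable (fun z => S0 z * R z) := hS0m.mul hRm
  have hm1 : Measurable (fun z => S1 z * R z) := hS1m.mul hRm
  have b0 : ∫⁻ z, S0 z * R z ∂kcZ μ n ≤ kcn0 μ S0 * kcL M := by
    unfold kcn0
    rw [← lintegral_mul_const _ hS0m]
    exact lintegral_mono fun z => by gcongr; exact hR0 z
  have b1 : ∫⁻ z, S1 z * R z ∂kcZ μ n ≤ kcn1 μ S1 * (kcL M * T) := by
    unfold kcn1
    rw [← lintegral_mul_const _ (kcn1_inner_meas hS1m),
      lintegral_prod _ hm1.aemeasurable]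
    refine lintegral_mono fun x => ?_
    refine (kc_cs volume (fun s => S1 (x, s)) (fun s => R (x, s))
      (hS1m.comp measurable_prodMk_left) (hRm.comp measurable_prodMk_left)).trans ?_
    gcongr
    exact hR1 x
  calc _ ≤ 2 * ∫⁻ z, (∑ I : Finset (Fin n) with I.card ≤ M, ‖kccmp μ I F z‖ₑ ^ 2) ^ ((1:ℝ)/2)
        * R z ∂kcZ μ n := kc_step1 hφ hh hF hV
    _ ≤ 2 * ∫⁻ z, (S0 z * R z + S1 z * R z) ∂kcZ μ n := by
        gcongr 2 * ?_
        refine lintegral_mono_ae ?_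
        filter_upwards [kc_ptw hw0 hw hV hF0 hdec] with z hz
        rw [← add_mul]
        gcongr
    _ ≤ 2 * (kcn0 μ S0 * kcL M + kcn1 μ S1 * (kcL M * T)) := by
        rw [lintegral_add_left hm0]
        gcongr
    _ ≤ 2 * ((ENNReal.ofReal C * kcn0 μ (fun z => ‖F0 z‖ₑ)) * kcL M
          + (ENNReal.ofReal C * kcn1 μ (fun z => ‖F1 z‖ₑ)) * (kcL M * T)) := by
        gcongr
        · exact kc_S_norm (kclat0 μ) hw0 hC hF0.enorm
        · exact kc_S_norm (kclat1 μ) hw0 hC hF1.enorm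
    _ = _ := by ring

end mainest

section duality
set_option linter.unusedSectionVars false

open Filter Topology

lemma kc_dual {E : Type*} [NormedAddCommGroup E] [InnerProductSpace ℝ E] [CompleteSpace E]
    (V : Submodule ℝ E) (p0 p1 : E → ℝ≥0∞)
    (a0 : ∀ f g, p0 (f + g) ≤ p0 f + p0 g) (s0 : ∀ (c : ℝ) f, p0 (c • f) = ‖c‖ₑ * p0 f)
    (a1 : ∀ f g, p1 (f + g) ≤ p1 f + p1 g) (s1 : ∀ (c : ℝ) f, p1 (c • f) = ‖c‖ₑ * p1 f)
    (hp : ∀ f, p1 f ≤ ‖f‖ₑ) {T : ℝ≥0∞} (hT : T < ⊤) {F : E} (hF : F ∈ V)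
    (hno : ¬ ∃ g0 ∈ V, ∃ g1 ∈ V, F = g0 + g1 ∧ p0 g0 + T * p1 g1 < 1) :
    ∃ φ : E, inner ℝ φ F = 1 ∧ (∀ g ∈ V, p0 g < ⊤ → ENNReal.ofReal (inner ℝ φ g) ≤ p0 g) ∧
      (∀ g ∈ V, p1 g < ⊤ → ENNReal.ofReal (inner ℝ φ g) ≤ T * p1 g) := by
  have z0 : p0 0 = 0 := by simpa using s0 0 0
  have z1 : p1 0 = 0 := by simpa using s1 0 0
  set U : Set E := {f | ∃ g : E × E, (g.1 ∈ V ∧ g.2 ∈ V) ∧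
    p0 g.1 + T * p1 g.2 + T * ‖f - (g.1 + g.2)‖ₑ < 1} with hU
  have hopen : IsOpen U := by
    have : U = ⋃ g : E × E, ⋃ _ : g.1 ∈ V ∧ g.2 ∈ V,
        {f | p0 g.1 + T * p1 g.2 + T * ‖f - (g.1 + g.2)‖ₑ < 1} := by
      ext f; simp [hU]
    rw [this]
    refine isOpen_iUnion fun g => isOpen_iUnion fun _ => ?_
    refine isOpen_lt ?_ continuous_const
    refine continuous_const.add ?_
    exact (ENNReal.continuous_const_mul hT.ne).comp ((continuous_id.sub continuous_const).enorm)
  have hconv : Convex ℝ U := by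
    rintro f ⟨g, hg, hfg⟩ f' ⟨g', hg', hfg'⟩ a b ha hb hab
    refine ⟨a • g + b • g', ⟨V.add_mem (V.smul_mem _ hg.1) (V.smul_mem _ hg'.1),
      V.add_mem (V.smul_mem _ hg.2) (V.smul_mem _ hg'.2)⟩, ?_⟩
    have e : a • f + b • f' - ((a • g + b • g').1 + (a • g + b • g').2)
        = a • (f - (g.1 + g.2)) + b • (f' - (g'.1 + g'.2)) := by
      simp only [Prod.fst_add, Prod.snd_add, Prod.smul_fst, Prod.smul_snd]
      module
    rw [e]
    have hab' : ‖a‖ₑ + ‖b‖ₑ = 1 := by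
      rw [Real.enorm_of_nonneg ha, Real.enorm_of_nonneg hb, ← ENNReal.ofReal_add ha hb, hab]
      simp
    have q0 : p0 (a • g + b • g').1 ≤ ‖a‖ₑ * p0 g.1 + ‖b‖ₑ * p0 g'.1 := by
      rw [← s0, ← s0]; exact a0 _ _
    have q1 : p1 (a • g + b • g').2 ≤ ‖a‖ₑ * p1 g.2 + ‖b‖ₑ * p1 g'.2 := by
      rw [← s1, ← s1]; exact a1 _ _
    have q2 : ‖a • (f - (g.1 + g.2)) + b • (f' - (g'.1 + g'.2))‖ₑ
        ≤ ‖a‖ₑ * ‖f - (g.1 + g.2)‖ₑ + ‖b‖ₑ * ‖f' - (g'.1 + g'.2)‖ₑ := by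
      rw [← enorm_smul, ← enorm_smul]; exact enorm_add_le _ _
    set X := p0 g.1 + T * p1 g.2 + T * ‖f - (g.1 + g.2)‖ₑ
    set Y := p0 g'.1 + T * p1 g'.2 + T * ‖f' - (g'.1 + g'.2)‖ₑ
    calc _ ≤ (‖a‖ₑ * p0 g.1 + ‖b‖ₑ * p0 g'.1) + T * (‖a‖ₑ * p1 g.2 + ‖b‖ₑ * p1 g'.2)
          + T * (‖a‖ₑ * ‖f - (g.1 + g.2)‖ₑ + ‖b‖ₑ * ‖f' - (g'.1 + g'.2)‖ₑ) := by gcongr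
      _ = ‖a‖ₑ * X + ‖b‖ₑ * Y := by ring
      _ ≤ ‖a‖ₑ * max X Y + ‖b‖ₑ * max X Y := by
          gcongr
          · exact le_max_left _ _
          · exact le_max_right _ _
      _ = max X Y := by rw [← add_mul, hab', one_mul]
      _ < 1 := max_lt hfg hfg'
  have hFU : F ∉ U := by
    rintro ⟨g, hg, hlt⟩
    refine hno ⟨g.1, hg.1, F - g.1, V.sub_mem hF hg.1, by abel, lt_of_le_of_lt ?_ hlt⟩
    have : p1 (F - g.1) ≤ p1 g.2 + ‖F - (g.1 + g.2)‖ₑ := by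
      have e : F - g.1 = g.2 + (F - (g.1 + g.2)) := by abel
      rw [e]
      refine (a1 _ _).trans ?_
      gcongr
      exact hp _
    calc _ ≤ p0 g.1 + T * (p1 g.2 + ‖F - (g.1 + g.2)‖ₑ) := by gcongr
      _ = _ := by ring
  obtain ⟨ℓ, hℓ⟩ := geometric_hahn_banach_open_point hconv hopen hFU
  have hpos : 0 < ℓ F := by
    have : (0:E) ∈ U := ⟨0, ⟨V.zero_mem, V.zero_mem⟩, by simp [z0, z1]⟩
    simpa using hℓ 0 this
  have hφ : ∀ g, inner ℝ ((ℓ F)⁻¹ • (InnerProductSpace.toDual ℝ E).symm ℓ) g = (ℓ F)⁻¹ * ℓ g := by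
    intro g
    rw [real_inner_smul_left, InnerProductSpace.toDual_symm_apply]
  have key : ∀ g : E, ∀ P : ℝ≥0∞, (∀ c : ℝ, 0 < c → ‖c‖ₑ * P < 1 → c • g ∈ U) →
      ENNReal.ofReal ((ℓ F)⁻¹ * ℓ g) ≤ P := by
    intro g P h
    by_contra hcon
    rw [not_le] at hcon
    set r := (ℓ F)⁻¹ * ℓ g with hr
    have hr0 : 0 < r := ENNReal.ofReal_pos.1 (lt_of_le_of_lt zero_le hcon)
    have h1 : ‖r⁻¹‖ₑ * P < 1 := by
      rw [Real.enorm_of_nonneg (inv_nonneg.2 hr0.le)]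
      calc ENNReal.ofReal r⁻¹ * P < ENNReal.ofReal r⁻¹ * ENNReal.ofReal r := by
            rw [ENNReal.mul_lt_mul_iff_right]
            · exact hcon
            · simpa using hr0
            · exact ENNReal.ofReal_ne_top
        _ = 1 := by
            rw [← ENNReal.ofReal_mul (inv_nonneg.2 hr0.le), inv_mul_cancel₀ hr0.ne']; simp
    have h2 := hℓ _ (h _ (inv_pos.2 hr0) h1)
    rw [map_smul, smul_eq_mul] at h2
    have h3 : ℓ g = r * ℓ F := by rw [hr]; field_simp
    rw [h3, ← mul_assoc, inv_mul_cancel₀ hr0.ne', one_mul] at h2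
    exact lt_irrefl _ h2
  refine ⟨(ℓ F)⁻¹ • (InnerProductSpace.toDual ℝ E).symm ℓ, ?_, ?_, ?_⟩
  · rw [hφ, inv_mul_cancel₀ hpos.ne']
  · intro g hg _
    rw [hφ]
    refine key g _ fun c hc h => ⟨(c • g, 0), ⟨V.smul_mem _ hg, V.zero_mem⟩, ?_⟩
    simpa [z1, s0] using h
  · intro g hg _
    rw [hφ]
    refine key g _ fun c hc h => ⟨(0, c • g), ⟨V.zero_mem, V.smul_mem _ hg⟩, ?_⟩
    have e : T * (‖c‖ₑ * p1 g) = ‖c‖ₑ * (T * p1 g) := by ring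
    simpa [z0, s1, e] using h

end duality

section core
set_option linter.unusedSectionVars false

open Filter Topology

variable {n : ℕ} {μ : Measure Ω} [IsProbabilityMeasure μ] {M : ℕ}

lemma KcInV.add' {f g : (Fin n → Ω) × ℝ → ℝ} (hf : KcInV μ M f) (hg : KcInV μ M g)
    (gf : ∀ᵐ z ∂kcZ μ n, KcGood μ f z) (gg : ∀ᵐ z ∂kcZ μ n, KcGood μ g z) :
    KcInV μ M (fun z => f z + g z) := by
  intro I hI
  filter_upwards [hf I hI, hg I hI, gf, gg] with z h1 h2 h3 h4
  rw [h3.cmp_add h4, h1, h2, add_zero]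

lemma KcInV.smul' {f : (Fin n → Ω) × ℝ → ℝ} (hf : KcInV μ M f) (c : ℝ) :
    KcInV μ M (fun z => c * f z) := by
  intro I hI
  filter_upwards [hf I hI] with z h1
  rw [kccmp_smul, h1, mul_zero]

lemma KcInV.congr' {f g : (Fin n → Ω) × ℝ → ℝ} (hf : KcInV μ M f)
    (h : ∀ᵐ z ∂kcZ μ n, f z = g z) : KcInV μ M g := by
  intro I hI
  have hmix : ∀ᵐ z ∂kcZ μ n, ∀ J : Finset (Fin n), ∀ᵐ y ∂kcP μ n,
      f (kcmix J z.1 y, z.2) = g (kcmix J z.1 y, z.2) := by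
    rw [ae_all_iff]; intro J
    exact kc_ae_mix μ J h
  filter_upwards [hf I hI, hmix] with z h1 h2
  rw [← h1]
  unfold kccmp
  congr 1
  funext J
  exact (integral_congr_ae (h2 J)).symm

lemma kcLp_l2 (g : Lp ℝ 2 (kcZ μ n)) : KcL2 μ (g : (Fin n → Ω) × ℝ → ℝ) :=
  ⟨(Lp.stronglyMeasurable g).measurable, Lp.memLp g⟩

variable (μ n M) in
def kcV : Submodule ℝ (Lp ℝ 2 (kcZ μ n)) where
  carrier := {g | KcInV μ M (g : (Fin n → Ω) × ℝ → ℝ)}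
  add_mem' := by
    intro f g hf hg
    refine (KcInV.add' hf hg (kcLp_l2 f).good (kcLp_l2 g).good).congr' ?_
    filter_upwards [Lp.coeFn_add f g] with z hz
    rw [hz]; rfl
  zero_mem' := by
    have h : KcInV μ M (fun _ : (Fin n → Ω) × ℝ => (0:ℝ)) := by
      intro I hI
      refine ae_of_all _ fun z => ?_
      have := kccmp_smul (μ := μ) 0 (fun _ : (Fin n → Ω) × ℝ => (0:ℝ)) z I
      simpa using this
    refine h.congr' ?_
    filter_upwards [Lp.coeFn_zero ℝ 2 (kcZ μ n)] with z hz
    rw [hz]; rfl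
  smul_mem' := by
    intro c f hf
    refine (KcInV.smul' hf c).congr' ?_
    filter_upwards [Lp.coeFn_smul c f] with z hz
    rw [hz]; rfl

lemma kc_inV_zero : KcInV μ M (fun _ : (Fin n → Ω) × ℝ => (0:ℝ)) := by
  intro I hI
  refine ae_of_all _ fun z => ?_
  have := kccmp_smul (μ := μ) 0 (fun _ : (Fin n → Ω) × ℝ => (0:ℝ)) z I
  simpa using this

variable {N : ((Fin n → Ω) × ℝ → ℝ≥0∞) → ℝ≥0∞}

lemma KcLat.lp_add (hN : KcLat μ N) (f g : Lp ℝ 2 (kcZ μ n)) :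
    N (fun z => ‖(f + g) z‖ₑ) ≤ N (fun z => ‖f z‖ₑ) + N (fun z => ‖g z‖ₑ) := by
  refine le_trans (le_of_eq ?_) (hN.eadd (kcLp_l2 f).1 (kcLp_l2 g).1)
  refine hN.congr ?_
  filter_upwards [Lp.coeFn_add f g] with z hz
  rw [hz]; rfl

lemma KcLat.e_smul (hN : KcLat μ N) (c : ℝ) {f : (Fin n → Ω) × ℝ → ℝ} (hf : Measurable f) :
    N (fun z => ‖c * f z‖ₑ) = ‖c‖ₑ * N (fun z => ‖f z‖ₑ) := by
  rw [← hN.smul _ _ hf.enorm]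
  simp only [enorm_mul]

lemma KcLat.lp_smul (hN : KcLat μ N) (c : ℝ) (f : Lp ℝ 2 (kcZ μ n)) :
    N (fun z => ‖(c • f) z‖ₑ) = ‖c‖ₑ * N (fun z => ‖f z‖ₑ) := by
  rw [← hN.e_smul c (kcLp_l2 f).1]
  refine hN.congr ?_
  filter_upwards [Lp.coeFn_smul c f] with z hz
  rw [hz]; rfl

lemma kc_lp_norm (f : Lp ℝ 2 (kcZ μ n)) : kcn2 μ (fun z => ‖f z‖ₑ) = ‖f‖ₑ := by
  rw [Lp.enorm_def, eLpNorm_eq_lintegral_rpow_enorm_toReal (by norm_num) (by norm_num)]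
  simp [kcn2]

lemma kc_lp_inner (φ : Lp ℝ 2 (kcZ μ n)) {G : (Fin n → Ω) × ℝ → ℝ} (hG : KcL2 μ G) :
    inner ℝ φ (hG.2.toLp G) = ∫ z, G z * φ z ∂kcZ μ n := by
  rw [L2.inner_def]
  refine integral_congr_ae ?_
  filter_upwards [hG.2.coeFn_toLp] with z hz
  rw [hz]
  simp

lemma kc_core {w : Finset (Fin n) → ℝ} (hw0 : ∀ J, 0 ≤ w J) {C : ℝ} (hC0 : 0 < C) (hC : ∑ J, w J ≤ C)
    (hw : ∀ α : Finset (Fin n) → ℝ, (∀ I : Finset (Fin n), M < I.card → kcM α I = 0) →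
      √(∑ I, kcM α I ^ 2) ≤ ∑ J, w J * |α J|)
    {T : ℝ≥0∞} (hTT : T < ⊤) (hT0 : T ≠ 0)
    {F F0 F1 : (Fin n → Ω) × ℝ → ℝ} (hF : KcL2 μ F) (hV : KcInV μ M F) 
    (hF0 : Measurable F0) (hF1 : Measurable F1)
    (hdec : ∀ᵐ z ∂kcZ μ n, F z = F0 z + F1 z) {κ : ℝ≥0∞} (hκ0 : κ ≠ 0) (hκT : κ < ⊤)
    (hκ : kcn0 μ (fun z => ‖F0 z‖ₑ) + T * kcn1 μ (fun z => ‖F1 z‖ₑ) ≤ κ) :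
    ∃ g0 g1 : (Fin n → Ω) × ℝ → ℝ, KcL2 μ g0 ∧ KcL2 μ g1 ∧ KcInV μ M g0 ∧ KcInV μ M g1 ∧
      (∀ᵐ z ∂kcZ μ n, F z = g0 z + g1 z) ∧
      kcn0 μ (fun z => ‖g0 z‖ₑ) + T * kcn1 μ (fun z => ‖g1 z‖ₑ)
        ≤ 2 * (2 * kcL M * ENNReal.ofReal C * κ) := by
  have hL0 : kcL M ≠ 0 := by
    unfold kcL
    have : (4 * 8 ^ M : ℝ≥0∞) ≠ 0 := by positivity
    simp [this]
  have hLT : kcL M < ⊤ := ENNReal.rpow_lt_top_of_nonneg (by norm_num) (by finiteness)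
  set D := 2 * kcL M * ENNReal.ofReal C * κ with hD
  have hD0 : D ≠ 0 := by
    have : ENNReal.ofReal C ≠ 0 := by simpa using hC0
    rw [hD]
    exact mul_ne_zero (mul_ne_zero (mul_ne_zero (by norm_num) hL0) this) hκ0
  have hDT : D ≠ ⊤ := by
    rw [hD]
    exact (ENNReal.mul_lt_top (ENNReal.mul_lt_top (ENNReal.mul_lt_top (by finiteness) hLT)
      ENNReal.ofReal_lt_top) hκT).ne
  set R : ℝ := (2 * D).toReal with hR
  have h2D0 : 2 * D ≠ 0 := mul_ne_zero (by norm_num) hD0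
  have h2DT : 2 * D ≠ ⊤ := ENNReal.mul_ne_top (by norm_num) hDT
  have hR0 : 0 < R := ENNReal.toReal_pos h2D0 h2DT
  have hRe : ‖R‖ₑ = 2 * D := by
    rw [Real.enorm_of_nonneg hR0.le, ENNReal.ofReal_toReal h2DT]
  have hFV : hF.2.toLp F ∈ kcV n μ M := by
    refine hV.congr' ?_
    filter_upwards [hF.2.coeFn_toLp] with z hz
    rw [hz]
  by_cases hex : ∃ g0 ∈ kcV n μ M, ∃ g1 ∈ kcV n μ M, R⁻¹ • hF.2.toLp F = g0 + g1 ∧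
      kcn0 μ (fun z => ‖g0 z‖ₑ) + T * kcn1 μ (fun z => ‖g1 z‖ₑ) < 1
  · obtain ⟨g0, hg0, g1, hg1, he, hlt⟩ := hex
    refine ⟨fun z => R * g0 z, fun z => R * g1 z, (kcLp_l2 g0).smul R, (kcLp_l2 g1).smul R,
      KcInV.smul' hg0 R, KcInV.smul' hg1 R, ?_, ?_⟩
    · filter_upwards [hF.2.coeFn_toLp, Lp.coeFn_smul R⁻¹ (hF.2.toLp F), Lp.coeFn_add g0 g1]
        with z h1 h2 h3
      rw [he, h3, Pi.smul_apply, h1, Pi.add_apply, smul_eq_mul] at h2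
      rw [← mul_add, h2, ← mul_assoc, mul_inv_cancel₀ hR0.ne', one_mul]
    · rw [(kclat0 μ).e_smul R (kcLp_l2 g0).1, (kclat1 μ).e_smul R (kcLp_l2 g1).1, hRe]
      calc _ = 2 * D * (kcn0 μ (fun z => ‖g0 z‖ₑ) + T * kcn1 μ (fun z => ‖g1 z‖ₑ)) := by ring
        _ ≤ 2 * D * 1 := by gcongr
        _ = _ := mul_one _
  · exfalso
    obtain ⟨φ, hφ1, hφ2, hφ3⟩ := kc_dual (kcV n μ M)
      (fun g => kcn0 μ (fun z => ‖g z‖ₑ)) (fun g => kcn1 μ (fun z => ‖g z‖ₑ))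
      (fun f g => (kclat0 μ).lp_add f g) (fun c f => (kclat0 μ).lp_smul c f)
      (fun f g => (kclat1 μ).lp_add f g) (fun c f => (kclat1 μ).lp_smul c f)
      (fun f => (kcn1_le_n2 μ (kcLp_l2 f).1.enorm).trans (kc_lp_norm f).le) hTT
      ((kcV n μ M).smul_mem R⁻¹ hFV) hex
    have hmem : ∀ G (hG : KcL2 μ G), KcInV μ M G → hG.2.toLp G ∈ kcV n μ M := by
      intro G hG hGV
      refine hGV.congr' ?_
      filter_upwards [hG.2.coeFn_toLp] with z hz
      rw [hz]
    have hn : ∀ {N : ((Fin n → Ω) × ℝ → ℝ≥0∞) → ℝ≥0∞}, KcLat μ N → ∀ G (hG : KcL2 μ G),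
        N (fun z => ‖hG.2.toLp G z‖ₑ) = N (fun z => ‖G z‖ₑ) := by
      intro N hN G hG
      refine hN.congr ?_
      filter_upwards [hG.2.coeFn_toLp] with z hz
      rw [hz]
    have hm := kc_main hw0 hC hw (kcLp_l2 φ) hTT hT0
      (fun G hG hGV hfin => by
        have := hφ2 _ (hmem G hG hGV) (by rw [hn (kclat0 μ) G hG]; exact hfin)
        rw [kc_lp_inner φ hG, hn (kclat0 μ) G hG] at this
        rwa [one_mul])
      (fun G hG hGV hfin => by
        have := hφ3 _ (hmem G hG hGV) (by rw [hn (kclat1 μ) G hG]; exact hfin)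
        rwa [kc_lp_inner φ hG, hn (kclat1 μ) G hG] at this)
      hF hV hF0 hF1 hdec
    rw [← kc_lp_inner φ hF] at hm
    rw [real_inner_smul_right] at hφ1
    have h1 : inner ℝ φ (hF.2.toLp F) = R := by
      field_simp at hφ1
      linarith
    rw [h1] at hm
    have h2 : ENNReal.ofReal R = 2 * D := by rw [hR, ENNReal.ofReal_toReal h2DT]
    have h3 : 2 * D ≤ D := by
      rw [← h2]
      refine hm.trans ?_
      rw [hD]
      gcongr
    have h4 : D + D ≤ D + 0 := by rw [add_zero, ← two_mul]; exact h3
    exact hD0 (le_antisymm ((ENNReal.add_le_add_iff_left hDT).1 h4) zero_le)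

end core

/-- **K-closedness of `(V^1_{≤M}(Ω^n, L¹(ℝ)), V^1_{≤M}(Ω^n, L²(ℝ)))` in
`(L¹(Ω^n, L¹(ℝ)), L¹(Ω^n, L²(ℝ)))`** (Theorem `kclvml1` of the paper), with a constant
depending only on `M` and not on `n`. -/
theorem kClosed_V1leM_L1_L2 (M : ℕ) :
    ∃ C : ℝ, 0 < C ∧
      ∀ (Ω : Type u) [MeasurableSpace Ω] (μ : Measure Ω) [IsProbabilityMeasure μ]
        (n : ℕ) (F F₀ F₁ : (Fin n → Ω) → ℝ → ℝ) (t : ℝ), 0 < t →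
        (∃ u v : (Fin n → Ω) → ℝ → ℝ,
          MemV1leM μ M (normL1L1R μ) u ∧ MemV1leM μ M (normL1L2R μ) v ∧
          ∀ᵐ z ∂((Measure.pi fun _ : Fin n => μ).prod volume),
            F z.1 z.2 = u z.1 z.2 + v z.1 z.2) →
        Measurable (Function.uncurry F₀) → Measurable (Function.uncurry F₁) →
        normL1L1R μ F₀ < ⊤ → normL1L2R μ F₁ < ⊤ →
        (∀ᵐ z ∂((Measure.pi fun _ : Fin n => μ).prod volume),
          F z.1 z.2 = F₀ z.1 z.2 + F₁ z.1 z.2) →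
        ∃ G₀ G₁ : (Fin n → Ω) → ℝ → ℝ,
          MemV1leM μ M (normL1L1R μ) G₀ ∧ MemV1leM μ M (normL1L2R μ) G₁ ∧
          (∀ᵐ z ∂((Measure.pi fun _ : Fin n => μ).prod volume),
            F z.1 z.2 = G₀ z.1 z.2 + G₁ z.1 z.2) ∧
          normL1L1R μ G₀ + ENNReal.ofReal t * normL1L2R μ G₁
            ≤ ENNReal.ofReal C * (normL1L1R μ F₀ + ENNReal.ofReal t * normL1L2R μ F₁) := by
  obtain ⟨C, hC0, hCs⟩ := kc_square M
  have hLT : kcL M < ⊤ := ENNReal.rpow_lt_top_of_nonneg (by norm_num) (by finiteness)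
  set D : ℝ≥0∞ := 2 * (2 * kcL M * ENNReal.ofReal C * 2) + 1 with hD
  have hDT : D ≠ ⊤ := by
    rw [hD]
    refine ENNReal.add_ne_top.2 ⟨?_, by norm_num⟩
    exact (ENNReal.mul_lt_top (by finiteness) (ENNReal.mul_lt_top (ENNReal.mul_lt_top
      (ENNReal.mul_lt_top (by finiteness) hLT) ENNReal.ofReal_lt_top) (by finiteness))).ne
  have hD0 : D ≠ 0 := by rw [hD]; simp
  refine ⟨D.toReal, ENNReal.toReal_pos hD0 hDT, ?_⟩
  intro Ω _ μ _ n F F₀ F₁ t ht ⟨u, v, hu, hv, huv⟩ hF₀ hF₁ hn₀ hn₁ hdec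
  rw [ENNReal.ofReal_toReal hDT]
  obtain ⟨w, hw0, hwC, hw⟩ := hCs n
  set T := ENNReal.ofReal t with hT
  have hTT : T < ⊤ := ENNReal.ofReal_lt_top
  have hT0 : T ≠ 0 := by simpa [hT] using ht
  have hN0 := kclat0 (n := n) μ
  have hN1 := kclat1 (n := n) μ
  rw [kc_norm0 μ F₀ hF₀] at hn₀ ⊢
  rw [kc_norm1 μ F₁ hF₁] at hn₁ ⊢
  set κ := kcn0 μ (fun z => ‖Function.uncurry F₀ z‖ₑ)
    + T * kcn1 μ (fun z => ‖Function.uncurry F₁ z‖ₑ) with hκ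
  have hκT : κ < ⊤ := ENNReal.add_lt_top.2 ⟨hn₀, ENNReal.mul_lt_top hTT hn₁⟩
  have hdec' : ∀ᵐ z ∂kcZ μ n, F z.1 z.2 = Function.uncurry F₀ z + Function.uncurry F₁ z := hdec
  have huv' : ∀ᵐ z ∂kcZ μ n, F z.1 z.2 = Function.uncurry u z + Function.uncurry v z := huv
  have build : ∀ G0 G1 : (Fin n → Ω) × ℝ → ℝ, Measurable G0 → Measurable G1 →
      KcInV μ M G0 → KcInV μ M G1 → kcn1 μ (fun z => ‖G1 z‖ₑ) < ⊤ →
      (∀ᵐ z ∂kcZ μ n, F z.1 z.2 = G0 z + G1 z) →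
      kcn0 μ (fun z => ‖G0 z‖ₑ) + T * kcn1 μ (fun z => ‖G1 z‖ₑ) ≤ D * κ →
      ∃ G₀ G₁ : (Fin n → Ω) → ℝ → ℝ,
          MemV1leM μ M (normL1L1R μ) G₀ ∧ MemV1leM μ M (normL1L2R μ) G₁ ∧
          (∀ᵐ z ∂((Measure.pi fun _ : Fin n => μ).prod volume),
            F z.1 z.2 = G₀ z.1 z.2 + G₁ z.1 z.2) ∧
          normL1L1R μ G₀ + T * normL1L2R μ G₁ ≤ D * κ := by
    intro G0 G1 m0 m1 i0 i1 hfin1 hd hle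
    have hfin0 : kcn0 μ (fun z => ‖G0 z‖ₑ) < ⊤ :=
      (le_self_add.trans hle).trans_lt (ENNReal.mul_lt_top hDT.lt_top hκT)
    refine ⟨fun x s => G0 (x, s), fun x s => G1 (x, s),
      kc_mem_of_inV hN0 (kc_norm0 μ) m0 hfin0 i0, kc_mem_of_inV hN1 (kc_norm1 μ) m1 hfin1 i1,
      hd, ?_⟩
    rw [kc_norm0 μ (fun x s => G0 (x, s)) m0, kc_norm1 μ (fun x s => G1 (x, s)) m1]
    exact hle
  by_cases hκ0 : κ = 0
  · have h0 : kcn0 μ (fun z => ‖Function.uncurry F₀ z‖ₑ) = 0 := (add_eq_zero.1 hκ0).1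
    have h1 : kcn1 μ (fun z => ‖Function.uncurry F₁ z‖ₑ) = 0 :=
      (mul_eq_zero.1 (add_eq_zero.1 hκ0).2).resolve_left hT0
    refine build (fun _ => 0) (fun _ => 0) measurable_const measurable_const kc_inV_zero kc_inV_zero
      ?_ ?_ ?_
    · simp [hN1.null]
    · filter_upwards [hdec', hN0.zero _ hF₀.enorm h0, hN1.zero _ hF₁.enorm h1] with z h2 h3 h4
      rw [enorm_eq_zero] at h3 h4
      rw [h2, h3, h4]
    · simp [hN0.null, hN1.null]
  have hum : Measurable (Function.uncurry u) := hu.1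
  have hvm : Measurable (Function.uncurry v) := hv.1
  have hufin : kcn0 μ (fun z => ‖Function.uncurry u z‖ₑ) < ⊤ := by
    rw [← kc_norm0 μ u hum]; exact hu.2.1
  have hvfin : kcn1 μ (fun z => ‖Function.uncurry v z‖ₑ) < ⊤ := by
    rw [← kc_norm1 μ v hvm]; exact hv.2.1
  have huV := kc_inV_of_mem hN0 (kc_norm0 μ) hu
  have hvV := kc_inV_of_mem hN1 (kc_norm1 μ) hv
  set U := Function.uncurry u
  set W := Function.uncurry v
  have htend : Filter.Tendsto (fun k => kcn0 μ (fun z => ‖U z - kctrV μ M k U z‖ₑ)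
      + T * kcn1 μ (fun z => ‖W z - kctrV μ M k W z‖ₑ)) Filter.atTop (nhds 0) := by
    have h1 := kctrV_tend hN0 hum hufin huV
    have h2 := ENNReal.Tendsto.const_mul (a := T) (kctrV_tend hN1 hvm hvfin hvV) (Or.inr hTT.ne)
    simpa using h1.add h2
  obtain ⟨k, hk⟩ := (htend.eventually_lt_const (pos_iff_ne_zero.2 hκ0)).exists
  set Uk := kctrV μ M k U with hUk
  set Wk := kctrV μ M k W with hWk
  have hUk2 : KcL2 μ Uk := KcL2.mk (kctrV_meas k hum) (kctrV_fin (kclat2 μ) hum (kctr_n2 k hum))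
  have hWk2 : KcL2 μ Wk := KcL2.mk (kctrV_meas k hvm) (kctrV_fin (kclat2 μ) hvm (kctr_n2 k hvm))
  have hUkV : KcInV μ M Uk := kctrV_inV k hum
  have hWkV : KcInV μ M Wk := kctrV_inV k hvm
  have mdu : Measurable (fun z => U z - Uk z) := hum.sub hUk2.1
  have mdw : Measurable (fun z => W z - Wk z) := hvm.sub hWk2.1
  have hdu : KcInV μ M (fun z => U z - Uk z) := by
    have := KcInV.add' huV (hUkV.smul' (-1)) (hN0.good hum hufin) (hUk2.smul (-1)).good
    convert this using 2; ring
  have hdw : KcInV μ M (fun z => W z - Wk z) := by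
    have := KcInV.add' hvV (hWkV.smul' (-1)) (hN1.good hvm hvfin) (hWk2.smul (-1)).good
    convert this using 2; ring
  have fdu : kcn0 μ (fun z => ‖U z - Uk z‖ₑ) < ⊤ := (le_self_add.trans hk.le).trans_lt hκT
  have fdw : kcn1 μ (fun z => ‖W z - Wk z‖ₑ) < ⊤ :=
    (hN1.esub hvm hWk2.1).trans_lt (ENNReal.add_lt_top.2 ⟨hvfin,
      (kcn1_le_n2 μ hWk2.1.enorm).trans_lt hWk2.fin⟩)
  have hcost : kcn0 μ (fun z => ‖Function.uncurry F₀ z - (U z - Uk z)‖ₑ)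
      + T * kcn1 μ (fun z => ‖Function.uncurry F₁ z - (W z - Wk z)‖ₑ) ≤ 2 * κ := by
    calc _ ≤ (kcn0 μ (fun z => ‖Function.uncurry F₀ z‖ₑ) + kcn0 μ (fun z => ‖U z - Uk z‖ₑ))
          + T * (kcn1 μ (fun z => ‖Function.uncurry F₁ z‖ₑ) + kcn1 μ (fun z => ‖W z - Wk z‖ₑ)) := by
          gcongr
          · exact hN0.esub hF₀ mdu
          · exact hN1.esub hF₁ mdw
      _ = κ + (kcn0 μ (fun z => ‖U z - Uk z‖ₑ) + T * kcn1 μ (fun z => ‖W z - Wk z‖ₑ)) := by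
          rw [hκ]; ring
      _ ≤ κ + κ := by gcongr
      _ = 2 * κ := (two_mul κ).symm
  obtain ⟨g0, g1, l0, l1, i0, i1, hd, hle⟩ := kc_core (F := fun z => Uk z + Wk z)
    (F0 := fun z => Function.uncurry F₀ z - (U z - Uk z))
    (F1 := fun z => Function.uncurry F₁ z - (W z - Wk z)) (κ := 2 * κ)
    hw0 hC0 hwC hw hTT hT0 (hUk2.add hWk2)
    (KcInV.add' hUkV hWkV hUk2.good hWk2.good) (hF₀.sub mdu) (hF₁.sub mdw)
    (by
      filter_upwards [hdec', huv'] with z h1 h2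
      linarith)
    (mul_ne_zero (by norm_num) hκ0) (ENNReal.mul_lt_top (by norm_num) hκT) hcost
  refine build (fun z => g0 z + (U z - Uk z)) (fun z => g1 z + (W z - Wk z)) (l0.1.add mdu)
    (l1.1.add mdw) (KcInV.add' i0 hdu l0.good (hN0.good mdu fdu))
    (KcInV.add' i1 hdw l1.good (hN1.good mdw fdw)) ?_ ?_ ?_
  · exact (hN1.eadd l1.1 mdw).trans_lt (ENNReal.add_lt_top.2 
      ⟨(kcn1_le_n2 μ l1.1.enorm).trans_lt l1.fin, fdw⟩)
  · filter_upwards [hd, huv'] with z h1 h2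
    linarith
  · calc _ ≤ (kcn0 μ (fun z => ‖g0 z‖ₑ) + kcn0 μ (fun z => ‖U z - Uk z‖ₑ))
          + T * (kcn1 μ (fun z => ‖g1 z‖ₑ) + kcn1 μ (fun z => ‖W z - Wk z‖ₑ)) := by
          gcongr
          · exact hN0.eadd l0.1 mdu
          · exact hN1.eadd l1.1 mdw
      _ = (kcn0 μ (fun z => ‖g0 z‖ₑ) + T * kcn1 μ (fun z => ‖g1 z‖ₑ))
          + (kcn0 μ (fun z => ‖U z - Uk z‖ₑ) + T * kcn1 μ (fun z => ‖W z - Wk z‖ₑ)) := by ring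
      _ ≤ 2 * (2 * kcL M * ENNReal.ofReal C * (2 * κ)) + κ := by gcongr
      _ = D * κ := by rw [hD]; ring
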